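/- Suppose f is of Allee type (f_A), δ ∈ (θ*_f, 1), and (c*, q*) is a semi-wave pair for (f, δ, d). Let (u,g,h) be a classical solution of the free boundary problem (a) with initial datum u₀ ∈ X(h₀) on [0,∞). Then the solution converges to the semi-wave profile at each front: sup_{x ∈ [0, h(t)]} |u(t,x) − q*(h(t) − x)| → 0 and sup_{x ∈ [g(t), 0]} |u(t,x) − q*(x − g(t))| → 0 as t → ∞. -/

import Mathlib

open Set Filter

/-- A function `f` is of Allee type `(f_A)` with distinguished zero `θ ∈ [0,1)`. -/
def AlleeType (f : ℝ → ℝ) (θ : ℝ) : Prop :=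
  ContDiffOn ℝ 1 f (Ici (0:ℝ)) ∧ θ ∈ Ico (0:ℝ) 1 ∧
    f 0 = 0 ∧ f θ = 0 ∧ f 1 = 0 ∧
    derivWithin f (Ici (0:ℝ)) 0 ≤ 0 ∧ derivWithin f (Ici (0:ℝ)) 1 < 0 ∧
    (∀ u ∈ Icc (0:ℝ) θ, f u ≤ 0) ∧ (∀ u ∈ Ioo θ (1:ℝ), 0 < f u) ∧
    (∀ u ∈ Ioi (1:ℝ), f u < 0) ∧ 0 < ∫ s in (0:ℝ)..1, f s

/-- `θs` is the number `θ*_f ∈ [θ,1)` attached to an Allee type `f`. -/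
def IsThetaStar (f : ℝ → ℝ) (θ θs : ℝ) : Prop :=
  θs ∈ Ico θ (1:ℝ) ∧ (∫ s in (0:ℝ)..θs, f s) = 0 ∧
    ∀ u ∈ Ioc θs (1:ℝ), 0 < ∫ s in (0:ℝ)..u, f s

/-- Membership in the initial class `X(h₀)`. -/
def InX (δ h₀ : ℝ) (φ : ℝ → ℝ) : Prop :=
  ContDiffOn ℝ 2 φ (Icc (-h₀) h₀) ∧ φ (-h₀) = δ ∧ φ h₀ = δ ∧
    ∀ x ∈ Icc (-h₀) h₀, 0 < φ x

/-- A classical solution `(u,g,h)` of the free boundary problem (with reaction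
term `f = f(t,x,u)`) with initial datum `u₀ ∈ X(h₀)` on the time interval `I`. -/
structure ClassicalSolution (d δ h₀ : ℝ) (f : ℝ → ℝ → ℝ → ℝ) (u₀ : ℝ → ℝ)
    (I : Set ℝ) (u : ℝ → ℝ → ℝ) (g h : ℝ → ℝ) : Prop where
  g_reg : ContDiffOn ℝ 1 g I
  h_reg : ContDiffOn ℝ 1 h I
  g_lt_h : ∀ t ∈ I, g t < h t
  u_cont : ContinuousOn (fun p : ℝ × ℝ => u p.1 p.2)
      {p : ℝ × ℝ | p.1 ∈ I ∧ p.2 ∈ Icc (g p.1) (h p.1)}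
  ux_cont : ContinuousOn (fun p : ℝ × ℝ => deriv (u p.1) p.2)
      {p : ℝ × ℝ | p.1 ∈ I ∧ 0 < p.1 ∧ p.2 ∈ Icc (g p.1) (h p.1)}
  ut_diff : ∀ t ∈ I, 0 < t → ∀ x ∈ Ioo (g t) (h t),
      DifferentiableAt ℝ (fun s => u s x) t
  ux_diff : ∀ t ∈ I, 0 < t → ∀ x ∈ Icc (g t) (h t), DifferentiableAt ℝ (u t) x
  uxx_diff : ∀ t ∈ I, 0 < t → ∀ x ∈ Ioo (g t) (h t),
      DifferentiableAt ℝ (deriv (u t)) x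
  ut_cont : ContinuousOn (fun p : ℝ × ℝ => deriv (fun s => u s p.2) p.1)
      {p : ℝ × ℝ | p.1 ∈ I ∧ 0 < p.1 ∧ p.2 ∈ Ioo (g p.1) (h p.1)}
  uxx_cont : ContinuousOn (fun p : ℝ × ℝ => deriv (deriv (u p.1)) p.2)
      {p : ℝ × ℝ | p.1 ∈ I ∧ 0 < p.1 ∧ p.2 ∈ Ioo (g p.1) (h p.1)}
  pde : ∀ t ∈ I, 0 < t → ∀ x ∈ Ioo (g t) (h t),
      deriv (fun s => u s x) t = d * deriv (deriv (u t)) x + f t x (u t x)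
  bc_g : ∀ t ∈ I, 0 < t → u t (g t) = δ
  bc_h : ∀ t ∈ I, 0 < t → u t (h t) = δ
  stefan_g : ∀ t ∈ I, 0 < t → deriv g t = -(d / δ) * deriv (u t) (g t)
  stefan_h : ∀ t ∈ I, 0 < t → deriv h t = -(d / δ) * deriv (u t) (h t)
  g_init : g 0 = -h₀
  h_init : h 0 = h₀
  u_init : ∀ x ∈ Icc (-h₀) h₀, u 0 x = u₀ x

/-- A semi-wave pair `(c,q)` for `(f, δ, d)`. -/
def SemiWavePair (d δ : ℝ) (f : ℝ → ℝ) (c : ℝ) (q : ℝ → ℝ) : Prop :=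
  0 < c ∧ ContDiffOn ℝ 2 q (Ici (0:ℝ)) ∧
    (∀ z ∈ Ici (0:ℝ),
      d * derivWithin (derivWithin q (Ici (0:ℝ))) (Ici (0:ℝ)) z
        - c * derivWithin q (Ici (0:ℝ)) z + f (q z) = 0) ∧
    (∀ z ∈ Ioi (0:ℝ), 0 < q z) ∧ q 0 = δ ∧
    Tendsto q atTop (nhds 1) ∧
    derivWithin q (Ici (0:ℝ)) 0 = c * δ / d ∧
    ∀ z ∈ Ici (0:ℝ), 0 < derivWithin q (Ici (0:ℝ)) z

/-- Condition `(f2)` with Hölder exponent `β`. -/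
def CondF2 (f : ℝ → ℝ → ℝ → ℝ) (β : ℝ) : Prop :=
  β ∈ Ioo (0:ℝ) 1 ∧
    (∀ M > 0, ∃ C > 0, ∀ t₁ ∈ Ici (0:ℝ), ∀ t₂ ∈ Ici (0:ℝ), ∀ x₁ x₂ : ℝ,
        ∀ v ∈ Icc (0:ℝ) M,
        |f t₁ x₁ v - f t₂ x₂ v| ≤ C * (|t₁ - t₂| ^ (β / 2) + |x₁ - x₂| ^ β)) ∧
    (∀ t ∈ Ici (0:ℝ), ∀ x : ℝ, ContDiffOn ℝ 1 (f t x) (Ici (0:ℝ))) ∧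
    (∀ t ∈ Ici (0:ℝ), ∀ x : ℝ, f t x 0 = 0) ∧
    (∀ M > 0, ∃ L > 0, ∀ t ∈ Ici (0:ℝ), ∀ x : ℝ,
        ∀ v₁ ∈ Icc (0:ℝ) M, ∀ v₂ ∈ Icc (0:ℝ) M,
        |f t x v₁ - f t x v₂| ≤ L * |v₁ - v₂|)

/-- Condition `(f3)` with constant `M₀`. -/
def CondF3 (f : ℝ → ℝ → ℝ → ℝ) (M₀ : ℝ) : Prop :=
  0 < M₀ ∧ ∀ t ∈ Ici (0:ℝ), ∀ x : ℝ, ∀ v, M₀ ≤ v → f t x v < 0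

/-- Part (i) of condition `(f4)`, with upper bound function `fbar`. -/
def CondF4i (f : ℝ → ℝ → ℝ → ℝ) (fbar : ℝ → ℝ) (β : ℝ) : Prop :=
  CondF2 f β ∧ (∀ t ∈ Ici (0:ℝ), ∀ x : ℝ, f t x 1 = 0) ∧
    ContinuousOn fbar (Ici (1:ℝ)) ∧
    ∀ t ∈ Ici (0:ℝ), ∀ x : ℝ, ∀ v, 1 < v → f t x v ≤ fbar v ∧ fbar v < 0

/-- Condition `(f4)`, with bounds `fbar` (above, for `u > 1`) and
`funder` (below, of Allee type). -/
def CondF4 (f : ℝ → ℝ → ℝ → ℝ) (fbar funder : ℝ → ℝ) (θ β : ℝ) : Prop :=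
  CondF4i f fbar β ∧ AlleeType funder θ ∧
    ∀ t ∈ Ici (0:ℝ), ∀ x : ℝ, ∀ v, 0 ≤ v → funder v ≤ f t x v

/-- Combustion-type nonlinearity `(f_c)` with ignition value `θ`. -/
def CombustionType (f : ℝ → ℝ) (θ : ℝ) : Prop :=
  ContDiffOn ℝ 1 f (Ici (0:ℝ)) ∧ θ ∈ Ioo (0:ℝ) 1 ∧
    (∀ u ∈ Icc (0:ℝ) θ, f u = 0) ∧ f 1 = 0 ∧ derivWithin f (Ici (0:ℝ)) 1 < 0 ∧
    (∀ u ∈ Ioo θ (1:ℝ), 0 < f u) ∧ (∀ u ∈ Ioi (1:ℝ), f u < 0)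

/-- The (unnormalised) bistable condition `(F_b)` with constants `0 < P < Q`. -/
def CondFb (F : ℝ → ℝ) (P Q : ℝ) : Prop :=
  0 < P ∧ P < Q ∧ ContDiffOn ℝ 1 F (Ici (0:ℝ)) ∧
    F 0 = 0 ∧ F P = 0 ∧ F Q = 0 ∧
    derivWithin F (Ici (0:ℝ)) 0 < 0 ∧ derivWithin F (Ici (0:ℝ)) Q < 0 ∧
    (∀ u ∈ Ioo (0:ℝ) P, F u < 0) ∧ (∀ u ∈ Ioi Q, F u < 0) ∧
    (∀ u ∈ Ioo P Q, 0 < F u) ∧ 0 < ∫ s in (0:ℝ)..Q, F s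

section Part1

open Set Filter
open scoped Topology

/-- Second derivative test at a local minimum. -/
lemma second_deriv_nonneg {φ V : ℝ → ℝ} {B x : ℝ} (hmin : IsLocalMin φ x)
    (hφ : ∀ᶠ y in 𝓝 x, HasDerivAt φ (V y) y) (hV : HasDerivAt V B x) : 0 ≤ B := by
  have hV0 : V x = 0 := hmin.hasDerivAt_eq_zero hφ.self_of_nhds
  by_contra hB
  push Not at hB
  have hd : ∀ᶠ y in 𝓝 x, deriv φ y = V y := hφ.mono fun y hy => hy.deriv
  have hdd : deriv (deriv φ) x = B := by
    rw [Filter.EventuallyEq.deriv_eq hd]; exact hV.deriv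
  have hmax : IsLocalMax φ x := by
    apply isLocalMax_of_deriv_deriv_neg
    · rw [hdd]; exact hB
    · rw [hd.self_of_nhds, hV0]
    · exact hφ.self_of_nhds.continuousAt
  have hconst : ∀ᶠ y in 𝓝 x, φ y = φ x := by
    filter_upwards [hmin, hmax] with y h1 h2
    exact le_antisymm h2 h1
  have hV00 : ∀ᶠ y in 𝓝 x, V y = 0 := by
    filter_upwards [hconst.eventually_nhds, hφ] with y h1 h2
    have : HasDerivAt φ 0 y := (hasDerivAt_const y (φ x)).congr_of_eventuallyEq h1
    exact h2.unique this
  have : HasDerivAt V 0 x := (hasDerivAt_const x (0:ℝ)).congr_of_eventuallyEq hV00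
  have := hV.unique this
  linarith

/-- A derivative sign at the first zero in time. -/
lemma deriv_nonpos_of_left {φ : ℝ → ℝ} {A t : ℝ} (h : HasDerivAt φ A t)
    (hpos : ∀ᶠ s in 𝓝[<] t, φ t ≤ φ s) : A ≤ 0 := by
  have h1 : Tendsto (slope φ t) (𝓝[<] t) (𝓝 A) :=
    h.tendsto_slope.mono_left (nhdsWithin_mono _ (fun y hy => ne_of_lt hy))
  refine le_of_tendsto h1 ?_
  filter_upwards [hpos, self_mem_nhdsWithin] with s hs hlt
  rw [slope_def_field]
  have : s < t := hlt
  exact div_nonpos_of_nonneg_of_nonpos (by linarith) (by linarith)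

/-- Abstract parabolic minimum principle on a moving domain. -/
lemma min_principle {d T T' : ℝ} (hd : 0 < d) {l r : ℝ → ℝ} {w : ℝ → ℝ → ℝ}
    (hl : ContinuousOn l (Icc T T')) (hr : ContinuousOn r (Icc T T'))
    (hw : ContinuousOn (fun p : ℝ × ℝ => w p.1 p.2)
      {p : ℝ × ℝ | p.1 ∈ Icc T T' ∧ p.2 ∈ Icc (l p.1) (r p.1)})
    (h0 : ∀ x ∈ Icc (l T) (r T), 0 < w T x)
    (hbl : ∀ t ∈ Ioc T T', l t ≤ r t → 0 < w t (l t))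
    (hbr : ∀ t ∈ Ioc T T', l t ≤ r t → 0 < w t (r t))
    (hint : ∀ t ∈ Ioc T T', ∀ x ∈ Ioo (l t) (r t), w t x = 0 → ∃ (A B : ℝ) (V : ℝ → ℝ),
      HasDerivAt (fun s => w s x) A t ∧ (∀ᶠ y in 𝓝 x, HasDerivAt (w t) (V y) y) ∧
      HasDerivAt V B x ∧ d * B < A) :
    ∀ t ∈ Icc T T', ∀ x ∈ Icc (l t) (r t), 0 < w t x := by
  set D : Set (ℝ × ℝ) := {p : ℝ × ℝ | p.1 ∈ Icc T T' ∧ p.2 ∈ Icc (l p.1) (r p.1)} with hD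
  set S : Set (ℝ × ℝ) := {p : ℝ × ℝ | p.1 ∈ Icc T T'} with hS
  have hSc : IsClosed S := isClosed_Icc.preimage continuous_fst
  have hlS : ContinuousOn (fun p : ℝ × ℝ => l p.1) S :=
    hl.comp continuous_fst.continuousOn (fun p hp => hp)
  have hrS : ContinuousOn (fun p : ℝ × ℝ => r p.1) S :=
    hr.comp continuous_fst.continuousOn (fun p hp => hp)
  have hDc : IsClosed D := by
    have e : D = {p ∈ S | l p.1 ≤ p.2} ∩ {p ∈ S | p.2 ≤ r p.1} := by
      ext p; simp only [hD, hS, mem_setOf_eq, mem_inter_iff, mem_Icc]; tauto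
    rw [e]
    exact (hSc.isClosed_le hlS continuous_snd.continuousOn).inter
      (hSc.isClosed_le continuous_snd.continuousOn hrS)
  obtain ⟨ml, hml⟩ := (isCompact_Icc.image_of_continuousOn hl).bddBelow
  obtain ⟨mr, hmr⟩ := (isCompact_Icc.image_of_continuousOn hr).bddAbove
  have hDk : IsCompact D := by
    refine ((isCompact_Icc (a := T) (b := T')).prod (isCompact_Icc (a := ml) (b := mr))).of_isClosed_subset hDc ?_
    rintro ⟨t, x⟩ ⟨ht, hx⟩
    exact ⟨ht, (hml (mem_image_of_mem l ht)).trans hx.1, hx.2.trans (hmr (mem_image_of_mem r ht))⟩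
  set N : Set (ℝ × ℝ) := {p ∈ D | w p.1 p.2 ≤ 0} with hN
  have hNc : IsClosed N := hDc.isClosed_le hw continuousOn_const
  have hNk : IsCompact N := hDk.of_isClosed_subset hNc (fun p hp => hp.1)
  by_contra hcon
  push Not at hcon
  obtain ⟨t1, ht1, x1, hx1, hw1⟩ := hcon
  have hNne : N.Nonempty := ⟨(t1, x1), ⟨ht1, hx1⟩, hw1⟩
  obtain ⟨⟨t, x⟩, ⟨⟨ht, hx⟩, hwle⟩, hmin⟩ := hNk.exists_isMinOn hNne continuous_fst.continuousOn
  simp only at ht hx hwle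
  have hpos : ∀ s ∈ Ico T t, ∀ y ∈ Icc (l s) (r s), 0 < w s y := by
    intro s hs y hy
    by_contra hc
    push Not at hc
    have hm : ((s, y) : ℝ × ℝ) ∈ N := ⟨⟨⟨hs.1, hs.2.le.trans ht.2⟩, hy⟩, hc⟩
    have := hmin hm
    simp only [mem_setOf_eq] at this
    linarith [hs.2]
  have hTt : T < t := by
    rcases ht.1.lt_or_eq with h | h
    · exact h
    · subst h; exact absurd (h0 x hx) (not_lt.2 hwle)
  have htI : t ∈ Ioc T T' := ⟨hTt, ht.2⟩
  have hlr : l t ≤ r t := hx.1.trans hx.2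
  have hxl : l t < x := by
    rcases hx.1.lt_or_eq with h | h
    · exact h
    · rw [← h] at hwle; exact absurd (hbl t htI hlr) (not_lt.2 hwle)
  have hxr : x < r t := by
    rcases hx.2.lt_or_eq with h | h
    · exact h
    · rw [h] at hwle; exact absurd (hbr t htI hlr) (not_lt.2 hwle)
  have hmemleft : ∀ᶠ s in 𝓝[<] t, s ∈ Ico T t := by
    filter_upwards [Ioo_mem_nhdsLT hTt] with s hs using ⟨hs.1.le, hs.2⟩
  have hle : 𝓝[<] t ≤ 𝓝[Icc T T'] t := by
    refine nhdsWithin_le_iff.2 ?_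
    filter_upwards [hmemleft] with s hs using ⟨hs.1, hs.2.le.trans ht.2⟩
  have hDleft : ∀ y ∈ Ioo (l t) (r t), ∀ᶠ s in 𝓝[<] t, s ∈ Ico T t ∧ y ∈ Icc (l s) (r s) := by
    intro y hy
    have e1 : ∀ᶠ s in 𝓝[<] t, l s < y := ((hl t ht).mono_left hle).eventually_lt_const hy.1
    have e2 : ∀ᶠ s in 𝓝[<] t, y < r s := ((hr t ht).mono_left hle).eventually_const_lt hy.2
    filter_upwards [hmemleft, e1, e2] with s h1 h2 h3 using ⟨h1, h2.le, h3.le⟩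
  have hge : ∀ y ∈ Ioo (l t) (r t), 0 ≤ w t y := by
    intro y hy
    have hc : Tendsto (fun s => w s y) (𝓝[<] t) (𝓝 (w t y)) := by
      have hc1 := hw (t, y) ⟨ht, hy.1.le, hy.2.le⟩
      have hc2 : Tendsto (fun s : ℝ => ((s, y) : ℝ × ℝ)) (𝓝[<] t) (𝓝[D] (t, y)) := by
        refine tendsto_nhdsWithin_iff.2 ⟨?_, ?_⟩
        · have : ContinuousAt (fun s : ℝ => ((s, y) : ℝ × ℝ)) t := by fun_prop
          exact this.tendsto.mono_left nhdsWithin_le_nhds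
        · filter_upwards [hDleft y hy] with s hs
          exact ⟨⟨hs.1.1, hs.1.2.le.trans ht.2⟩, hs.2⟩
      exact hc1.tendsto.comp hc2
    refine ge_of_tendsto hc ?_
    filter_upwards [hDleft y hy] with s hs using (hpos s hs.1 y hs.2).le
  have hw0 : w t x = 0 := le_antisymm hwle (hge x ⟨hxl, hxr⟩)
  obtain ⟨A, B, V, hA, hV, hB, hAB⟩ := hint t htI x ⟨hxl, hxr⟩ hw0
  have hA0 : A ≤ 0 := by
    refine deriv_nonpos_of_left hA ?_
    filter_upwards [hDleft x ⟨hxl, hxr⟩] with s hs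
    rw [hw0]; exact (hpos s hs.1 x hs.2).le
  have hB0 : 0 ≤ B := by
    refine second_deriv_nonneg ?_ hV hB
    filter_upwards [Ioo_mem_nhds hxl hxr] with y hy
    rw [hw0]; exact hge y hy
  nlinarith

end Part1

section Part2

open Set Filter
open scoped Topology

/-- Working form of a classical solution. -/
structure Sol (d δ : ℝ) (f : ℝ → ℝ) (u : ℝ → ℝ → ℝ) (g h : ℝ → ℝ) : Prop where
  gcont : ContinuousOn g (Ici 0)
  hcont : ContinuousOn h (Ici 0)
  glt : ∀ t, 0 ≤ t → g t < h t
  ucont : ContinuousOn (fun p : ℝ × ℝ => u p.1 p.2)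
      {p : ℝ × ℝ | 0 ≤ p.1 ∧ p.2 ∈ Icc (g p.1) (h p.1)}
  int : ∀ t, 0 < t → ∀ x ∈ Ioo (g t) (h t), ∃ (A B : ℝ) (V : ℝ → ℝ),
      HasDerivAt (fun s => u s x) A t ∧ (∀ᶠ y in 𝓝 x, HasDerivAt (u t) (V y) y) ∧
      HasDerivAt V B x ∧ A = d * B + f (u t x)
  bg : ∀ t, 0 ≤ t → u t (g t) = δ
  bh : ∀ t, 0 ≤ t → u t (h t) = δ
  hder : ∀ t, 0 < t → ∃ m, HasDerivAt (u t) m (h t) ∧ HasDerivAt h (-(d / δ) * m) t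
  gder : ∀ t, 0 < t → ∃ m, HasDerivAt (u t) m (g t) ∧ HasDerivAt g (-(d / δ) * m) t
  upos0 : ∀ x ∈ Icc (g 0) (h 0), 0 < u 0 x

lemma ClassicalSolution.toSol {d δ h₀ : ℝ} {f u₀ : ℝ → ℝ} {u : ℝ → ℝ → ℝ} {g h : ℝ → ℝ}
    (hh₀ : 0 < h₀) (hu₀ : InX δ h₀ u₀)
    (hs : ClassicalSolution d δ h₀ (fun _ _ v => f v) u₀ (Ici (0:ℝ)) u g h) :
    Sol d δ f u g h where
  gcont := hs.g_reg.continuousOn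
  hcont := hs.h_reg.continuousOn
  glt := fun t ht => hs.g_lt_h t ht
  ucont := hs.u_cont
  int := by
    intro t ht x hx
    refine ⟨deriv (fun s => u s x) t, deriv (deriv (u t)) x, deriv (u t), ?_, ?_, ?_, ?_⟩
    · exact (hs.ut_diff t ht.le ht x hx).hasDerivAt
    · filter_upwards [Ioo_mem_nhds hx.1 hx.2] with y hy
      exact (hs.ux_diff t ht.le ht y ⟨hy.1.le, hy.2.le⟩).hasDerivAt
    · exact (hs.uxx_diff t ht.le ht x hx).hasDerivAt
    · exact hs.pde t ht.le ht x hx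
  bg := by
    intro t ht
    rcases ht.lt_or_eq with h1 | h1
    · exact hs.bc_g t ht h1
    · subst h1
      rw [hs.g_init, hs.u_init _ ⟨le_refl _, by linarith⟩]; exact hu₀.2.1
  bh := by
    intro t ht
    rcases ht.lt_or_eq with h1 | h1
    · exact hs.bc_h t ht h1
    · subst h1
      rw [hs.h_init, hs.u_init _ ⟨by linarith, le_refl _⟩]; exact hu₀.2.2.1
  hder := by
    intro t ht
    refine ⟨deriv (u t) (h t), ?_, ?_⟩
    · exact (hs.ux_diff t ht.le ht _ ⟨(hs.g_lt_h t ht.le).le, le_refl _⟩).hasDerivAt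
    · rw [← hs.stefan_h t ht.le ht]
      have h1 := (hs.h_reg.differentiableOn one_ne_zero) t ht.le
      exact (h1.differentiableAt (Ici_mem_nhds ht)).hasDerivAt
  gder := by
    intro t ht
    refine ⟨deriv (u t) (g t), ?_, ?_⟩
    · exact (hs.ux_diff t ht.le ht _ ⟨le_refl _, (hs.g_lt_h t ht.le).le⟩).hasDerivAt
    · rw [← hs.stefan_g t ht.le ht]
      have h1 := (hs.g_reg.differentiableOn one_ne_zero) t ht.le
      exact (h1.differentiableAt (Ici_mem_nhds ht)).hasDerivAt
  upos0 := by
    intro x hx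
    rw [hs.g_init, hs.h_init] at hx
    rw [hs.u_init x hx]; exact hu₀.2.2.2 x hx

/-- Reflection of a solution. -/
lemma Sol.refl {d δ : ℝ} {f : ℝ → ℝ} {u : ℝ → ℝ → ℝ} {g h : ℝ → ℝ} (S : Sol d δ f u g h) :
    Sol d δ f (fun t x => u t (-x)) (fun t => -h t) (fun t => -g t) where
  gcont := S.hcont.neg
  hcont := S.gcont.neg
  glt := fun t ht => neg_lt_neg (S.glt t ht)
  ucont := by
    have h1 : ContinuousOn (fun p : ℝ × ℝ => ((p.1, -p.2) : ℝ × ℝ))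
        {p : ℝ × ℝ | 0 ≤ p.1 ∧ p.2 ∈ Icc (-h p.1) (-g p.1)} := by fun_prop
    refine S.ucont.comp h1 ?_
    rintro p ⟨hp, hp1, hp2⟩
    exact ⟨hp, by simp only; linarith, by simp only; linarith⟩
  int := by
    intro t ht x hx
    obtain ⟨A, B, V, hA, hV, hB, e⟩ := S.int t ht (-x) ⟨by linarith [hx.2], by linarith [hx.1]⟩
    refine ⟨A, B, fun y => -V (-y), hA, ?_, ?_, e⟩
    · have hc : Tendsto (fun y : ℝ => -y) (𝓝 x) (𝓝 (-x)) := continuous_neg.tendsto x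
      filter_upwards [hc.eventually hV] with y hy
      have := HasDerivAt.comp y hy (hasDerivAt_neg y)
      simpa [Function.comp_def] using this
    · have := (HasDerivAt.comp x hB (hasDerivAt_neg x)).fun_neg
      simpa [Function.comp_def] using this
  bg := fun t ht => by simpa using S.bh t ht
  bh := fun t ht => by simpa using S.bg t ht
  hder := by
    intro t ht
    obtain ⟨m, h1, h2⟩ := S.gder t ht
    refine ⟨-m, ?_, ?_⟩
    · have h1' : HasDerivAt (u t) m (- -g t) := by simpa using h1
      have := HasDerivAt.comp (-g t) h1' (hasDerivAt_neg (-g t))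
      simpa [Function.comp_def] using this
    · have e : -(d / δ) * -m = -(-(d / δ) * m) := by ring
      rw [e]; exact h2.fun_neg
  gder := by
    intro t ht
    obtain ⟨m, h1, h2⟩ := S.hder t ht
    refine ⟨-m, ?_, ?_⟩
    · have h1' : HasDerivAt (u t) m (- -h t) := by simpa using h1
      have := HasDerivAt.comp (-h t) h1' (hasDerivAt_neg (-h t))
      simpa [Function.comp_def] using this
    · have e : -(d / δ) * -m = -(-(d / δ) * m) := by ring
      rw [e]; exact h2.fun_neg
  upos0 := fun x hx => S.upos0 (-x) ⟨by linarith [hx.2], by linarith [hx.1]⟩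

section
variable {d δ : ℝ} {f : ℝ → ℝ} {u : ℝ → ℝ → ℝ} {g h : ℝ → ℝ}

/-- Comparison with a strict subsolution on a moving subdomain. -/
lemma Sol.lower (S : Sol d δ f u g h) (hd : 0 < d) {T T' : ℝ} (hT : 0 ≤ T) {l r : ℝ → ℝ}
    {U : ℝ → ℝ → ℝ}
    (hl : ContinuousOn l (Icc T T')) (hr : ContinuousOn r (Icc T T'))
    (hgl : ∀ t ∈ Icc T T', g t ≤ l t) (hrh : ∀ t ∈ Icc T T', r t ≤ h t)
    (hU : ContinuousOn (fun p : ℝ × ℝ => U p.1 p.2)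
      {p : ℝ × ℝ | p.1 ∈ Icc T T' ∧ p.2 ∈ Icc (l p.1) (r p.1)})
    (h0 : ∀ x ∈ Icc (l T) (r T), U T x < u T x)
    (hbl : ∀ t ∈ Ioc T T', l t ≤ r t → U t (l t) < u t (l t))
    (hbr : ∀ t ∈ Ioc T T', l t ≤ r t → U t (r t) < u t (r t))
    (hint : ∀ t ∈ Ioc T T', ∀ x ∈ Ioo (l t) (r t), u t x = U t x → ∃ (A B : ℝ) (V : ℝ → ℝ),
      HasDerivAt (fun s => U s x) A t ∧ (∀ᶠ y in 𝓝 x, HasDerivAt (U t) (V y) y) ∧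
      HasDerivAt V B x ∧ A < d * B + f (U t x)) :
    ∀ t ∈ Icc T T', ∀ x ∈ Icc (l t) (r t), U t x < u t x := by
  have key := min_principle (w := fun t x => u t x - U t x) hd hl hr ?_ ?_ ?_ ?_ ?_
  · intro t ht x hx
    have := key t ht x hx
    linarith
  · refine ContinuousOn.sub (S.ucont.mono ?_) hU
    rintro p ⟨hp, hp2⟩
    exact ⟨hT.trans hp.1, (hgl _ hp).trans hp2.1, hp2.2.trans (hrh _ hp)⟩
  · intro x hx; have := h0 x hx; linarith
  · intro t ht hlr; have := hbl t ht hlr; linarith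
  · intro t ht hlr; have := hbr t ht hlr; linarith
  · intro t ht x hx hw
    have hw' : u t x = U t x := by linarith
    have htI : t ∈ Icc T T' := ⟨ht.1.le, ht.2⟩
    obtain ⟨A, B, V, hA, hV, hB, hlt⟩ := hint t ht x hx hw'
    obtain ⟨A1, B1, V1, hA1, hV1, hB1, e1⟩ := S.int t (hT.trans_lt ht.1) x
      ⟨(hgl t htI).trans_lt hx.1, hx.2.trans_le (hrh t htI)⟩
    refine ⟨A1 - A, B1 - B, fun y => V1 y - V y, hA1.sub hA, ?_, hB1.sub hB, ?_⟩
    · filter_upwards [hV, hV1] with y h1 h2 using h2.sub h1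
    · rw [e1, hw']; linarith

/-- Comparison with a strict supersolution on a moving subdomain. -/
lemma Sol.upper (S : Sol d δ f u g h) (hd : 0 < d) {T T' : ℝ} (hT : 0 ≤ T) {l r : ℝ → ℝ}
    {U : ℝ → ℝ → ℝ}
    (hl : ContinuousOn l (Icc T T')) (hr : ContinuousOn r (Icc T T'))
    (hgl : ∀ t ∈ Icc T T', g t ≤ l t) (hrh : ∀ t ∈ Icc T T', r t ≤ h t)
    (hU : ContinuousOn (fun p : ℝ × ℝ => U p.1 p.2)
      {p : ℝ × ℝ | p.1 ∈ Icc T T' ∧ p.2 ∈ Icc (l p.1) (r p.1)})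
    (h0 : ∀ x ∈ Icc (l T) (r T), u T x < U T x)
    (hbl : ∀ t ∈ Ioc T T', l t ≤ r t → u t (l t) < U t (l t))
    (hbr : ∀ t ∈ Ioc T T', l t ≤ r t → u t (r t) < U t (r t))
    (hint : ∀ t ∈ Ioc T T', ∀ x ∈ Ioo (l t) (r t), u t x = U t x → ∃ (A B : ℝ) (V : ℝ → ℝ),
      HasDerivAt (fun s => U s x) A t ∧ (∀ᶠ y in 𝓝 x, HasDerivAt (U t) (V y) y) ∧
      HasDerivAt V B x ∧ d * B + f (U t x) < A) :
    ∀ t ∈ Icc T T', ∀ x ∈ Icc (l t) (r t), u t x < U t x := by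
  have key := min_principle (w := fun t x => U t x - u t x) hd hl hr ?_ ?_ ?_ ?_ ?_
  · intro t ht x hx
    have := key t ht x hx
    linarith
  · refine ContinuousOn.sub hU (S.ucont.mono ?_)
    rintro p ⟨hp, hp2⟩
    exact ⟨hT.trans hp.1, (hgl _ hp).trans hp2.1, hp2.2.trans (hrh _ hp)⟩
  · intro x hx; have := h0 x hx; linarith
  · intro t ht hlr; have := hbl t ht hlr; linarith
  · intro t ht hlr; have := hbr t ht hlr; linarith
  · intro t ht x hx hw
    have hw' : u t x = U t x := by linarith
    have htI : t ∈ Icc T T' := ⟨ht.1.le, ht.2⟩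
    obtain ⟨A, B, V, hA, hV, hB, hlt⟩ := hint t ht x hx hw'
    obtain ⟨A1, B1, V1, hA1, hV1, hB1, e1⟩ := S.int t (hT.trans_lt ht.1) x
      ⟨(hgl t htI).trans_lt hx.1, hx.2.trans_le (hrh t htI)⟩
    refine ⟨A - A1, B - B1, fun y => V y - V1 y, hA.sub hA1, ?_, hB.sub hB1, ?_⟩
    · filter_upwards [hV, hV1] with y h1 h2 using h1.sub h2
    · rw [e1, hw']; linarith

/-- First time at which a positive continuous function vanishes. -/
lemma first_time {φ : ℝ → ℝ} {T T' : ℝ} (hφ : ContinuousOn φ (Icc T T')) (h0 : 0 < φ T)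
    (hneg : ∃ t ∈ Icc T T', φ t ≤ 0) :
    ∃ t ∈ Ioc T T', φ t = 0 ∧ ∀ s ∈ Ico T t, 0 < φ s := by
  set N : Set ℝ := {t ∈ Icc T T' | φ t ≤ 0} with hN
  have hNc : IsClosed N := isClosed_Icc.isClosed_le hφ continuousOn_const
  have hNk : IsCompact N := isCompact_Icc.of_isClosed_subset hNc (fun p hp => hp.1)
  obtain ⟨t1, ht1, h1⟩ := hneg
  obtain ⟨t, ⟨ht, hφt⟩, hmin⟩ := hNk.exists_isMinOn ⟨t1, ht1, h1⟩ continuous_id.continuousOn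
  have hpos : ∀ s ∈ Ico T t, 0 < φ s := by
    intro s hs
    by_contra hc
    push Not at hc
    have hm : s ∈ N := ⟨⟨hs.1, hs.2.le.trans ht.2⟩, hc⟩
    have h2 : t ≤ s := hmin hm
    exact absurd hs.2 (not_lt.2 h2)
  have hTt : T < t := by
    rcases ht.1.lt_or_eq with h | h
    · exact h
    · subst h; exact absurd h0 (not_lt.2 hφt)
  refine ⟨t, ⟨hTt, ht.2⟩, le_antisymm hφt ?_, hpos⟩
  have hle : 𝓝[<] t ≤ 𝓝[Icc T T'] t := by
    refine nhdsWithin_le_iff.2 ?_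
    filter_upwards [Ioo_mem_nhdsLT hTt] with s hs using ⟨hs.1.le, hs.2.le.trans ht.2⟩
  refine ge_of_tendsto ((hφ t ht).mono_left hle) ?_
  filter_upwards [Ioo_mem_nhdsLT hTt] with s hs using (hpos s ⟨hs.1.le, hs.2⟩).le

/-- Slope comparison at the right end. -/
lemma slope_right {φ ψ : ℝ → ℝ} {m n a x : ℝ} (hax : a < x) (hφ : HasDerivAt φ m x)
    (hψ : HasDerivAt ψ n x) (he : φ x = ψ x) (hle : ∀ y ∈ Ioo a x, ψ y ≤ φ y) : m ≤ n := by
  have h1 := deriv_nonpos_of_left (hφ.sub hψ) ?_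
  · linarith
  · filter_upwards [Ioo_mem_nhdsLT hax] with s hs
    have := hle s hs
    simp only [Pi.sub_apply]; linarith

/-- Closure in time of a strict inequality. -/
lemma Sol.le_of_left (S : Sol d δ f u g h) {T t x : ℝ} (hT : 0 ≤ T) (ht : T < t) {U : ℝ → ℝ → ℝ}
    (hx : x ∈ Ioo (g t) (h t)) (hU : ContinuousAt (fun s => U s x) t) :
    Tendsto (fun s => u s x - U s x) (𝓝[<] t) (𝓝 (u t x - U t x)) := by
  refine Tendsto.sub ?_ (hU.tendsto.mono_left nhdsWithin_le_nhds)
  have ht0 : t ∈ Ici (0:ℝ) := hT.trans ht.le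
  have hc1 := S.ucont (t, x) ⟨ht0, hx.1.le, hx.2.le⟩
  have hle : 𝓝[<] t ≤ 𝓝[Ici 0] t := by
    refine nhdsWithin_le_iff.2 ?_
    filter_upwards [Ioo_mem_nhdsLT ht] with s hs using hT.trans hs.1.le
  have hc2 : Tendsto (fun s : ℝ => ((s, x) : ℝ × ℝ)) (𝓝[<] t)
      (𝓝[{p : ℝ × ℝ | 0 ≤ p.1 ∧ p.2 ∈ Icc (g p.1) (h p.1)}] (t, x)) := by
    refine tendsto_nhdsWithin_iff.2 ⟨?_, ?_⟩
    · have : ContinuousAt (fun s : ℝ => ((s, x) : ℝ × ℝ)) t := by fun_prop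
      exact this.tendsto.mono_left nhdsWithin_le_nhds
    · have e1 : ∀ᶠ s in 𝓝[<] t, g s < x := ((S.gcont t ht0).mono_left hle).eventually_lt_const hx.1
      have e2 : ∀ᶠ s in 𝓝[<] t, x < h s := ((S.hcont t ht0).mono_left hle).eventually_const_lt hx.2
      filter_upwards [e1, e2, Ioo_mem_nhdsLT ht] with s h1 h2 h3
      exact ⟨hT.trans h3.1.le, h1.le, h2.le⟩
  exact hc1.tendsto.comp hc2

/-- Free boundary comparison from below, at the right front. -/
lemma Sol.fb_lower (S : Sol d δ f u g h) (hd : 0 < d) (hδ : 0 < δ) {T T' L : ℝ} (hT : 0 ≤ T)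
    {H : ℝ → ℝ} {U : ℝ → ℝ → ℝ} (hH : Continuous H)
    (hU : Continuous (fun p : ℝ × ℝ => U p.1 p.2))
    (hgL : ∀ t ∈ Icc T T', g t < L) (hLH : ∀ t ∈ Icc T T', L < H t)
    (hud : ∀ t ∈ Icc T T', ∀ x ∈ Ioo (g t) (h t), δ < u t x)
    (hUH : ∀ t ∈ Icc T T', U t (H t) = δ)
    (hfront : ∀ t ∈ Ioc T T', ∃ Hp m, HasDerivAt H Hp t ∧ HasDerivAt (U t) m (H t) ∧
      Hp < -(d / δ) * m)
    (h0 : H T < h T) (hU0 : ∀ x ∈ Icc L (H T), U T x < u T x)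
    (hUL : ∀ t ∈ Icc T T', U t L < u t L)
    (hint : ∀ t ∈ Ioc T T', ∀ x ∈ Ioo L (H t), u t x = U t x → ∃ (A B : ℝ) (V : ℝ → ℝ),
      HasDerivAt (fun s => U s x) A t ∧ (∀ᶠ y in 𝓝 x, HasDerivAt (U t) (V y) y) ∧
      HasDerivAt V B x ∧ A < d * B + f (U t x)) :
    ∀ t ∈ Icc T T', H t < h t ∧ ∀ x ∈ Icc L (H t), U t x < u t x := by
  have base : ∀ t1, t1 ≤ T' → (∀ t ∈ Icc T t1, H t < h t) →
      ∀ t ∈ Icc T t1, ∀ x ∈ Icc L (H t), U t x < u t x := by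
    intro t1 ht1 hHh
    have sub : ∀ t, t ∈ Icc T t1 → t ∈ Icc T T' := fun t ht => ⟨ht.1, ht.2.trans ht1⟩
    refine S.lower hd hT (l := fun _ => L) (r := H) continuousOn_const hH.continuousOn ?_ ?_
      hU.continuousOn hU0 ?_ ?_ ?_
    · intro t ht; exact (hgL t (sub t ht)).le
    · intro t ht; exact (hHh t ht).le
    · intro t ht _; exact hUL t (sub t ⟨ht.1.le, ht.2⟩)
    · intro t ht _
      have ht' : t ∈ Icc T t1 := ⟨ht.1.le, ht.2⟩
      rw [hUH t (sub t ht')]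
      exact hud t (sub t ht') _ ⟨(hgL t (sub t ht')).trans (hLH t (sub t ht')), hHh t ht'⟩
    · intro t ht x hx e
      exact hint t ⟨ht.1, ht.2.trans ht1⟩ x hx e
  have hHh : ∀ t ∈ Icc T T', H t < h t := by
    by_contra hcon
    push Not at hcon
    obtain ⟨t1, ht1, h1⟩ := hcon
    have hc : ContinuousOn (fun t => h t - H t) (Icc T T') :=
      (S.hcont.mono (fun t ht => hT.trans ht.1)).sub hH.continuousOn
    obtain ⟨t, ht, ht0, hpos⟩ := first_time hc (by linarith) ⟨t1, ht1, by linarith⟩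
    have htI : t ∈ Icc T T' := ⟨ht.1.le, ht.2⟩
    have ehH : h t = H t := by linarith
    have hprev : ∀ s ∈ Ico T t, ∀ x ∈ Icc L (H s), U s x < u s x := by
      intro s hs x hx
      exact base s (hs.2.le.trans ht.2) (fun s' hs' => by
        have := hpos s' ⟨hs'.1, hs'.2.trans_lt hs.2⟩; linarith) s ⟨hs.1, le_refl _⟩ x hx
    have hle : ∀ y ∈ Ioo L (h t), U t y ≤ u t y := by
      intro y hy
      have hc : ContinuousAt (fun s => U s y) t := by
        have : Continuous (fun s => U s y) := hU.comp (by fun_prop : Continuous fun s : ℝ => (s, y))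
        exact this.continuousAt
      have htd := S.le_of_left hT ht.1 ⟨(hgL t htI).trans hy.1, hy.2⟩ hc
      have hnn : 0 ≤ u t y - U t y := by
        refine ge_of_tendsto htd ?_
        have e2 : ∀ᶠ s in 𝓝[<] t, y < H s :=
          (hH.continuousAt.tendsto.mono_left nhdsWithin_le_nhds).eventually_const_lt (by rw [← ehH]; exact hy.2)
        filter_upwards [e2, Ioo_mem_nhdsLT ht.1] with s h2 h3
        have := hprev s ⟨h3.1.le, h3.2⟩ y ⟨hy.1.le, h2.le⟩
        linarith
      linarith
    obtain ⟨Hp, m, hHp, hm, hlt⟩ := hfront t ht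
    obtain ⟨n, hn, hhp⟩ := S.hder t (hT.trans_lt ht.1)
    rw [← ehH] at hm
    have hs := slope_right (by rw [ehH]; exact hLH t htI) hn hm
      (by rw [S.bh t (hT.trans ht.1.le), ehH, hUH t htI]) hle
    have hA := deriv_nonpos_of_left (hhp.sub hHp) (by
      filter_upwards [Ioo_mem_nhdsLT ht.1] with s hs
      have := hpos s ⟨hs.1.le, hs.2⟩
      simp only [Pi.sub_apply]; linarith)
    have : (d / δ) * n ≤ (d / δ) * m := mul_le_mul_of_nonneg_left hs (by positivity)
    linarith
  intro t ht
  exact ⟨hHh t ht, base T' le_rfl hHh t ht⟩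

/-- Free boundary comparison from above, at the right front. -/
lemma Sol.fb_upper (S : Sol d δ f u g h) (hd : 0 < d) (hδ : 0 < δ) {T T' : ℝ} (hT : 0 ≤ T)
    {H : ℝ → ℝ} {U : ℝ → ℝ → ℝ} (hH : Continuous H)
    (hU : Continuous (fun p : ℝ × ℝ => U p.1 p.2))
    (hUd : ∀ t ∈ Icc T T', ∀ x < H t, δ < U t x)
    (hUH : ∀ t ∈ Icc T T', U t (H t) = δ)
    (hfront : ∀ t ∈ Ioc T T', ∃ Hp m, HasDerivAt H Hp t ∧ HasDerivAt (U t) m (H t) ∧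
      -(d / δ) * m < Hp)
    (h0 : h T < H T) (hU0 : ∀ x ∈ Icc (g T) (h T), u T x < U T x)
    (hint : ∀ t ∈ Ioc T T', ∀ x < H t, u t x = U t x → ∃ (A B : ℝ) (V : ℝ → ℝ),
      HasDerivAt (fun s => U s x) A t ∧ (∀ᶠ y in 𝓝 x, HasDerivAt (U t) (V y) y) ∧
      HasDerivAt V B x ∧ d * B + f (U t x) < A) :
    ∀ t ∈ Icc T T', h t < H t ∧ ∀ x ∈ Icc (g t) (h t), u t x < U t x := by
  have nn : ∀ t ∈ Icc T T', 0 ≤ t := fun t ht => hT.trans ht.1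
  have base : ∀ t1, t1 ≤ T' → (∀ t ∈ Icc T t1, h t < H t) →
      ∀ t ∈ Icc T t1, ∀ x ∈ Icc (g t) (h t), u t x < U t x := by
    intro t1 ht1 hHh
    have sub : ∀ t, t ∈ Icc T t1 → t ∈ Icc T T' := fun t ht => ⟨ht.1, ht.2.trans ht1⟩
    refine S.upper hd hT (l := g) (r := h) (S.gcont.mono fun t ht => nn t (sub t ht))
      (S.hcont.mono fun t ht => nn t (sub t ht)) (fun t _ => le_rfl) (fun t _ => le_rfl)
      hU.continuousOn hU0 ?_ ?_ ?_
    · intro t ht hlr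
      have ht' : t ∈ Icc T t1 := ⟨ht.1.le, ht.2⟩
      rw [S.bg t (nn t (sub t ht'))]
      exact hUd t (sub t ht') _ (hlr.trans_lt (hHh t ht'))
    · intro t ht _
      have ht' : t ∈ Icc T t1 := ⟨ht.1.le, ht.2⟩
      rw [S.bh t (nn t (sub t ht'))]
      exact hUd t (sub t ht') _ (hHh t ht')
    · intro t ht x hx e
      have ht' : t ∈ Icc T t1 := ⟨ht.1.le, ht.2⟩
      exact hint t ⟨ht.1, ht.2.trans ht1⟩ x (hx.2.trans (hHh t ht')) e
  have hHh : ∀ t ∈ Icc T T', h t < H t := by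
    by_contra hcon
    push Not at hcon
    obtain ⟨t1, ht1, h1⟩ := hcon
    have hc : ContinuousOn (fun t => H t - h t) (Icc T T') :=
      hH.continuousOn.sub (S.hcont.mono (fun t ht => hT.trans ht.1))
    obtain ⟨t, ht, ht0, hpos⟩ := first_time hc (by linarith) ⟨t1, ht1, by linarith⟩
    have htI : t ∈ Icc T T' := ⟨ht.1.le, ht.2⟩
    have ehH : h t = H t := by linarith
    have hprev : ∀ s ∈ Ico T t, ∀ x ∈ Icc (g s) (h s), u s x < U s x := by
      intro s hs x hx
      exact base s (hs.2.le.trans ht.2) (fun s' hs' => by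
        have := hpos s' ⟨hs'.1, hs'.2.trans_lt hs.2⟩; linarith) s ⟨hs.1, le_refl _⟩ x hx
    have hle' : 𝓝[<] t ≤ 𝓝[Ici 0] t := by
      refine nhdsWithin_le_iff.2 ?_
      filter_upwards [Ioo_mem_nhdsLT ht.1] with s hs using hT.trans hs.1.le
    have hle : ∀ y ∈ Ioo (g t) (h t), u t y ≤ U t y := by
      intro y hy
      have hc : ContinuousAt (fun s => U s y) t := by
        have : Continuous (fun s => U s y) := hU.comp (by fun_prop : Continuous fun s : ℝ => (s, y))
        exact this.continuousAt
      have htd := S.le_of_left hT ht.1 hy hc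
      have hnn : u t y - U t y ≤ 0 := by
        refine le_of_tendsto htd ?_
        have e1 : ∀ᶠ s in 𝓝[<] t, g s < y :=
          ((S.gcont t (nn t htI)).mono_left hle').eventually_lt_const hy.1
        have e2 : ∀ᶠ s in 𝓝[<] t, y < h s :=
          ((S.hcont t (nn t htI)).mono_left hle').eventually_const_lt hy.2
        filter_upwards [e1, e2, Ioo_mem_nhdsLT ht.1] with s h1 h2 h3
        have := hprev s ⟨h3.1.le, h3.2⟩ y ⟨h1.le, h2.le⟩
        linarith
      linarith
    obtain ⟨Hp, m, hHp, hm, hlt⟩ := hfront t ht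
    obtain ⟨n, hn, hhp⟩ := S.hder t (hT.trans_lt ht.1)
    rw [← ehH] at hm
    have hs := slope_right (S.glt t (nn t htI)) hm hn
      (by rw [S.bh t (hT.trans ht.1.le), ehH, hUH t htI]) hle
    have hA := deriv_nonpos_of_left (hHp.sub hhp) (by
      filter_upwards [Ioo_mem_nhdsLT ht.1] with s hs
      have := hpos s ⟨hs.1.le, hs.2⟩
      simp only [Pi.sub_apply]; linarith)
    have : (d / δ) * m ≤ (d / δ) * n := mul_le_mul_of_nonneg_left hs (by positivity)
    linarith
  intro t ht
  exact ⟨hHh t ht, base T' le_rfl hHh t ht⟩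
end

end Part2

section Part3

open Set Filter
open scoped Topology

/-- Facts on the reaction term. -/
structure FDat (d δ : ℝ) (f : ℝ → ℝ) (L β r : ℝ) : Prop where
  hd : 0 < d
  hδ : 0 < δ
  hδ1 : δ < 1
  fcont : ContinuousOn f (Ici 0)
  fpos : ∀ y ∈ Ico δ 1, 0 < f y
  fneg : ∀ y, 1 < y → f y < 0
  f0 : f 0 = 0
  f1 : f 1 = 0
  L0 : 0 < L
  lip : ∀ y₁ ∈ Icc (0:ℝ) 2, ∀ y₂ ∈ Icc (0:ℝ) 2, |f y₁ - f y₂| ≤ L * |y₁ - y₂|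
  β0 : 0 < β
  r0 : 0 < r
  r1 : r ≤ 1
  mono : ∀ y₁ y₂, 1 - r ≤ y₁ → y₁ ≤ y₂ → y₂ ≤ 1 + r → f y₂ - f y₁ ≤ -(2 * β) * (y₂ - y₁)

/-- Facts on the extended semi-wave. -/
structure QDat (d δ c : ℝ) (f Q Q1 : ℝ → ℝ) : Prop where
  hc : 0 < c
  Qder : ∀ z, HasDerivAt Q (Q1 z) z
  Q1der : ∀ z, 0 < z → HasDerivAt Q1 ((c * Q1 z - f (Q z)) / d) z
  Q1cont : Continuous Q1
  Q0 : Q 0 = δ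
  Q10 : Q1 0 = c * δ / d
  Q1pos : ∀ z, 0 < Q1 z
  Qlt : ∀ z, Q z < 1
  Qlim : Tendsto Q atTop (𝓝 1)
  Q1lim : Tendsto Q1 atTop (𝓝 0)

lemma FDat.exists_of {d δ θ θs : ℝ} {f : ℝ → ℝ} (hd : 0 < d) (hf : AlleeType f θ)
    (hθs : IsThetaStar f θ θs) (hδ : δ ∈ Ioo θs 1) : ∃ L β r, FDat d δ f L β r := by
  obtain ⟨hC, hθ, f0, fθ, f1, hf0', hf1', hneg, hpos, hneg1, hint⟩ := hf
  obtain ⟨K, hK⟩ := (hC.mono (fun y (hy : y ∈ Icc (0:ℝ) 2) => hy.1)).exists_lipschitzOnWith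
    one_ne_zero (convex_Icc 0 2) isCompact_Icc
  have hcd : ContinuousOn (derivWithin f (Ici (0:ℝ))) (Ici 0) :=
    hC.continuousOn_derivWithin (uniqueDiffOn_Ici 0) le_rfl
  set β := -derivWithin f (Ici (0:ℝ)) 1 / 4 with hβ
  have hβ0 : 0 < β := by rw [hβ]; linarith
  have hcd1 : ContinuousAt (derivWithin f (Ici (0:ℝ))) 1 :=
    (hcd 1 (by norm_num : (0:ℝ) ≤ 1)).continuousAt (Ici_mem_nhds one_pos)
  have hev : ∀ᶠ y in 𝓝 (1:ℝ), derivWithin f (Ici (0:ℝ)) y < -(2 * β) :=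
    hcd1.tendsto.eventually_lt_const (by rw [hβ]; linarith)
  obtain ⟨e, he, hball⟩ := Metric.eventually_nhds_iff.1 hev
  set r := min (e / 2) (1 / 2) with hr
  have hr0 : 0 < r := by rw [hr]; positivity
  have hr1 : r ≤ 1 / 2 := min_le_right _ _
  have hre : r < e := (min_le_left _ _).trans_lt (by linarith)
  refine ⟨K + 1, β, r, hd, ?_, hδ.2, hC.continuousOn, ?_, hneg1, f0, f1, by positivity, ?_, hβ0, hr0,
    by linarith, ?_⟩
  · have := hθs.1.1; linarith [hδ.1, hθ.1]
  · intro y hy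
    exact hpos y ⟨by linarith [hθs.1.1, hδ.1, hy.1], hy.2⟩
  · intro y₁ h1 y₂ h2
    have h3 := hK.dist_le_mul y₁ h1 y₂ h2
    rw [Real.dist_eq, Real.dist_eq] at h3
    have : 0 ≤ |y₁ - y₂| := abs_nonneg _
    nlinarith
  · intro y₁ y₂ h1 h12 h2
    have sub : ∀ y ∈ Icc (1 - r) (1 + r), (0:ℝ) < y := fun y hy => by linarith [hy.1]
    refine (convex_Icc (1 - r) (1 + r)).image_sub_le_mul_sub_of_deriv_le
      (hC.continuousOn.mono fun y hy => (sub y hy).le) ?_ ?_ y₁ ⟨h1, by linarith⟩ y₂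
        ⟨by linarith, h2⟩ h12
    · intro y hy
      have hy' := sub y (interior_subset hy)
      exact ((hC.differentiableOn one_ne_zero y hy'.le).differentiableAt
        (Ici_mem_nhds hy')).differentiableWithinAt
    · intro y hy
      have hyI := interior_subset hy
      have hy' := sub y hyI
      rw [← derivWithin_of_mem_nhds (Ici_mem_nhds hy')]
      refine (hball ?_).le
      rw [Real.dist_eq, abs_lt]
      constructor <;> linarith [hyI.1, hyI.2]

lemma QDat.exists_of {d δ c L β r : ℝ} {f q : ℝ → ℝ} (F : FDat d δ f L β r)
    (hsw : SemiWavePair d δ f c q) :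
    ∃ Q Q1, QDat d δ c f Q Q1 ∧ ∀ z, 0 ≤ z → Q z = q z := by
  obtain ⟨hc, hC, hode, hqpos, hq0, hlim, hq10, hq1pos⟩ := hsw
  have hd := F.hd
  have hδ := F.hδ
  set q1 := derivWithin q (Ici (0:ℝ)) with hq1
  have hC1 : ContDiffOn ℝ 1 q1 (Ici 0) := hC.derivWithin (uniqueDiffOn_Ici 0) (by norm_num)
  have hqd : ∀ z, 0 ≤ z → HasDerivWithinAt q (q1 z) (Ici 0) z := fun z hz =>
    (hC.differentiableOn two_ne_zero z hz).hasDerivWithinAt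
  have hq1d : ∀ z, 0 ≤ z → HasDerivWithinAt q1 ((c * q1 z - f (q z)) / d) (Ici 0) z := by
    intro z hz
    have h1 := (hC1.differentiableOn one_ne_zero z hz).hasDerivWithinAt
    have h2 := hode z hz
    have : derivWithin q1 (Ici 0) z = (c * q1 z - f (q z)) / d := by
      field_simp; linarith
    rwa [this] at h1
  set Q : ℝ → ℝ := fun z => if 0 ≤ z then q z else δ + c * δ / d * z with hQ
  set Q1 : ℝ → ℝ := fun z => q1 (max z 0) with hQ1
  have Qq : ∀ z, 0 ≤ z → Q z = q z := fun z hz => by simp [hQ, hz]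
  have Q1q : ∀ z, 0 ≤ z → Q1 z = q1 z := fun z hz => by simp [hQ1, hz]
  have Ql : ∀ z, z ≤ 0 → Q z = δ + c * δ / d * z := by
    intro z hz
    rcases hz.lt_or_eq with h | h
    · simp [hQ, not_le.2 h]
    · subst h; simp [hQ, hq0]
  have Q1l : ∀ z, z ≤ 0 → Q1 z = c * δ / d := fun z hz => by simp [hQ1, max_eq_right hz, hq10]
  have hlin : ∀ z, HasDerivAt (fun z => δ + c * δ / d * z) (c * δ / d) z := by
    intro z
    simpa using ((hasDerivAt_id z).const_mul (c * δ / d)).const_add δ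
  have Qder : ∀ z, HasDerivAt Q (Q1 z) z := by
    intro z
    rcases lt_trichotomy z 0 with h | h | h
    · rw [Q1l z h.le]
      refine (hlin z).congr_of_eventuallyEq ?_
      filter_upwards [Iio_mem_nhds h] with y hy using Ql y (le_of_lt hy)
    · subst h
      rw [Q1l 0 le_rfl]
      have a1 : HasDerivWithinAt Q (c * δ / d) (Ici 0) 0 := by
        have := hqd 0 le_rfl
        rw [hq10] at this
        exact this.congr (fun y hy => Qq y hy) (Qq 0 le_rfl)
      have a2 : HasDerivWithinAt Q (c * δ / d) (Iic 0) 0 :=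
        (hlin 0).hasDerivWithinAt.congr (fun y hy => Ql y hy) (Ql 0 le_rfl)
      have := a2.union a1
      rwa [Iic_union_Ici, hasDerivWithinAt_univ] at this
    · rw [Q1q z h.le]
      refine ((hqd z h.le).hasDerivAt (Ici_mem_nhds h)).congr_of_eventuallyEq ?_
      filter_upwards [Ioi_mem_nhds h] with y hy using Qq y (le_of_lt hy)
  have Q1der : ∀ z, 0 < z → HasDerivAt Q1 ((c * Q1 z - f (Q z)) / d) z := by
    intro z h
    rw [Q1q z h.le, Qq z h.le]
    refine ((hq1d z h.le).hasDerivAt (Ici_mem_nhds h)).congr_of_eventuallyEq ?_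
    filter_upwards [Ioi_mem_nhds h] with y hy using Q1q y (le_of_lt hy)
  have Q1cont : Continuous Q1 := by
    rw [← continuousOn_univ]
    refine hC1.continuousOn.comp (t := Ici 0) (by fun_prop) ?_
    intro z _; exact le_max_right z (0:ℝ)
  have Q1pos : ∀ z, 0 < Q1 z := fun z => hq1pos _ (le_max_right z (0:ℝ))
  have Qmono : StrictMono Q := strictMono_of_deriv_pos fun z => by rw [(Qder z).deriv]; exact Q1pos z
  have Qlim : Tendsto Q atTop (𝓝 1) := by
    refine hlim.congr' ?_
    filter_upwards [eventually_ge_atTop 0] with z hz using (Qq z hz).symm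
  have Qlt : ∀ z, Q z < 1 := by
    intro z
    have h1 : Q z < Q (z + 1) := Qmono (by linarith)
    have h2 : Q (z + 1) ≤ 1 := by
      refine ge_of_tendsto Qlim ?_
      filter_upwards [eventually_ge_atTop (z + 1)] with y hy using Qmono.monotone hy
    linarith
  have Q1lim : Tendsto Q1 atTop (𝓝 0) := by
    rw [Metric.tendsto_atTop]
    intro ε hε
    have hfc : Tendsto (fun z => f (Q z)) atTop (𝓝 0) := by
      have : ContinuousAt f 1 := (F.fcont 1 (by norm_num : (0:ℝ) ≤ 1)).continuousAt (Ici_mem_nhds one_pos)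
      have h2 := this.tendsto.comp Qlim
      rwa [F.f1] at h2
    have hev : ∀ᶠ z in atTop, f (Q z) < c * (ε / 2) :=
      hfc.eventually_lt_const (by positivity)
    obtain ⟨z1, hz1⟩ := eventually_atTop.1 hev
    refine ⟨max z1 1, fun z0 hz0 => ?_⟩
    have hz01 : 1 ≤ z0 := (le_max_right _ _).trans hz0
    have hz00 : z1 ≤ z0 := (le_max_left _ _).trans hz0
    rw [Real.dist_eq, sub_zero, abs_of_pos (Q1pos z0)]
    by_contra hcon
    push Not at hcon
    have hall : ∀ z, z0 ≤ z → ε / 2 < Q1 z := by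
      intro z hz
      by_contra hneg
      push Not at hneg
      obtain ⟨t, ht, ht0, hpos⟩ := first_time (φ := fun z => Q1 z - ε / 2) (T := z0) (T' := z)
        (by fun_prop) (by linarith) ⟨z, ⟨hz, le_rfl⟩, by linarith⟩
      have h1 := deriv_nonpos_of_left ((Q1der t (by linarith [ht.1])).sub_const (ε / 2)) (by
        filter_upwards [Ioo_mem_nhdsLT ht.1] with s hs
        have := hpos s ⟨hs.1.le, hs.2⟩
        linarith)
      have h2 := hz1 t (by linarith [ht.1])
      have h3 : Q1 t = ε / 2 := by linarith
      rw [h3] at h1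
      have : 0 < (c * (ε / 2) - f (Q t)) / d := div_pos (by linarith) hd
      linarith
    obtain ⟨z, hz, hs⟩ := exists_hasDerivAt_eq_slope Q Q1 (a := z0) (b := z0 + 2 / ε)
      (by have : 0 < 2 / ε := by positivity
          linarith) (fun y _ => (Qder y).continuousAt.continuousWithinAt) (fun y _ => Qder y)
    have h1 := hall z hz.1.le
    rw [hs, lt_div_iff₀ (by have : 0 < 2 / ε := by positivity
                            linarith)] at h1
    have h2 : ε / 2 * (z0 + 2 / ε - z0) = 1 := by field_simp; ring
    have h3 := Qlt (z0 + 2 / ε)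
    have h4 : 0 < Q z0 := by
      have := Qmono.monotone (show (0:ℝ) ≤ z0 by linarith)
      rw [Ql 0 le_rfl] at this
      linarith
    linarith
  exact ⟨Q, Q1, ⟨hc, Qder, Q1der, Q1cont, by rw [Ql 0 le_rfl]; ring, Q1l 0 le_rfl, Q1pos, Qlt, Qlim, Q1lim⟩, Qq⟩

section
variable {d δ c : ℝ} {f Q Q1 : ℝ → ℝ}

lemma QDat.Qcont (D : QDat d δ c f Q Q1) : Continuous Q :=
  continuous_iff_continuousAt.2 fun z => (D.Qder z).continuousAt

lemma QDat.Qmono (D : QDat d δ c f Q Q1) : StrictMono Q :=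
  strictMono_of_deriv_pos fun z => by rw [(D.Qder z).deriv]; exact D.Q1pos z

lemma QDat.Qge (D : QDat d δ c f Q Q1) {z : ℝ} (hz : 0 ≤ z) : δ ≤ Q z := by
  have := D.Qmono.monotone hz
  rwa [D.Q0] at this

/-- `Q` is Lipschitz on `[-1,∞)`. -/
lemma QDat.lip (D : QDat d δ c f Q Q1) :
    ∃ M, 0 < M ∧ ∀ x y, -1 ≤ x → x ≤ y → Q y - Q x ≤ M * (y - x) := by
  obtain ⟨z1, hz1⟩ := eventually_atTop.1 (D.Q1lim.eventually_lt_const one_pos)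
  obtain ⟨M, hM⟩ := (isCompact_Icc (a := -1) (b := z1)).bddAbove_image D.Q1cont.continuousOn
  have hb : ∀ z, -1 ≤ z → Q1 z ≤ max M 1 := by
    intro z hz
    rcases le_total z z1 with h | h
    · exact (hM (mem_image_of_mem _ ⟨hz, h⟩)).trans (le_max_left _ _)
    · exact (hz1 z h).le.trans (le_max_right _ _)
  refine ⟨max M 1, by positivity, fun x y hx hxy => ?_⟩
  refine (convex_Ici (-1:ℝ)).image_sub_le_mul_sub_of_deriv_le D.Qcont.continuousOn
    (fun z _ => (D.Qder z).differentiableAt.differentiableWithinAt) ?_ x hx y (hx.trans hxy) hxy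
  intro z hz
  rw [(D.Qder z).deriv]
  exact hb z (interior_subset hz)
end

end Part3

section Part4

open Set Filter
open scoped Topology

/-- One half of the compactly supported bump. -/
lemma half_bump {φ ψ G V : ℝ → ℝ} {δ1 N g0 σ v0 : ℝ}
    (hφ : ∀ y ∈ Icc (0:ℝ) 1, HasDerivWithinAt φ (ψ y) (Icc 0 1) y)
    (hψ : ∀ y ∈ Icc (0:ℝ) 1, HasDerivWithinAt ψ (N * G (φ y)) (Icc 0 1) y)
    (φ0 : φ 0 = δ1) (ψ0 : ψ 0 = 0) (hV : ∀ s, HasDerivAt V (G s) s) (V0 : V δ1 = 0)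
    (Vpos : ∀ s ∈ Ico 0 δ1, 0 < V s) (Vbig : ∀ s ∈ Icc 0 (δ1 - σ), v0 ≤ V s)
    (Gneg : ∀ s, δ1 - σ ≤ s → G s ≤ -g0) (hg0 : 0 < g0) (hN : 0 < N) (hσ : 0 < σ) (hσδ : σ < δ1)
    (hδ1 : δ1 < 1) (hN1 : σ < N * g0 / 8) (hN2 : 2 ≤ N * v0) :
    ∃ y ∈ Ioc (0:ℝ) 1, φ y = 0 ∧ ∀ s ∈ Ico 0 y, 0 < φ s ∧ φ s ≤ δ1 := by
  have cφ : ContinuousOn φ (Icc 0 1) := fun y hy => (hφ y hy).continuousWithinAt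
  have cψ : ContinuousOn ψ (Icc 0 1) := fun y hy => (hψ y hy).continuousWithinAt
  have dφ : ∀ y ∈ Ioo (0:ℝ) 1, HasDerivAt φ (ψ y) y := fun y hy =>
    (hφ y ⟨hy.1.le, hy.2.le⟩).hasDerivAt (Icc_mem_nhds hy.1 hy.2)
  have dψ : ∀ y ∈ Ioo (0:ℝ) 1, HasDerivAt ψ (N * G (φ y)) y := fun y hy =>
    (hψ y ⟨hy.1.le, hy.2.le⟩).hasDerivAt (Icc_mem_nhds hy.1 hy.2)
  have cV : Continuous V := continuous_iff_continuousAt.2 fun s => (hV s).continuousAt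
  -- energy
  have energy : ∀ y ∈ Icc (0:ℝ) 1, ψ y ^ 2 = 2 * N * V (φ y) := by
    intro y hy
    rcases hy.1.eq_or_lt with h | h
    · subst h; rw [φ0, ψ0, V0]; ring
    · obtain ⟨z, hz, hs⟩ := exists_hasDerivAt_eq_slope (fun y => ψ y ^ 2 - 2 * N * V (φ y))
        (fun _ => 0) h (by
          refine ContinuousOn.sub ?_ ?_
          · exact (cψ.mono (Icc_subset_Icc_right hy.2)).pow 2
          · exact continuousOn_const.mul (cV.comp_continuousOn (cφ.mono (Icc_subset_Icc_right hy.2)))) (by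
          intro z hz
          have hz' : z ∈ Ioo (0:ℝ) 1 := ⟨hz.1, hz.2.trans_le hy.2⟩
          have h1 := ((dψ z hz').pow 2).sub (((hV (φ z)).comp z (dφ z hz')).const_mul (2 * N))
          refine h1.congr_deriv ?_
          push_cast; ring)
      have := hs.symm
      rw [div_eq_zero_iff] at this
      rcases this with h1 | h1
      · simp only [φ0, ψ0, V0] at h1; linarith
      · linarith
  have subB : ∀ y ∈ Icc (0:ℝ) 1, (∀ s ∈ Icc 0 y, δ1 - σ ≤ φ s) →
      ∀ s ∈ Icc 0 y, ψ s ≤ -(N * g0 * s) := by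
    intro y hy hall s hs
    rcases hs.1.eq_or_lt with h | h
    · subst h; rw [ψ0]; simp
    · obtain ⟨z, hz, hs'⟩ := exists_hasDerivAt_eq_slope ψ (fun z => N * G (φ z)) h
        (cψ.mono (Icc_subset_Icc_right (hs.2.trans hy.2)))
        (fun z hz => dψ z ⟨hz.1, hz.2.trans_le (hs.2.trans hy.2)⟩)
      have h1 := Gneg (φ z) (hall z ⟨hz.1.le, hz.2.le.trans hs.2⟩)
      rw [eq_div_iff (by linarith), ψ0] at hs'
      have h2 : N * G (φ z) ≤ N * (-g0) := mul_le_mul_of_nonneg_left h1 hN.le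
      have h3 : N * G (φ z) * (s - 0) ≤ N * (-g0) * (s - 0) :=
        mul_le_mul_of_nonneg_right h2 (by linarith)
      linarith
  -- initial interval
  obtain ⟨e, he, he1, hinit⟩ : ∃ e, 0 < e ∧ e ≤ 1 ∧ ∀ s ∈ Icc 0 e, δ1 - σ ≤ φ s := by
    have h1 : ∀ᶠ y in 𝓝[Icc 0 1] (0:ℝ), δ1 - σ < φ y :=
      (cφ 0 ⟨le_rfl, zero_le_one⟩).eventually_const_lt (by rw [φ0]; linarith)
    obtain ⟨e, he, hb⟩ := Metric.mem_nhdsWithin_iff.1 h1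
    refine ⟨min (e / 2) 1, by positivity, min_le_right _ _, fun s hs => ?_⟩
    have h2 : s ≤ e / 2 := hs.2.trans (min_le_left _ _)
    have h3 : s ≤ 1 := hs.2.trans (min_le_right _ _)
    refine le_of_lt (hb ⟨?_, hs.1, h3⟩)
    rw [Metric.mem_ball, Real.dist_eq, sub_zero, abs_of_nonneg hs.1]; linarith
  have subA : ∀ Y' ∈ Ioc (0:ℝ) 1, (∀ s ∈ Ico 0 Y', 0 < φ s) → ∀ s ∈ Ioo 0 Y', ψ s < 0 := by
    intro Y' hY' hpos s hs
    have hsm : ∀ t ∈ Ioc 0 e, ψ t < 0 := by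
      intro t ht
      have := subB e ⟨he.le, he1⟩ hinit t ⟨ht.1.le, ht.2⟩
      have : 0 < N * g0 * t := by have := ht.1; positivity
      linarith
    rcases le_or_gt s e with h | h
    · exact hsm s ⟨hs.1, h⟩
    by_contra hcon
    push Not at hcon
    obtain ⟨t, ht, ht0, htp⟩ := first_time (φ := fun y => -ψ y) (T := e) (T' := s)
      ((cψ.mono (fun y hy => ⟨he.le.trans hy.1, hy.2.trans (hs.2.le.trans hY'.2)⟩)).neg)
      (by have := hsm e ⟨he, le_rfl⟩; linarith) ⟨s, ⟨h.le, le_rfl⟩, by linarith⟩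
    have ht1 : t < 1 := ht.2.trans_lt (hs.2.trans_le hY'.2)
    have htpos : 0 < t := he.trans ht.1
    have hneg : ∀ z ∈ Ioo 0 t, ψ z < 0 := by
      intro z hz
      rcases le_or_gt z e with h | h
      · exact hsm z ⟨hz.1, h⟩
      · have := htp z ⟨h.le, hz.2⟩; linarith
    obtain ⟨z, hz, hsl⟩ := exists_hasDerivAt_eq_slope φ ψ htpos
      (cφ.mono (Icc_subset_Icc_right ht1.le)) (fun z hz => dφ z ⟨hz.1, hz.2.trans ht1⟩)
    have h1 := hneg z hz
    rw [hsl, div_lt_iff₀ (by linarith), φ0] at h1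
    have h2 : 0 < φ t := hpos t ⟨htpos.le, ht.2.trans_lt hs.2⟩
    have h3 := Vpos (φ t) ⟨h2.le, by linarith⟩
    have h4 := energy t ⟨htpos.le, ht1.le⟩
    have h5 : ψ t = 0 := by linarith
    rw [h5] at h4
    have : 0 < 2 * N * V (φ t) := by positivity
    linarith [h4]
  have anti : ∀ Y' ∈ Ioc (0:ℝ) 1, (∀ s ∈ Ico 0 Y', 0 < φ s) → AntitoneOn φ (Icc 0 Y') := by
    intro Y' hY' hpos
    refine antitoneOn_of_deriv_nonpos (convex_Icc _ _) (cφ.mono (Icc_subset_Icc_right hY'.2)) ?_ ?_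
    · intro z hz
      rw [interior_Icc] at hz
      exact (dφ z ⟨hz.1, hz.2.trans_le hY'.2⟩).differentiableAt.differentiableWithinAt
    · intro z hz
      rw [interior_Icc] at hz
      rw [(dφ z ⟨hz.1, hz.2.trans_le hY'.2⟩).deriv]
      exact (subA Y' hY' hpos z hz).le
  have hzero : ∃ t ∈ Icc (0:ℝ) 1, φ t ≤ 0 := by
    by_contra hcon
    push Not at hcon
    have hpos : ∀ s ∈ Ico (0:ℝ) 1, 0 < φ s := fun s hs => hcon s ⟨hs.1, hs.2.le⟩
    have h1I : (1:ℝ) ∈ Ioc (0:ℝ) 1 := ⟨one_pos, le_rfl⟩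
    have an := anti 1 h1I hpos
    have hneg := subA 1 h1I hpos
    have hhalf : φ (1/2) ≤ δ1 - σ := by
      by_contra hc
      push Not at hc
      have hall : ∀ s ∈ Icc (0:ℝ) (1/2), δ1 - σ ≤ φ s := by
        intro s hs
        have := an (a := s) ⟨hs.1, by linarith [hs.2]⟩ (b := 1/2) ⟨by norm_num, by norm_num⟩ hs.2
        linarith
      have hb := subB (1/2) ⟨by norm_num, by norm_num⟩ hall
      have hm : AntitoneOn (fun y => φ y + N * g0 * y ^ 2 / 2) (Icc (0:ℝ) (1/2)) := by
        have hdd : ∀ z ∈ Ioo (0:ℝ) (1/2),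
            HasDerivAt (fun y => φ y + N * g0 * y ^ 2 / 2) (ψ z + N * g0 * z) z := by
          intro z hz
          have h1 := (dφ z ⟨hz.1, by linarith [hz.2]⟩).add
            ((((hasDerivAt_id z).pow 2).const_mul (N * g0)).div_const 2)
          refine h1.congr_deriv ?_
          simp; ring
        refine antitoneOn_of_deriv_nonpos (convex_Icc _ _) ?_ ?_ ?_
        · exact (cφ.mono (Icc_subset_Icc_right (by norm_num))).add (by fun_prop)
        · intro z hz
          rw [interior_Icc] at hz
          exact (hdd z hz).differentiableAt.differentiableWithinAt
        · intro z hz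
          rw [interior_Icc] at hz
          rw [(hdd z hz).deriv]
          linarith [hb z ⟨hz.1.le, hz.2.le⟩]
      have := hm (a := 0) ⟨le_rfl, by norm_num⟩ (b := 1/2) ⟨by norm_num, le_rfl⟩ (by norm_num)
      simp only [φ0] at this
      nlinarith
    obtain ⟨z, hz, hsl⟩ := exists_hasDerivAt_eq_slope φ ψ (a := 1/2) (b := 1) (by norm_num)
      (cφ.mono (Icc_subset_Icc_left (by norm_num))) (fun z hz => dφ z ⟨by linarith [hz.1], hz.2⟩)
    have hz0 : 0 < z := by linarith [hz.1]
    have hzI : z ∈ Icc (0:ℝ) 1 := ⟨hz0.le, hz.2.le⟩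
    have hφz : φ z ≤ δ1 - σ :=
      (an (a := 1/2) ⟨by norm_num, by norm_num⟩ (b := z) hzI hz.1.le).trans hhalf
    have h2 := Vbig (φ z) ⟨(hcon z hzI).le, hφz⟩
    have h3 := energy z hzI
    have h4 := hneg z ⟨hz0, hz.2⟩
    have h5 : ψ z ≤ -2 := by
      have : N * v0 ≤ N * V (φ z) := mul_le_mul_of_nonneg_left h2 hN.le
      nlinarith
    rw [hsl, div_le_iff₀ (by norm_num)] at h5
    have h6 := hcon 1 ⟨zero_le_one, le_rfl⟩
    linarith
  obtain ⟨y, hy, hy0, hyp⟩ := first_time cφ (by rw [φ0]; linarith) hzero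
  refine ⟨y, hy, hy0, fun s hs => ⟨hyp s hs, ?_⟩⟩
  have := anti y hy hyp (a := 0) ⟨le_rfl, hy.1.le⟩ (b := s) ⟨hs.1, hs.2.le⟩ hs.1
  rwa [φ0] at this

/-- Existence of a compactly supported stationary strict subsolution. -/
lemma bump_exists {d θ θs δ1 : ℝ} {f : ℝ → ℝ} (hd : 0 < d) (hf : AlleeType f θ)
    (hθs : IsThetaStar f θ θs) (hδ : δ1 ∈ Ioo θs 1) :
    ∃ (Y η a b P : ℝ) (φ ψ : ℝ → ℝ), 0 < Y ∧ 0 < η ∧ 0 < a ∧ 0 < b ∧ φ 0 = δ1 ∧ φ (-a) = 0 ∧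
      φ b = 0 ∧ ContinuousOn φ (Icc (-a) b) ∧ (∀ y ∈ Icc (-a) b, φ y ≤ δ1) ∧
      ∀ y ∈ Ioo (-a) b, 0 < φ y ∧ HasDerivAt φ (ψ y) y ∧
        HasDerivAt ψ (Y ^ 2 / d * (η - f (φ y))) y ∧ |ψ y| ≤ P := by
  obtain ⟨hC, hθ, f0, fθ, f1, hf0', hf1', hneg, hpos, hneg1, hint⟩ := hf
  have cf : ContinuousOn f (Ici 0) := hC.continuousOn
  have hθδ : θ < δ1 := hθs.1.1.trans_lt hδ.1
  have hδ0 : 0 < δ1 := hθ.1.trans_lt hθδ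
  have hfδ : 0 < f δ1 := hpos δ1 ⟨hθδ, hδ.2⟩
  set g0 := f δ1 / 4 with hg0
  have hg0p : 0 < g0 := by positivity
  -- neighbourhood of δ1
  obtain ⟨σ, hσ, hσδ, hfσ⟩ : ∃ σ, 0 < σ ∧ σ < δ1 ∧ ∀ s ∈ Icc (δ1 - σ) δ1, 2 * g0 ≤ f s := by
    have h1 : ∀ᶠ y in 𝓝 δ1, 2 * g0 < f y :=
      ((cf δ1 hδ0.le).continuousAt (Ici_mem_nhds hδ0)).tendsto.eventually_const_lt (by rw [hg0]; linarith)
    obtain ⟨e, he, hb⟩ := Metric.eventually_nhds_iff.1 h1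
    refine ⟨min (e / 2) (δ1 / 2), by positivity, (min_le_right _ _).trans_lt (by linarith), ?_⟩
    intro s hs
    refine (hb ?_).le
    have := min_le_left (e / 2) (δ1 / 2)
    rw [Real.dist_eq, abs_lt]; constructor <;> linarith [hs.1, hs.2]
  have ii : ∀ a b, 0 ≤ a → 0 ≤ b → IntervalIntegrable f MeasureTheory.volume a b := by
    intro a b ha hb
    refine (cf.mono ?_).intervalIntegrable
    intro y hy
    exact (le_min ha hb).trans hy.1
  have Fpos : ∀ s ∈ Ico 0 δ1, 0 < ∫ y in s..δ1, f y := by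
    intro s hs
    rcases le_or_gt θ s with h | h
    · exact intervalIntegral.intervalIntegral_pos_of_pos_on (ii _ _ hs.1 hδ0.le)
        (fun y hy => hpos y ⟨h.trans_lt hy.1, hy.2.trans hδ.2⟩) hs.2
    · have h1 : ∫ y in (0:ℝ)..s, f y ≤ 0 := by
        have h0 : 0 ≤ ∫ y in (0:ℝ)..s, -f y := intervalIntegral.integral_nonneg hs.1 (fun y hy => by
          have := hneg y ⟨hy.1, hy.2.trans h.le⟩
          linarith)
        rw [intervalIntegral.integral_neg] at h0
        linarith
      have h2 := hθs.2.2 δ1 ⟨hδ.1, hδ.2.le⟩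
      have h3 := intervalIntegral.integral_add_adjacent_intervals (ii 0 s le_rfl hs.1) (ii s δ1 hs.1 hδ0.le)
      linarith
  -- clamped reaction
  obtain ⟨K, hK⟩ := (hC.mono (fun y (hy : y ∈ Icc (0:ℝ) δ1) => hy.1)).exists_lipschitzOnWith
    one_ne_zero (convex_Icc 0 δ1) isCompact_Icc
  set fc : ℝ → ℝ := fun s => f (max 0 (min s δ1)) with hfc
  have hcl : ∀ s, max 0 (min s δ1) ∈ Icc 0 δ1 := fun s =>
    ⟨le_max_left _ _, max_le hδ0.le (min_le_right _ _)⟩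
  have hfcl : LipschitzWith K fc := by
    refine LipschitzWith.of_dist_le_mul fun x y => ?_
    refine (hK.dist_le_mul _ (hcl x) _ (hcl y)).trans ?_
    refine mul_le_mul_of_nonneg_left ?_ K.2
    have h1 := ((LipschitzWith.id (α := ℝ)).min_const δ1).const_max 0
    simpa using h1.dist_le_mul x y
  have fceq : ∀ s ∈ Icc 0 δ1, fc s = f s := by
    intro s hs; simp only [hfc]; rw [min_eq_left hs.2, max_eq_right hs.1]
  have cfc : Continuous fc := hfcl.continuous
  set W : ℝ → ℝ := fun s => ∫ y in s..δ1, fc y with hW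
  have dW : ∀ s, HasDerivAt W (-fc s) s := fun s =>
    intervalIntegral.integral_hasDerivAt_left (cfc.intervalIntegrable _ _)
      (cfc.stronglyMeasurableAtFilter _ _) cfc.continuousAt
  have cW : Continuous W := continuous_iff_continuousAt.2 fun s => (dW s).continuousAt
  have Wpos : ∀ s ∈ Ico 0 δ1, 0 < W s := by
    intro s hs
    have : W s = ∫ y in s..δ1, f y := by
      refine intervalIntegral.integral_congr fun y hy => ?_
      rw [uIcc_of_le hs.2.le] at hy
      exact fceq y ⟨hs.1.trans hy.1, hy.2⟩
    rw [this]; exact Fpos s hs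
  have W0 : W δ1 = 0 := by simp [hW]
  obtain ⟨s1, hs1, hmin⟩ := (isCompact_Icc (a := 0) (b := δ1 - σ)).exists_isMinOn
    ⟨0, le_rfl, by linarith⟩ cW.continuousOn
  set v1 := W s1 with hv1
  have hv1p : 0 < v1 := Wpos s1 ⟨hs1.1, by linarith [hs1.2]⟩
  have hv1le : ∀ s ∈ Icc 0 (δ1 - σ), v1 ≤ W s := fun s hs => hmin hs
  set η := min g0 (v1 / 2) with hη
  have hηp : 0 < η := by positivity
  have hη1 : η ≤ g0 := min_le_left _ _
  have hη2 : η ≤ v1 / 2 := min_le_right _ _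
  have fcσ : ∀ s, δ1 - σ ≤ s → 2 * g0 ≤ fc s := by
    intro s hs
    have : max 0 (min s δ1) ∈ Icc (δ1 - σ) δ1 :=
      ⟨(le_min hs (by linarith)).trans (le_max_right _ _), (hcl s).2⟩
    exact hfσ _ this
  set G : ℝ → ℝ := fun s => η - fc s with hG
  set V : ℝ → ℝ := fun s => W s - η * (δ1 - s) with hVd
  have dV : ∀ s, HasDerivAt V (G s) s := by
    intro s
    have h1 := (dW s).sub (((hasDerivAt_id s).const_sub δ1).const_mul η)
    refine h1.congr_deriv ?_
    simp [hG]; ring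
  have V0 : V δ1 = 0 := by simp [hVd, W0]
  have Vbig : ∀ s ∈ Icc 0 (δ1 - σ), v1 / 2 ≤ V s := by
    intro s hs
    have h1 := hv1le s hs
    have h2 : η * (δ1 - s) ≤ η * 1 := mul_le_mul_of_nonneg_left (by linarith [hs.1, hδ.2]) hηp.le
    simp only [hVd]; linarith
  have Vpos : ∀ s ∈ Ico 0 δ1, 0 < V s := by
    intro s hs
    rcases le_or_gt s (δ1 - σ) with h | h
    · have := Vbig s ⟨hs.1, h⟩; linarith
    · obtain ⟨z, hz, hsl⟩ := exists_hasDerivAt_eq_slope W (fun z => -fc z) hs.2 cW.continuousOn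
        (fun z _ => dW z)
      have h1 := fcσ z (by linarith [hz.1])
      have h2 : 0 < δ1 - s := by linarith [hs.2]
      rw [eq_div_iff h2.ne', W0] at hsl
      have h3 : η * (δ1 - s) < fc z * (δ1 - s) := mul_lt_mul_of_pos_right (by linarith) h2
      simp only [hVd]; linarith
  have Gneg : ∀ s, δ1 - σ ≤ s → G s ≤ -g0 := by
    intro s hs
    have := fcσ s hs
    simp only [hG]; linarith
  -- size of the rescaling
  set N := 8 * σ / g0 + 4 / v1 + 1 with hN
  have hNp : 0 < N := by positivity
  have hN1 : σ < N * g0 / 8 := by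
    have : N * g0 / 8 = σ + (4 / v1 + 1) * g0 / 8 := by rw [hN]; field_simp; ring
    rw [this]
    have : 0 < (4 / v1 + 1) * g0 / 8 := by positivity
    linarith
  have hN2 : 2 ≤ N * (v1 / 2) := by
    have : N * (v1 / 2) = 2 + (8 * σ / g0 + 1) * (v1 / 2) := by rw [hN]; field_simp; ring
    rw [this]
    have : 0 < (8 * σ / g0 + 1) * (v1 / 2) := by positivity
    linarith
  set Y := Real.sqrt (N * d) with hY
  have hYp : 0 < Y := Real.sqrt_pos.2 (by positivity)
  have hYN : Y ^ 2 / d = N := by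
    rw [hY, Real.sq_sqrt (by positivity)]; field_simp
  -- bound on G
  obtain ⟨Gm, hGm⟩ : ∃ Gm, ∀ s, |G s| ≤ Gm := by
    obtain ⟨C, hC'⟩ := (isCompact_Icc (a := 0) (b := δ1)).exists_bound_of_continuousOn
      (f := f) (cf.mono fun y hy => hy.1)
    refine ⟨η + C, fun s => ?_⟩
    have := hC' _ (hcl s)
    rw [Real.norm_eq_abs] at this
    calc |G s| ≤ |η| + |fc s| := abs_sub _ _
      _ ≤ η + C := by rw [abs_of_pos hηp]; linarith
  have hGm0 : 0 ≤ Gm := (abs_nonneg _).trans (hGm 0)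
  set A : NNReal := ⟨N * Gm, by positivity⟩ with hA
  set field : ℝ × ℝ → ℝ × ℝ := fun p => (p.2, N * G p.1) with hfield
  have hNG : LipschitzWith (N.toNNReal * K) (fun s => N * G s) := by
    refine LipschitzWith.of_dist_le_mul fun x y => ?_
    have h1 := hfcl.dist_le_mul x y
    rw [Real.dist_eq] at h1 ⊢
    have : N * G x - N * G y = -N * (fc x - fc y) := by simp only [hG]; ring
    rw [this, abs_mul, abs_neg, abs_of_pos hNp]
    have := mul_le_mul_of_nonneg_left h1 hNp.le
    rw [NNReal.coe_mul, mul_assoc, Real.coe_toNNReal N hNp.le]; exact this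
  have hlipF : ∃ K', LipschitzWith K' field :=
    ⟨_, LipschitzWith.prodMk LipschitzWith.prod_snd (hNG.comp LipschitzWith.prod_fst)⟩
  obtain ⟨K', hK'⟩ := hlipF
  have hPL : IsPicardLindelof (fun _ : ℝ => field) (⟨0, by norm_num, by norm_num⟩ : Icc (-1:ℝ) 1)
      ((δ1, 0) : ℝ × ℝ) A 0 A K' := by
    refine IsPicardLindelof.of_time_independent ?_ hK'.lipschitzOnWith ?_
    · intro p hp
      rw [Metric.mem_closedBall, Prod.dist_eq, max_le_iff] at hp
      have h2 := hp.2
      simp only [dist_zero_right] at h2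
      rw [hfield, Prod.norm_def, max_le_iff]
      refine ⟨h2, ?_⟩
      simp only [Real.norm_eq_abs, abs_mul, abs_of_pos hNp]
      exact mul_le_mul_of_nonneg_left (hGm _) hNp.le
    · simp
  obtain ⟨α, hα0, hα⟩ := hPL.exists_eq_forall_mem_Icc_hasDerivWithinAt₀
  set φ : ℝ → ℝ := fun y => (α y).1 with hφ
  set ψ : ℝ → ℝ := fun y => (α y).2 with hψ
  have dφ : ∀ y ∈ Icc (-1:ℝ) 1, HasDerivWithinAt φ (ψ y) (Icc (-1) 1) y := fun y hy =>
    (hasFDerivAt_fst (𝕜 := ℝ) (p := α y)).comp_hasDerivWithinAt y (hα y hy)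
  have dψ : ∀ y ∈ Icc (-1:ℝ) 1, HasDerivWithinAt ψ (N * G (φ y)) (Icc (-1) 1) y := fun y hy =>
    (hasFDerivAt_snd (𝕜 := ℝ) (p := α y)).comp_hasDerivWithinAt y (hα y hy)
  have φ0 : φ 0 = δ1 := congrArg Prod.fst hα0
  have ψ0 : ψ 0 = 0 := congrArg Prod.snd hα0
  have sub1 : Icc (0:ℝ) 1 ⊆ Icc (-1) 1 := Icc_subset_Icc_left (by norm_num)
  obtain ⟨b, hb, hb0, hbp⟩ := half_bump (φ := φ) (ψ := ψ) (fun y hy => (dφ y (sub1 hy)).mono sub1)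
    (fun y hy => (dψ y (sub1 hy)).mono sub1) φ0 ψ0 dV V0 Vpos Vbig Gneg hg0p hNp hσ hσδ hδ.2 hN1 hN2
  have hmaps : MapsTo (fun y : ℝ => -y) (Icc (0:ℝ) 1) (Icc (-1) 1) := fun y hy =>
    ⟨by linarith [hy.2], by linarith [hy.1]⟩
  obtain ⟨a, ha, ha0, hap⟩ := half_bump (φ := fun y => φ (-y)) (ψ := fun y => -ψ (-y))
    (N := N) (G := G) (V := V) (δ1 := δ1)
    (fun y hy => by
      have := (dφ (-y) (hmaps hy)).scomp y (hasDerivAt_neg y).hasDerivWithinAt hmaps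
      simpa [Function.comp_def] using this)
    (fun y hy => by
      have := ((dψ (-y) (hmaps hy)).scomp y (hasDerivAt_neg y).hasDerivWithinAt hmaps).fun_neg
      simpa [Function.comp_def] using this)
    (by simpa using φ0) (by simpa using ψ0) dV V0 Vpos Vbig Gneg hg0p hNp hσ hσδ hδ.2 hN1 hN2
  have sub2 : Icc (-a) b ⊆ Icc (-1) 1 := Icc_subset_Icc (by linarith [ha.2]) hb.2
  have range : ∀ y ∈ Ioo (-a) b, 0 < φ y ∧ φ y ≤ δ1 := by
    intro y hy
    rcases le_total 0 y with h | h
    · exact hbp y ⟨h, hy.2⟩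
    · have := hap (-y) ⟨by linarith, by linarith [hy.1]⟩
      simpa using this
  obtain ⟨P, hP⟩ := (isCompact_Icc (a := (-1:ℝ)) (b := 1)).exists_bound_of_continuousOn
    (f := ψ) (fun y hy => (dψ y hy).continuousWithinAt)
  refine ⟨Y, η, a, b, P, φ, ψ, hYp, hηp, ha.1, hb.1, φ0, ha0, hb0,
    fun y hy => ((dφ y (sub2 hy)).continuousWithinAt).mono sub2, ?_, ?_⟩
  · intro y hy
    rcases hy.1.eq_or_lt with h | h
    · rw [← h, ha0]; exact hδ0.le
    rcases hy.2.eq_or_lt with h' | h'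
    · rw [h', hb0]; exact hδ0.le
    exact (range y ⟨h, h'⟩).2
  · intro y hy
    have hn : Icc (-1:ℝ) 1 ∈ 𝓝 y := Icc_mem_nhds (by linarith [hy.1, ha.2]) (by linarith [hy.2, hb.2])
    have hyI := sub2 (Ioo_subset_Icc_self hy)
    obtain ⟨r1, r2⟩ := range y hy
    refine ⟨r1, (dφ y hyI).hasDerivAt hn, ?_, hP y hyI⟩
    have := (dψ y hyI).hasDerivAt hn
    rw [hYN]
    have e : G (φ y) = η - f (φ y) := by simp only [hG]; rw [fceq _ ⟨r1.le, r2⟩]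
    rwa [e] at this

end Part4

section Part5

open Set Filter
open scoped Topology

section
variable {d δ L β r : ℝ} {f : ℝ → ℝ} {u : ℝ → ℝ → ℝ} {g h : ℝ → ℝ}

lemma Sol.slice_cont (S : Sol d δ f u g h) {t : ℝ} (ht : 0 ≤ t) :
    ContinuousOn (u t) (Icc (g t) (h t)) := by
  have h1 : ContinuousOn (fun x : ℝ => ((t, x) : ℝ × ℝ)) (Icc (g t) (h t)) := by fun_prop
  exact S.ucont.comp h1 (fun x hx => ⟨ht, hx⟩)

lemma hasDerivAt_expdecay (m k T t : ℝ) :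
    HasDerivAt (fun s => m * Real.exp (-k * (s - T))) (-k * (m * Real.exp (-k * (t - T)))) t := by
  have h1 := ((((hasDerivAt_id t).sub_const T).const_mul (-k)).exp).const_mul m
  refine h1.congr_deriv ?_
  simp only [id]; ring

lemma Sol.pos (F : FDat d δ f L β r) (S : Sol d δ f u g h) :
    ∀ t, 0 ≤ t → ∀ x ∈ Icc (g t) (h t), 0 < u t x := by
  obtain ⟨x1, hx1, hmin⟩ := (isCompact_Icc (a := g 0) (b := h 0)).exists_isMinOn
    ⟨g 0, le_rfl, (S.glt 0 le_rfl).le⟩ (S.slice_cont le_rfl)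
  have hm0 := S.upos0 x1 hx1
  set m := min (u 0 x1) (min δ 1) / 2 with hm
  have hδ := F.hδ
  have hmp : 0 < m := by positivity
  have m1 : m < u 0 x1 := by
    have := min_le_left (u 0 x1) (min δ 1); linarith
  have m2 : m < δ := by
    have := (min_le_right (u 0 x1) (min δ 1)).trans (min_le_left _ _); linarith
  have m3 : m ≤ 1 := by
    have := (min_le_right (u 0 x1) (min δ 1)).trans (min_le_right _ _); linarith
  intro t ht x hx
  have he : ∀ s, 0 ≤ s → m * Real.exp (-(L+1) * (s - 0)) ≤ m := by
    intro s hs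
    have : Real.exp (-(L+1) * (s - 0)) ≤ 1 := Real.exp_le_one_iff.2 (by nlinarith [F.L0])
    nlinarith
  have key := S.lower F.hd (T := 0) (T' := t) le_rfl (l := g) (r := h)
    (U := fun s _ => m * Real.exp (-(L+1) * (s - 0)))
    (S.gcont.mono fun s hs => hs.1) (S.hcont.mono fun s hs => hs.1) (fun _ _ => le_rfl)
    (fun _ _ => le_rfl) (by fun_prop) (by
      intro y hy
      have := he 0 le_rfl
      have h2 : u 0 x1 ≤ u 0 y := hmin hy
      linarith) (by
      intro s hs _
      rw [S.bg s hs.1.le]; linarith [he s hs.1.le]) (by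
      intro s hs _
      rw [S.bh s hs.1.le]; linarith [he s hs.1.le]) (by
      intro s hs y hy _
      refine ⟨_, 0, fun _ => 0, hasDerivAt_expdecay _ _ _ _,
        Eventually.of_forall fun z => hasDerivAt_const z _, hasDerivAt_const _ _, ?_⟩
      have hU0 : 0 < m * Real.exp (-(L+1) * (s - 0)) := by positivity
      have hU1 := he s hs.1.le
      have := F.lip (m * Real.exp (-(L+1) * (s - 0))) ⟨hU0.le, by linarith⟩ 0 ⟨le_rfl, by norm_num⟩
      generalize m * Real.exp (-(L+1) * (s - 0)) = w at *
      rw [F.f0, sub_zero, sub_zero, abs_of_pos hU0] at this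
      have := (abs_le.1 this).1
      linarith)
  have := key t ⟨ht, le_rfl⟩ x hx
  have h2 : 0 < m * Real.exp (-(L+1) * (t - 0)) := by positivity
  linarith

lemma Sol.bump_left (F : FDat d δ f L β r) (S : Sol d δ f u g h) {θ θs δ1 : ℝ}
    (hf : AlleeType f θ) (hθs : IsThetaStar f θ θs) (hδ1 : δ1 ∈ Ioo θs 1) (hδ1δ : δ1 < δ) :
    ∃ x0 k, 0 < k ∧ ∀ t, 0 ≤ t → ∀ x ∈ Icc (g t) (h t), x ≤ x0 + k * t → δ1 < u t x := by
  obtain ⟨Y, η, a, b, P, φ, ψ, hY, hη, ha, hb, φ0, φa, φb, cφ, hle, hin⟩ :=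
    bump_exists F.hd hf hθs hδ1
  have hd := F.hd
  set k := η * Y / (|P| + 1) with hk
  have hkp : 0 < k := by positivity
  refine ⟨g 0 - Y * b - 1, k, hkp, ?_⟩
  intro t ht x hx hxk
  set ξ : ℝ → ℝ := fun s => x - k * (t - s) with hξ
  have cξ : Continuous ξ := by fun_prop
  have hdom : ∀ s y, max (g s) (ξ s - Y * a) ≤ y → y ≤ min (h s) (ξ s + Y * b) →
      (y - ξ s) / Y ∈ Icc (-a) b := by
    intro s y h1 h2
    have h3 := (le_max_right _ _).trans h1
    have h4 := h2.trans (min_le_right _ _)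
    constructor
    · rw [le_div_iff₀ hY]; linarith
    · rw [div_le_iff₀ hY]; linarith
  have hgc : ContinuousOn g (Icc 0 t) := S.gcont.mono fun s hs => hs.1
  have hhc : ContinuousOn h (Icc 0 t) := S.hcont.mono fun s hs => hs.1
  have key := S.lower F.hd (T := 0) (T' := t) le_rfl (l := fun s => max (g s) (ξ s - Y * a))
    (r := fun s => min (h s) (ξ s + Y * b))
    (U := fun s y => φ ((y - ξ s) / Y))
    (hgc.sup (by fun_prop)) (hhc.inf (by fun_prop))
    (fun _ _ => le_max_left _ _) (fun _ _ => min_le_left _ _) (by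
      refine cφ.comp (by fun_prop) ?_
      rintro ⟨s, y⟩ ⟨_, h1, h2⟩
      exact hdom s y h1 h2) (by
      intro y hy
      exfalso
      have h1 := (le_max_left _ _).trans hy.1
      have h2 := hy.2.trans (min_le_right _ _)
      simp only [hξ] at h2
      linarith) (by
      intro s hs hlr
      have hy := hdom s _ le_rfl hlr
      rcases le_total (g s) (ξ s - Y * a) with hc | hc
      · simp only [max_eq_right hc] at hlr ⊢
        have e : (ξ s - Y * a - ξ s) / Y = -a := by field_simp; ring
        rw [e, φa]
        exact S.pos F s hs.1.le _ ⟨hc, hlr.trans (min_le_left _ _)⟩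
      · simp only [max_eq_left hc] at hy ⊢
        rw [S.bg s hs.1.le]
        exact (hle _ hy).trans_lt hδ1δ) (by
      intro s hs hlr
      have hy := hdom s _ hlr le_rfl
      rcases le_total (ξ s + Y * b) (h s) with hc | hc
      · simp only [min_eq_right hc] at hlr ⊢
        have e : (ξ s + Y * b - ξ s) / Y = b := by field_simp; ring
        rw [e, φb]
        exact S.pos F s hs.1.le _ ⟨(le_max_left _ _).trans hlr, hc⟩
      · simp only [min_eq_left hc] at hy ⊢
        rw [S.bh s hs.1.le]
        exact (hle _ hy).trans_lt hδ1δ) (by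
      intro s hs y hy _
      have hmem : (y - ξ s) / Y ∈ Ioo (-a) b := by
        have h3 := (le_max_right _ _).trans_lt hy.1
        have h4 := hy.2.trans_le (min_le_right _ _)
        constructor
        · rw [lt_div_iff₀ hY]; linarith
        · rw [div_lt_iff₀ hY]; linarith
      obtain ⟨p1, p2, p3, p4⟩ := hin _ hmem
      refine ⟨ψ ((y - ξ s) / Y) * (-k / Y), Y ^ 2 / d * (η - f (φ ((y - ξ s) / Y))) * (1 / Y) / Y,
        fun z => ψ ((z - ξ s) / Y) / Y, ?_, ?_, ?_, ?_⟩
      · have h1 : HasDerivAt (fun s => (y - ξ s) / Y) (-k / Y) s := by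
          have h0 := ((((hasDerivAt_id s).const_sub t).const_mul k).const_sub x).const_sub y
          refine (h0.div_const Y).congr_deriv ?_
          ring
        exact p2.comp s h1
      · have hc : ContinuousAt (fun z => (z - ξ s) / Y) y := by fun_prop
        filter_upwards [hc.eventually (Ioo_mem_nhds hmem.1 hmem.2)] with z hz
        have h1 : HasDerivAt (fun z => (z - ξ s) / Y) (1 / Y) z :=
          ((hasDerivAt_id z).sub_const _).div_const Y
        refine ((hin _ hz).2.1.comp z h1).congr_deriv ?_
        ring
      · have h1 : HasDerivAt (fun z => (z - ξ s) / Y) (1 / Y) y :=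
          ((hasDerivAt_id y).sub_const _).div_const Y
        exact (p3.comp y h1).div_const Y
      · have e : d * (Y ^ 2 / d * (η - f (φ ((y - ξ s) / Y))) * (1 / Y) / Y) +
            f (φ ((y - ξ s) / Y)) = η := by field_simp; ring
        rw [e]
        have h1 : ψ ((y - ξ s) / Y) * (-k / Y) ≤ |P| * (k / Y) := by
          have : -ψ ((y - ξ s) / Y) ≤ |P| := (neg_le_abs _).trans (p4.trans (le_abs_self _))
          have := mul_le_mul_of_nonneg_right this (show 0 ≤ k / Y by positivity)
          calc ψ ((y - ξ s) / Y) * (-k / Y) = -ψ ((y - ξ s) / Y) * (k / Y) := by ring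
            _ ≤ _ := this
        have h2 : |P| * (k / Y) < η := by
          have : k / Y = η / (|P| + 1) := by rw [hk]; field_simp
          rw [this, mul_div_assoc', div_lt_iff₀ (by positivity)]
          nlinarith
        linarith)
  have := key t ⟨ht, le_rfl⟩ x ⟨max_le hx.1 (by simp only [hξ]; nlinarith),
    le_min hx.2 (by simp only [hξ]; nlinarith)⟩
  simpa [hξ, φ0] using this

/-- Eventually the solution is above `δ` in the interior. -/
lemma Sol.above (F : FDat d δ f L β r) (S : Sol d δ f u g h) {θ θs : ℝ}
    (hf : AlleeType f θ) (hθs : IsThetaStar f θ θs) (hδ : δ ∈ Ioo θs 1) :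
    ∃ T, 0 < T ∧ ∀ t, T ≤ t → ∀ x ∈ Ioo (g t) (h t), δ < u t x := by
  set δ1 := (θs + δ) / 2 with hδ1
  have hδ1I : δ1 ∈ Ioo θs 1 := ⟨by linarith [hδ.1], by linarith [hδ.1, hδ.2]⟩
  have hδ1δ : δ1 < δ := by linarith [hδ.1]
  have hθ1 : θ < δ1 := hθs.1.1.trans_lt hδ1I.1
  have hδ10 : 0 < δ1 := hf.2.1.1.trans_lt hθ1
  obtain ⟨x0, k, hk, h1⟩ := S.bump_left F hf hθs hδ1I hδ1δ
  obtain ⟨x0', k', hk', h1'⟩ := S.refl.bump_left F hf hθs hδ1I hδ1δ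
  -- everything above δ1
  obtain ⟨T1, hT1, habove⟩ : ∃ T1, 0 ≤ T1 ∧ ∀ t, T1 ≤ t → ∀ x ∈ Icc (g t) (h t), δ1 < u t x := by
    refine ⟨|x0| / k + |x0'| / k', by positivity, fun t ht x hx => ?_⟩
    have e1 : 0 ≤ |x0| / k := by positivity
    have e2 : 0 ≤ |x0'| / k' := by positivity
    have ht0 : 0 ≤ t := by linarith
    rcases le_total x 0 with hc | hc
    · refine h1 t ht0 x hx ?_
      have : |x0| ≤ k * t := by
        have : |x0| / k ≤ t := by linarith
        rwa [div_le_iff₀ hk, mul_comm] at this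
      linarith [neg_abs_le x0]
    · have := h1' t ht0 (-x) ⟨by linarith [hx.2], by linarith [hx.1]⟩ (by
        have : |x0'| ≤ k' * t := by
          have : |x0'| / k' ≤ t := by linarith
          rwa [div_le_iff₀ hk', mul_comm] at this
        linarith [neg_abs_le x0'])
      simpa using this
  -- positive lower bound of f on [δ1,δ]
  obtain ⟨s1, hs1, hmin⟩ := (isCompact_Icc (a := δ1) (b := δ)).exists_isMinOn
    ⟨δ1, le_rfl, hδ1δ.le⟩ (F.fcont.mono fun y hy => hδ10.le.trans hy.1)
  have hfs1 : 0 < f s1 := hf.2.2.2.2.2.2.2.2.1 s1 ⟨hθ1.trans_le hs1.1, hs1.2.trans_lt hδ.2⟩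
  set m := f s1 / 2 with hm
  have hmp : 0 < m := by positivity
  set τ := (δ - δ1) / m with hτ
  have hτp : 0 < τ := div_pos (by linarith) hmp
  have hge : ∀ t, T1 + τ ≤ t → ∀ x ∈ Icc (g t) (h t), δ ≤ u t x := by
    intro t ht x hx
    refine le_of_forall_pos_lt_add fun ε hε => ?_
    set ε' := min ε ((δ - δ1)) with hε'
    have hε'p : 0 < ε' := lt_min hε (by linarith)
    have hε'1 : ε' ≤ ε := min_le_left _ _
    have hmτ : m * τ = δ - δ1 := by rw [hτ]; field_simp
    have key := S.lower F.hd (T := t - τ) (T' := t) (by linarith) (l := g) (r := h)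
      (U := fun s _ => δ - ε' - m * (t - s))
      (S.gcont.mono fun s hs => by have := hs.1; show 0 ≤ s; linarith)
      (S.hcont.mono fun s hs => by have := hs.1; show 0 ≤ s; linarith) (fun _ _ => le_rfl)
      (fun _ _ => le_rfl) (by fun_prop) (by
        intro y hy
        have := habove (t - τ) (by linarith) y hy
        have e : m * (t - (t - τ)) = δ - δ1 := by rw [← hmτ]; ring
        rw [e]; linarith) (by
        intro s hs _
        rw [S.bg s (by linarith [hs.1])]
        nlinarith [hs.2]) (by
        intro s hs _
        rw [S.bh s (by linarith [hs.1])]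
        nlinarith [hs.2]) (by
        intro s hs y hy he
        refine ⟨m, 0, fun _ => 0, ?_,
          Eventually.of_forall fun z => hasDerivAt_const z _, hasDerivAt_const _ _, ?_⟩
        · have h0 := ((((hasDerivAt_id s).const_sub t).const_mul m).const_sub (δ - ε'))
          refine h0.congr_deriv ?_
          ring
        · have h2 := habove s (by linarith [hs.1]) y ⟨hy.1.le, hy.2.le⟩
          rw [he] at h2
          have h3 : f s1 ≤ f (δ - ε' - m * (t - s)) := hmin ⟨h2.le, by nlinarith [hs.2]⟩
          linarith)
    have := key t ⟨by linarith, le_rfl⟩ x hx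
    simp only [sub_self, mul_zero, sub_zero] at this
    linarith
  refine ⟨T1 + τ + 1, by linarith, fun t ht x hx => ?_⟩
  have ht0 : 0 < t := by linarith
  refine lt_of_le_of_ne (hge t (by linarith) x ⟨hx.1.le, hx.2.le⟩) fun heq => ?_
  obtain ⟨A, B, V, hA, hV, hB, e⟩ := S.int t ht0 x hx
  have hB0 : 0 ≤ B := by
    refine second_deriv_nonneg ?_ hV hB
    filter_upwards [Ioo_mem_nhds hx.1 hx.2] with y hy
    rw [← heq]; exact hge t (by linarith) y ⟨hy.1.le, hy.2.le⟩
  have hA0 : A ≤ 0 := by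
    refine deriv_nonpos_of_left hA ?_
    have c1 : ContinuousAt g t := (S.gcont t ht0.le).continuousAt (Ici_mem_nhds ht0)
    have c2 : ContinuousAt h t := (S.hcont t ht0.le).continuousAt (Ici_mem_nhds ht0)
    have e1 := nhdsWithin_le_nhds (s := Iio t) (c1.tendsto.eventually_lt_const hx.1)
    have e2 := nhdsWithin_le_nhds (s := Iio t) (c2.tendsto.eventually_const_lt hx.2)
    filter_upwards [e1, e2, Ioo_mem_nhdsLT (show t - 1 < t by linarith)] with s h1 h2 h3
    rw [← heq]; exact hge s (by linarith [h3.1]) x ⟨le_of_lt h1, le_of_lt h2⟩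
  have := F.fpos δ ⟨le_rfl, F.hδ1⟩
  rw [← heq] at e
  nlinarith [F.hd]
end

end Part5

section Part6

open Set Filter
open scoped Topology

/-- A solution which is above `δ` in the interior from time `T0` on. -/
structure SolE (d δ : ℝ) (f : ℝ → ℝ) (u : ℝ → ℝ → ℝ) (g h : ℝ → ℝ) (T0 : ℝ) : Prop where
  sol : Sol d δ f u g h
  T0pos : 0 < T0
  above : ∀ t, T0 ≤ t → ∀ x ∈ Ioo (g t) (h t), δ < u t x

section
variable {d δ L β r T0 : ℝ} {f : ℝ → ℝ} {u : ℝ → ℝ → ℝ} {g h : ℝ → ℝ}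

lemma SolE.refl (S : SolE d δ f u g h T0) :
    SolE d δ f (fun t x => u t (-x)) (fun t => -h t) (fun t => -g t) T0 where
  sol := S.sol.refl
  T0pos := S.T0pos
  above := fun t ht x hx => S.above t ht (-x) ⟨by linarith [hx.2], by linarith [hx.1]⟩

lemma SolE.ge (S : SolE d δ f u g h T0) {t : ℝ} (ht : T0 ≤ t) :
    ∀ x ∈ Icc (g t) (h t), δ ≤ u t x := by
  intro x hx
  have ht0 : 0 ≤ t := S.T0pos.le.trans ht
  rcases hx.1.eq_or_lt with h1 | h1
  · rw [← h1, S.sol.bg t ht0]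
  rcases hx.2.eq_or_lt with h2 | h2
  · rw [h2, S.sol.bh t ht0]
  exact (S.above t ht x ⟨h1, h2⟩).le

lemma SolE.hmono (F : FDat d δ f L β r) (S : SolE d δ f u g h T0) : MonotoneOn h (Ici T0) := by
  have hd := F.hd
  have hδ := F.hδ
  have hder : ∀ t, T0 ≤ t → ∃ m, 0 ≤ m ∧ HasDerivAt h m t := by
    intro t ht
    obtain ⟨m, h1, h2⟩ := S.sol.hder t (S.T0pos.trans_le ht)
    have ht0 : 0 ≤ t := S.T0pos.le.trans ht
    have := slope_right (S.sol.glt t ht0) h1 (hasDerivAt_const (h t) δ) (S.sol.bh t ht0)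
      (fun y hy => (S.above t ht y hy).le)
    exact ⟨_, by have : 0 ≤ d / δ := by positivity
                 nlinarith, h2⟩
  refine monotoneOn_of_deriv_nonneg (convex_Ici T0)
    (S.sol.hcont.mono fun t ht => S.T0pos.le.trans ht) ?_ ?_
  · intro t ht
    obtain ⟨m, -, h2⟩ := hder t (interior_subset ht)
    exact h2.differentiableAt.differentiableWithinAt
  · intro t ht
    obtain ⟨m, h1, h2⟩ := hder t (interior_subset ht)
    rw [h2.deriv]; exact h1

lemma SolE.ganti (F : FDat d δ f L β r) (S : SolE d δ f u g h T0) : AntitoneOn g (Ici T0) := by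
  intro a ha b hb hab
  have := S.refl.hmono F ha hb hab
  linarith

lemma FDat.fmin (F : FDat d δ f L β r) {y : ℝ} (hy : δ ≤ y) (hy1 : y < 1) :
    ∃ m, 0 < m ∧ ∀ s ∈ Icc δ y, m ≤ f s := by
  obtain ⟨s1, hs1, hmin⟩ := (isCompact_Icc (a := δ) (b := y)).exists_isMinOn
    ⟨δ, le_rfl, hy⟩ (F.fcont.mono fun y hy => F.hδ.le.trans hy.1)
  exact ⟨f s1, F.fpos s1 ⟨hs1.1, hs1.2.trans_lt hy1⟩, fun s hs => hmin hs⟩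

set_option maxHeartbeats 2000000 in
lemma SolE.h_large (F : FDat d δ f L β r) (S : SolE d δ f u g h T0) (X : ℝ) :
    ∃ T, T0 ≤ T ∧ ∀ t, T ≤ t → X < h t := by
  have hd := F.hd
  have hδ := F.hδ
  have hT0 := S.T0pos
  have hglt := S.sol.glt T0 hT0.le
  set x1 := (2 * g T0 + h T0) / 3 with hx1
  set H0 := (g T0 + 2 * h T0) / 3 with hH0
  have a1 : g T0 < x1 := by linarith
  have a2 : x1 < H0 := by linarith
  have a3 : H0 < h T0 := by linarith
  by_cases hX : X ≤ H0
  · refine ⟨T0, le_rfl, fun t ht => ?_⟩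
    have := S.hmono F (a := T0) (mem_Ici.2 le_rfl) (b := t) ht ht
    linarith
  push Not at hX
  obtain ⟨x2, hx2, hmin⟩ := (isCompact_Icc (a := x1) (b := H0)).exists_isMinOn
    ⟨x1, le_rfl, a2.le⟩ ((S.sol.slice_cont hT0.le).mono
      (fun y hy => ⟨a1.le.trans hy.1, hy.2.trans a3.le⟩))
  set ι := u T0 x2 - δ with hι
  have hιp : 0 < ι := by
    have := S.above T0 le_rfl x2 ⟨a1.trans_le hx2.1, hx2.2.trans_lt a3⟩
    linarith
  set ρ := (1 - δ) / 2 with hρ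
  have hρp : 0 < ρ := by have := F.hδ1; rw [hρ]; linarith
  obtain ⟨m, hm, hmf⟩ := F.fmin (y := δ + ρ) (by linarith) (by rw [hρ]; linarith [F.hδ1])
  set k1 := d / (2 * δ) * (H0 - x1) with hk1
  have hk1p : 0 < k1 := mul_pos (by positivity) (by linarith)
  set M := (X - x1) ^ 2 + (X - x1) * k1 + 2 * d + 1 with hM
  have hXx : 0 < X - x1 := by linarith
  have hMp : 0 < M := by positivity
  set w := min (min ι ρ) m with hw
  have hwp : 0 < w := by positivity
  have hw1 : w ≤ ι := (min_le_left _ _).trans (min_le_left _ _)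
  have hw2 : w ≤ ρ := (min_le_left _ _).trans (min_le_right _ _)
  have hw3 : w ≤ m := min_le_right _ _
  set κ := min 1 (w / (2 * M)) with hκ
  have hκp : 0 < κ := by positivity
  have hκ1 : κ ≤ 1 := min_le_left _ _
  have hκM : κ * M < w := by
    have h1 : κ * M ≤ w / (2 * M) * M := mul_le_mul_of_nonneg_right (min_le_right _ _) hMp.le
    have h2 : w / (2 * M) * M = w / 2 := by field_simp
    linarith
  set k := κ * k1 with hk
  have hkp : 0 < k := by positivity
  have hkk1 : k ≤ k1 := by nlinarith
  set τ := (X - H0) / k with hτ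
  have hτp : 0 < τ := div_pos (by linarith) hkp
  have hkτ : k * τ = X - H0 := by rw [hτ]; field_simp
  set H : ℝ → ℝ := fun t => H0 + k * (t - T0) with hHd
  have hHX : ∀ t ∈ Icc T0 (T0 + τ), H0 ≤ H t ∧ H t ≤ X := by
    intro t ht
    simp only [hHd]
    constructor
    · nlinarith [ht.1]
    · nlinarith [ht.2]
  have sq : ∀ t ∈ Icc T0 (T0 + τ), ∀ x ∈ Icc x1 (H t), 0 ≤ (x - x1) * (H t - x) ∧
      (x - x1) * (H t - x) ≤ (X - x1) ^ 2 := by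
    intro t ht x hx
    obtain ⟨b1, b2⟩ := hHX t ht
    have c1 : 0 ≤ x - x1 := by linarith [hx.1]
    have c2 : 0 ≤ H t - x := by linarith [hx.2]
    refine ⟨mul_nonneg c1 c2, ?_⟩
    rw [pow_two]
    exact mul_le_mul (by linarith) (by linarith [hx.1]) c2 hXx.le
  have κsq : κ * (X - x1) ^ 2 < w := by
    refine lt_of_le_of_lt (mul_le_mul_of_nonneg_left ?_ hκp.le) hκM
    rw [hM]
    have : 0 < (X - x1) * k1 := by positivity
    linarith
  have key := S.sol.fb_lower hd hδ (T := T0) (T' := T0 + τ) (L := x1) hT0.le (H := H)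
    (U := fun t x => δ + κ * ((x - x1) * (H t - x))) (by fun_prop) (by fun_prop) (by
      intro t ht
      have := S.ganti F (a := T0) (mem_Ici.2 le_rfl) (b := t) ht.1 ht.1
      linarith) (by
      intro t ht; linarith [(hHX t ht).1]) (by
      intro t ht; exact S.above t ht.1) (by
      intro t ht; simp) (by
      intro t ht
      have htI : t ∈ Icc T0 (T0 + τ) := ⟨ht.1.le, ht.2⟩
      refine ⟨k, -(κ * (H t - x1)), ?_, ?_, ?_⟩
      · have h0 := (((hasDerivAt_id t).sub_const T0).const_mul k).const_add H0
        refine h0.congr_deriv ?_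
        ring
      · have h0 := ((((hasDerivAt_id (H t)).sub_const x1).mul
          ((hasDerivAt_id (H t)).const_sub (H t))).const_mul κ).const_add δ
        refine h0.congr_deriv ?_
        simp only [id]; ring
      · have h1 := (hHX t htI).1
        have h2 : κ * (H0 - x1) ≤ κ * (H t - x1) := mul_le_mul_of_nonneg_left (by linarith) hκp.le
        have h3 : d / δ * (κ * (H0 - x1)) ≤ d / δ * (κ * (H t - x1)) :=
          mul_le_mul_of_nonneg_left h2 (by positivity)
        have h4 : d / δ * (κ * (H0 - x1)) = 2 * k := by rw [hk, hk1]; field_simp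
        linarith) (by
      simp only [hHd]; linarith) (by
      intro x hx
      have hmem : T0 ∈ Icc T0 (T0 + τ) := ⟨le_rfl, by linarith⟩
      have h1 := (sq T0 hmem x hx).2
      have h2 : κ * ((x - x1) * (H T0 - x)) ≤ κ * (X - x1) ^ 2 := mul_le_mul_of_nonneg_left h1 hκp.le
      have h3 : u T0 x2 ≤ u T0 x := hmin ⟨hx.1, by
        have := hx.2; simp only [hHd] at this; linarith⟩
      linarith) (by
      intro t ht
      have h1 := S.ganti F (a := T0) (mem_Ici.2 le_rfl) (b := t) ht.1 ht.1
      have h2 := S.hmono F (a := T0) (mem_Ici.2 le_rfl) (b := t) ht.1 ht.1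
      have := S.above t ht.1 x1 ⟨by linarith, by linarith⟩
      simpa using this) (by
      intro t ht x hx _
      have htI : t ∈ Icc T0 (T0 + τ) := ⟨ht.1.le, ht.2⟩
      refine ⟨κ * ((x - x1) * k), -(2 * κ), fun y => κ * (H t - y - (y - x1)), ?_, ?_, ?_, ?_⟩
      · have h0 := (((((((hasDerivAt_id t).sub_const T0).const_mul k).const_add H0).sub_const x).const_mul
          (x - x1)).const_mul κ).const_add δ
        refine h0.congr_deriv ?_
        ring
      · refine Eventually.of_forall fun y => ?_
        have h0 := ((((hasDerivAt_id y).sub_const x1).mul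
          ((hasDerivAt_id y).const_sub (H t))).const_mul κ).const_add δ
        refine h0.congr_deriv ?_
        simp only [id]; ring
      · have h0 := ((((hasDerivAt_id x).const_sub (H t)).sub ((hasDerivAt_id x).sub_const x1)).const_mul κ)
        refine h0.congr_deriv ?_
        ring
      · obtain ⟨s1, s2⟩ := sq t htI x ⟨hx.1.le, hx.2.le⟩
        have h2 : κ * ((x - x1) * (H t - x)) ≤ κ * (X - x1) ^ 2 := mul_le_mul_of_nonneg_left s2 hκp.le
        have h2' : 0 ≤ κ * ((x - x1) * (H t - x)) := mul_nonneg hκp.le s1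
        have h3 := hmf (δ + κ * ((x - x1) * (H t - x))) ⟨by linarith, by linarith⟩
        have h4 : (x - x1) * k ≤ (X - x1) * k1 :=
          mul_le_mul (by linarith [hx.2, (hHX t htI).2]) hkk1 hkp.le hXx.le
        have h5 : κ * ((x - x1) * k + 2 * d) ≤ κ * M := by
          refine mul_le_mul_of_nonneg_left ?_ hκp.le
          rw [hM]
          have : 0 ≤ (X - x1) ^ 2 := by positivity
          linarith
        nlinarith)
  refine ⟨T0 + τ, by linarith, fun t ht => ?_⟩
  have h1 := (key (T0 + τ) ⟨by linarith, le_rfl⟩).1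
  have h2 : H (T0 + τ) = X := by simp only [hHd]; linarith
  have h3 := S.hmono F (a := T0 + τ) (mem_Ici.2 (by linarith)) (b := t) (mem_Ici.2 (by linarith)) ht
  linarith

lemma SolE.large (F : FDat d δ f L β r) (S : SolE d δ f u g h T0) (X : ℝ) :
    ∃ T, T0 ≤ T ∧ ∀ t, T ≤ t → X < h t ∧ g t < -X := by
  obtain ⟨T1, h1, h1'⟩ := S.h_large F X
  obtain ⟨T2, h2, h2'⟩ := S.refl.h_large F X
  refine ⟨max T1 T2, h1.trans (le_max_left _ _), fun t ht => ?_⟩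
  have := h2' t ((le_max_right _ _).trans ht)
  exact ⟨h1' t ((le_max_left _ _).trans ht), by linarith⟩

/-- Parabola lemma. -/
lemma SolE.parabola (F : FDat d δ f L β r) (S : SolE d δ f u g h T0) {T τ κ b x0 : ℝ}
    (hT : T0 ≤ T) (hκ : 0 < κ) (hb : 0 < b) (hg : g T < x0 - b) (hh : x0 + b < h T)
    (hf : ∀ y ∈ Icc δ (δ + κ * τ), κ + 2 * d * (κ * τ) / b ^ 2 < f y) :
    ∀ t ∈ Icc T (T + τ), ∀ x ∈ Icc (x0 - b) (x0 + b),
      δ + κ * (t - T) * (1 - (x - x0) ^ 2 / b ^ 2) < u t x := by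
  have hd := F.hd
  have hab : ∀ t ∈ Icc T (T + τ), ∀ x ∈ Icc (x0 - b) (x0 + b), δ < u t x := by
    intro t ht x hx
    have h1 := S.ganti F (a := T) hT (b := t) (hT.trans ht.1) ht.1
    have h2 := S.hmono F (a := T) hT (b := t) (hT.trans ht.1) ht.1
    exact S.above t (hT.trans ht.1) x ⟨by linarith [hx.1], by linarith [hx.2]⟩
  refine S.sol.lower hd (S.T0pos.le.trans hT) (l := fun _ => x0 - b) (r := fun _ => x0 + b)
    (U := fun t x => δ + κ * (t - T) * (1 - (x - x0) ^ 2 / b ^ 2))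
    continuousOn_const continuousOn_const ?_ ?_ (by fun_prop) ?_ ?_ ?_ ?_
  · intro t ht
    have h1 := S.ganti F (a := T) hT (b := t) (hT.trans ht.1) ht.1
    linarith
  · intro t ht
    have h1 := S.hmono F (a := T) hT (b := t) (hT.trans ht.1) ht.1
    linarith
  · intro x hx
    simp only [sub_self, mul_zero, zero_mul, add_zero]
    by_cases hτ : 0 ≤ τ
    · exact hab T ⟨le_rfl, by linarith⟩ x hx
    · have := S.above T hT x ⟨by linarith [hx.1], by linarith [hx.2]⟩
      exact this
  · intro t ht hlr
    have e : (1 - (x0 - b - x0) ^ 2 / b ^ 2) = 0 := by field_simp; ring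
    rw [e, mul_zero, add_zero]
    exact hab t ⟨ht.1.le, ht.2⟩ _ ⟨le_rfl, hlr⟩
  · intro t ht hlr
    have e : (1 - (x0 + b - x0) ^ 2 / b ^ 2) = 0 := by field_simp; ring
    rw [e, mul_zero, add_zero]
    exact hab t ⟨ht.1.le, ht.2⟩ _ ⟨hlr, le_rfl⟩
  · intro t ht x hx _
    have hq0 : 0 ≤ (x - x0) ^ 2 / b ^ 2 := by positivity
    have hq1 : (x - x0) ^ 2 / b ^ 2 ≤ 1 := by
      rw [div_le_one (by positivity)]
      have : |x - x0| ≤ |b| := by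
        rw [abs_of_pos hb, abs_le]; constructor <;> linarith [hx.1, hx.2]
      exact sq_le_sq.2 this
    refine ⟨κ * (1 - (x - x0) ^ 2 / b ^ 2), -(2 * (κ * (t - T)) / b ^ 2),
      fun y => κ * (t - T) * (-(2 * (y - x0)) / b ^ 2), ?_, ?_, ?_, ?_⟩
    · have h0 := (((((hasDerivAt_id t).sub_const T).const_mul κ).mul_const
        (1 - (x - x0) ^ 2 / b ^ 2))).const_add δ
      refine h0.congr_deriv ?_
      ring
    · refine Eventually.of_forall fun y => ?_
      have h0 := (((((((hasDerivAt_id y).sub_const x0).pow 2).div_const (b ^ 2)).const_sub 1).const_mul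
        (κ * (t - T)))).const_add δ
      refine h0.congr_deriv ?_
      simp; ring
    · have h0 := ((((((hasDerivAt_id x).sub_const x0).const_mul 2).neg).div_const (b ^ 2)).const_mul
        (κ * (t - T)))
      refine h0.congr_deriv ?_
      ring
    · have hs0 : 0 < t - T := by linarith [ht.1]
      have hs1 : κ * (t - T) ≤ κ * τ := mul_le_mul_of_nonneg_left (by linarith [ht.2]) hκ.le
      have hs2 : 0 < κ * (t - T) := by positivity
      have h1 : κ * (t - T) * (1 - (x - x0) ^ 2 / b ^ 2) ≤ κ * (t - T) * 1 :=
        mul_le_mul_of_nonneg_left (by linarith) hs2.le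
      have h2 : 0 ≤ κ * (t - T) * (1 - (x - x0) ^ 2 / b ^ 2) := mul_nonneg hs2.le (by linarith)
      have h3 := hf (δ + κ * (t - T) * (1 - (x - x0) ^ 2 / b ^ 2)) ⟨by linarith, by linarith⟩
      have h4 : κ * (1 - (x - x0) ^ 2 / b ^ 2) ≤ κ * 1 := mul_le_mul_of_nonneg_left (by linarith) hκ.le
      have h5 : d * (2 * (κ * (t - T)) / b ^ 2) ≤ 2 * d * (κ * τ) / b ^ 2 := by
        rw [mul_div_assoc']
        refine div_le_div_of_nonneg_right ?_ (by positivity)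
        nlinarith
      linarith

/-- Locally uniform lower convergence to 1. -/
lemma SolE.near_one (F : FDat d δ f L β r) (S : SolE d δ f u g h T0) {ε : ℝ} (hε : 0 < ε) (X : ℝ) :
    ∃ T, T0 ≤ T ∧ ∀ t, T ≤ t → ∀ x ∈ Icc (-X) X, 1 - ε < u t x := by
  have hd := F.hd
  have hδ1 := F.hδ1
  have hδ := F.hδ
  set e := min ε ((1 - δ)) with he
  have hep : 0 < e := lt_min hε (by linarith)
  have he1 : e ≤ ε := min_le_left _ _
  have he2 : e ≤ 1 - δ := min_le_right _ _
  obtain ⟨m, hm, hmf⟩ := F.fmin (y := 1 - e / 2) (by linarith) (by linarith)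
  set κ := m / 2 with hκ
  have hκp : 0 < κ := by positivity
  set τ := (1 - δ - e / 2) / κ with hτ
  have hκτ : κ * τ = 1 - δ - e / 2 := by rw [hτ]; field_simp
  have hτp : 0 < τ := div_pos (by linarith) hκp
  set b := 2 * d * τ + 2 * |X| / e * (|X| + 1) + |X| + 1 with hb
  have hb1 : 1 ≤ b := by
    have : 0 ≤ 2 * d * τ + 2 * |X| / e * (|X| + 1) + |X| := by positivity
    linarith
  have hbX : |X| ≤ b := by
    have : 0 ≤ 2 * d * τ + 2 * |X| / e * (|X| + 1) := by positivity
    linarith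
  have hb0 : 0 < b := by linarith
  have hb2 : 2 * d * τ < b ^ 2 := by
    have : 2 * d * τ < b := by
      have : 0 ≤ 2 * |X| / e * (|X| + 1) + |X| := by positivity
      linarith
    nlinarith
  have hbe : X ^ 2 / b ^ 2 ≤ e / 2 := by
    rw [div_le_iff₀ (by positivity), ← sq_abs X]
    have h1 : 2 * |X| / e * (|X| + 1) ≤ b := by
      have : 0 ≤ 2 * d * τ + |X| + 1 := by positivity
      linarith
    have h2 : 2 * |X| * (|X| + 1) ≤ b * e := by
      have := mul_le_mul_of_nonneg_right h1 hep.le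
      have e1 : 2 * |X| / e * (|X| + 1) * e = 2 * |X| * (|X| + 1) := by field_simp
      linarith
    have h3 : 0 ≤ |X| := abs_nonneg X
    nlinarith
  obtain ⟨T1, hT1, hbig⟩ := S.large F b
  refine ⟨T1 + τ, by linarith, fun t ht x hx => ?_⟩
  obtain ⟨c1, c2⟩ := hbig (t - τ) (by linarith)
  have key := S.parabola F (T := t - τ) (τ := τ) (κ := κ) (b := b) (x0 := 0) (by linarith) hκp hb0
    (by linarith) (by linarith) (by
      intro y hy
      have h1 := hmf y ⟨hy.1, by linarith [hy.2]⟩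
      have h2 : 2 * d * (κ * τ) / b ^ 2 < κ := by
        rw [div_lt_iff₀ (by positivity)]; nlinarith
      linarith) t ⟨by linarith, by linarith⟩ x (by
      have := le_abs_self X
      constructor <;> linarith [hx.1, hx.2])
  have h1 : (x - 0) ^ 2 / b ^ 2 ≤ e / 2 := by
    refine le_trans (div_le_div_of_nonneg_right ?_ (by positivity)) hbe
    rw [sub_zero]
    exact sq_le_sq' hx.1 hx.2
  have e2 : κ * (t - (t - τ)) = 1 - δ - e / 2 := by rw [← hκτ]; ring
  rw [e2] at key
  have h3 : (1 - δ - e / 2) * (1 - e / 2) ≤ (1 - δ - e / 2) * (1 - (x - 0) ^ 2 / b ^ 2) :=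
    mul_le_mul_of_nonneg_left (by linarith) (by linarith)
  nlinarith

/-- Eventual upper bound. -/
lemma Sol.upper_one (F : FDat d δ f L β r) (S : Sol d δ f u g h) {ε : ℝ} (hε : 0 < ε) :
    ∃ T, 0 ≤ T ∧ ∀ t, T ≤ t → ∀ x ∈ Icc (g t) (h t), u t x < 1 + ε := by
  obtain ⟨x1, hx1, hmax⟩ := (isCompact_Icc (a := g 0) (b := h 0)).exists_isMaxOn
    ⟨g 0, le_rfl, (S.glt 0 le_rfl).le⟩ (S.slice_cont le_rfl)
  set M := |u 0 x1| + 1 with hM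
  have hMp : 0 < M := by positivity
  obtain ⟨s1, hs1, hmin⟩ := (isCompact_Icc (a := 1 + ε / 2) (b := 1 + ε / 2 + M)).exists_isMaxOn
    ⟨1 + ε / 2, le_rfl, by linarith⟩ (F.fcont.mono fun y hy => by
      have := hy.1; show 0 ≤ y; linarith)
  have hf1 : f s1 < 0 := F.fneg s1 (by linarith [hs1.1])
  set k := -f s1 / (2 * M) with hk
  have hkp : 0 < k := div_pos (by linarith) (by positivity)
  have hkM : k * M < - f s1 := by
    have : k * M = -f s1 / 2 := by rw [hk]; field_simp
    linarith
  have hδ1 := F.hδ1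
  have hexp : ∀ s, 0 ≤ s → 0 < M * Real.exp (-k * (s - 0)) ∧ M * Real.exp (-k * (s - 0)) ≤ M := by
    intro s hs
    have : Real.exp (-k * (s - 0)) ≤ 1 := Real.exp_le_one_iff.2 (by nlinarith)
    exact ⟨by positivity, by nlinarith⟩
  have key : ∀ t, 0 ≤ t → ∀ x ∈ Icc (g t) (h t), u t x < 1 + ε / 2 + M * Real.exp (-k * (t - 0)) := by
    intro t ht
    refine S.upper F.hd (T := 0) (T' := t) le_rfl (l := g) (r := h)
      (U := fun s _ => 1 + ε / 2 + M * Real.exp (-k * (s - 0)))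
      (S.gcont.mono fun s hs => hs.1) (S.hcont.mono fun s hs => hs.1) (fun _ _ => le_rfl)
      (fun _ _ => le_rfl) (by fun_prop) ?_ ?_ ?_ ?_ t ⟨ht, le_rfl⟩
    · intro y hy
      have h1 : u 0 y ≤ u 0 x1 := hmax hy
      have h2 := le_abs_self (u 0 x1)
      simp only [sub_self, mul_zero, Real.exp_zero, mul_one]
      linarith
    · intro s hs _
      rw [S.bg s hs.1.le]; linarith [(hexp s hs.1.le).1]
    · intro s hs _
      rw [S.bh s hs.1.le]; linarith [(hexp s hs.1.le).1]
    · intro s hs y hy _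
      refine ⟨_, 0, fun _ => 0, (hasDerivAt_expdecay M k 0 s).const_add _,
        Eventually.of_forall fun z => hasDerivAt_const z _, hasDerivAt_const _ _, ?_⟩
      obtain ⟨p1, p2⟩ := hexp s hs.1.le
      have h1 : f (1 + ε / 2 + M * Real.exp (-k * (s - 0))) ≤ f s1 := hmin ⟨by linarith, by linarith⟩
      have h2 : k * (M * Real.exp (-k * (s - 0))) ≤ k * M := mul_le_mul_of_nonneg_left p2 hkp.le
      linarith
  have hlim : Tendsto (fun t : ℝ => M * Real.exp (-k * (t - 0))) atTop (𝓝 (M * 0)) := by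
    refine Tendsto.const_mul M (Real.tendsto_exp_atBot.comp ?_)
    simp only [sub_zero]
    exact tendsto_id.const_mul_atTop_of_neg (by linarith)
  rw [mul_zero] at hlim
  obtain ⟨T, hT⟩ := eventually_atTop.1 (hlim.eventually_lt_const (show 0 < ε / 2 by linarith))
  refine ⟨max T 0, le_max_right _ _, fun t ht x hx => ?_⟩
  have h1 := hT t ((le_max_left _ _).trans ht)
  have h2 := key t ((le_max_right _ _).trans ht) x hx
  linarith
end

end Part6

section Part7

open Set Filter
open scoped Topology

/-- Constants for perturbed semi-waves. -/
structure WDat (d δ c : ℝ) (f Q Q1 : ℝ → ℝ) (β K p0 : ℝ) : Prop where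
  K0 : 0 < K
  p00 : 0 < p0
  Kp : K * p0 ≤ c / 2
  p1 : p0 ≤ 1 / 2
  Kd : d / δ < K
  low : ∀ z, 0 < z → ∀ p, 0 < p → p ≤ p0 → ∀ b, 0 ≤ b → b ≤ β →
    -(K * p) * Q1 z + b * p * (1 - Real.exp (-z)) - p * Real.exp (-z) * (c - K * p + d)
      + f (Q z) - f (Q z - p * (1 - Real.exp (-z))) < 0
  up : ∀ z, 0 < z → ∀ p, 0 < p → p ≤ p0 → ∀ b, 0 ≤ b → b ≤ β →
    0 < K * p * Q1 z - b * p * (1 - Real.exp (-z)) + p * Real.exp (-z) * (c + K * p + d)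
      + f (Q z) - f (Q z + p * (1 - Real.exp (-z)))

section
variable {d δ L β r T0 c K p0 : ℝ} {f Q Q1 : ℝ → ℝ} {u : ℝ → ℝ → ℝ} {g h : ℝ → ℝ}

lemma WDat.exists_of (F : FDat d δ f L β r) (D : QDat d δ c f Q Q1) :
    ∃ K p0, WDat d δ c f Q Q1 β K p0 := by
  have hd := F.hd
  have hδ := F.hδ
  have hc := D.hc
  have hL := F.L0
  have hβ := F.β0
  have hr := F.r0
  obtain ⟨Z0, hZ0⟩ := eventually_atTop.1 (D.Qlim.eventually_const_lt
    (show 1 - r / 2 < 1 by linarith))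
  obtain ⟨Z, hZ, hZp⟩ : ∃ Z, (∀ z, Z ≤ z → 1 - r / 2 < Q z) ∧ 0 ≤ Z :=
    ⟨max Z0 0, fun z hz => hZ0 z ((le_max_left _ _).trans hz), le_max_right _ _⟩
  obtain ⟨z1, hz1, hmin⟩ := (isCompact_Icc (a := 0) (b := Z)).exists_isMinOn
    ⟨0, le_rfl, hZp⟩ D.Q1cont.continuousOn
  have hm := D.Q1pos z1
  obtain ⟨K, hK⟩ : ∃ K, K = (β + L) / Q1 z1 + d / δ + 1 := ⟨_, rfl⟩
  have hq1 : 0 < (β + L) / Q1 z1 := by positivity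
  have hq2 : 0 < d / δ := by positivity
  have hK0 : 0 < K := by linarith
  have hKm : β + L < K * Q1 z1 := by
    have : (β + L) / Q1 z1 < K := by linarith
    rwa [div_lt_iff₀ hm] at this
  obtain ⟨p0, hp0⟩ : ∃ p0, p0 = min (min (r / 2) (δ / 2)) (min (c / (2 * K)) (1 / 2)) := ⟨_, rfl⟩
  have e1 : p0 ≤ r / 2 := hp0 ▸ (min_le_left _ _).trans (min_le_left _ _)
  have e2 : p0 ≤ δ / 2 := hp0 ▸ (min_le_left _ _).trans (min_le_right _ _)
  have e3 : p0 ≤ c / (2 * K) := hp0 ▸ (min_le_right _ _).trans (min_le_left _ _)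
  have e4 : p0 ≤ 1 / 2 := hp0 ▸ (min_le_right _ _).trans (min_le_right _ _)
  have e5 : 0 < p0 := by rw [hp0]; positivity
  have hKp : K * p0 ≤ c / 2 := by
    have := mul_le_mul_of_nonneg_left e3 hK0.le
    have e : K * (c / (2 * K)) = c / 2 := by field_simp
    linarith
  have common : ∀ z, 0 < z → ∀ p, 0 < p → p ≤ p0 → 0 < p * (1 - Real.exp (-z)) ∧
      p * (1 - Real.exp (-z)) < p ∧ 0 < Real.exp (-z) ∧ K * p ≤ c / 2 ∧ δ ≤ Q z ∧ Q z < 1 ∧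
      (z ≤ Z → K * p * Q1 z1 ≤ K * p * Q1 z) ∧ 0 < K * p * Q1 z := by
    intro z hz p hp hpp
    have h1 : 0 < Real.exp (-z) := Real.exp_pos _
    have h2 : Real.exp (-z) < 1 := by rw [Real.exp_lt_one_iff]; linarith
    refine ⟨mul_pos hp (by linarith), by nlinarith, h1, ?_, D.Qge hz.le, D.Qlt z, ?_, ?_⟩
    · exact (mul_le_mul_of_nonneg_left hpp hK0.le).trans hKp
    · intro hzZ
      exact mul_le_mul_of_nonneg_left (hmin ⟨hz.le, hzZ⟩) (by positivity)
    · exact mul_pos (by positivity) (D.Q1pos z)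
  refine ⟨K, p0, hK0, e5, hKp, e4, by linarith, ?_, ?_⟩
  · intro z hz p hp hpp b hb hbβ
    obtain ⟨c1, c2, c3, c4, c5, c6, c7, c8⟩ := common z hz p hp hpp
    obtain ⟨y, hy⟩ : ∃ y, y = p * (1 - Real.exp (-z)) := ⟨_, rfl⟩
    have ey : b * p * (1 - Real.exp (-z)) = b * y := by rw [hy]; ring
    rw [ey]
    rw [← hy] at c1 c2 ⊢
    have t1 : 0 < p * Real.exp (-z) * (c - K * p + d) :=
      mul_pos (by positivity) (by linarith)
    have t2 : b * y ≤ β * y := mul_le_mul_of_nonneg_right hbβ c1.le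
    rcases le_total z Z with hzZ | hzZ
    · have l1 := F.lip (Q z) ⟨by linarith, by linarith⟩ (Q z - y) ⟨by linarith, by linarith⟩
      have l2 := (le_abs_self _).trans l1
      rw [show Q z - (Q z - y) = y by ring, abs_of_pos c1] at l2
      have l3 := c7 hzZ
      have l4 : (β + L) * y ≤ (β + L) * p := mul_le_mul_of_nonneg_left c2.le (by linarith)
      have l5 : p * (β + L) < p * (K * Q1 z1) := mul_lt_mul_of_pos_left hKm hp
      linarith
    · have l1 := F.mono (Q z - y) (Q z) (by linarith [hZ z hzZ]) (by linarith) (by linarith)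
      rw [show Q z - (Q z - y) = y by ring] at l1
      have : 0 < β * y := by positivity
      linarith
  · intro z hz p hp hpp b hb hbβ
    obtain ⟨c1, c2, c3, c4, c5, c6, c7, c8⟩ := common z hz p hp hpp
    obtain ⟨y, hy⟩ : ∃ y, y = p * (1 - Real.exp (-z)) := ⟨_, rfl⟩
    have ey : b * p * (1 - Real.exp (-z)) = b * y := by rw [hy]; ring
    rw [ey]
    rw [← hy] at c1 c2 ⊢
    have t1 : 0 < p * Real.exp (-z) * (c + K * p + d) :=
      mul_pos (by positivity) (by positivity)
    have t2 : b * y ≤ β * y := mul_le_mul_of_nonneg_right hbβ c1.le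
    rcases le_total z Z with hzZ | hzZ
    · have l1 := F.lip (Q z + y) ⟨by linarith, by linarith⟩ (Q z) ⟨by linarith, by linarith⟩
      have l2 := (le_abs_self _).trans l1
      rw [show Q z + y - Q z = y by ring, abs_of_pos c1] at l2
      have l3 := c7 hzZ
      have l4 : (β + L) * y ≤ (β + L) * p := mul_le_mul_of_nonneg_left c2.le (by linarith)
      have l5 : p * (β + L) < p * (K * Q1 z1) := mul_lt_mul_of_pos_left hKm hp
      linarith
    · have l1 := F.mono (Q z) (Q z + y) (by linarith [hZ z hzZ]) (by linarith) (by linarith)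
      rw [show Q z + y - Q z = y by ring] at l1
      have : 0 < β * y := by positivity
      linarith

/-- Derivatives of `Q (H t - x) + σ p t (1 - exp (-(H t - x)))`. -/
lemma wave_derivs (D : QDat d δ c f Q Q1) {H p : ℝ → ℝ} {Hp pp t x : ℝ} (σ : ℝ)
    (hH : HasDerivAt H Hp t) (hp : HasDerivAt p pp t) :
    HasDerivAt (fun s => Q (H s - x) + σ * (p s * (1 - Real.exp (-(H s - x)))))
      (Q1 (H t - x) * Hp + σ * (pp * (1 - Real.exp (-(H t - x))) +
        p t * (Real.exp (-(H t - x)) * Hp))) t ∧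
    (∀ y, HasDerivAt (fun y => Q (H t - y) + σ * (p t * (1 - Real.exp (-(H t - y)))))
      (-Q1 (H t - y) - σ * (p t * Real.exp (-(H t - y)))) y) ∧
    (x < H t → HasDerivAt (fun y => -Q1 (H t - y) - σ * (p t * Real.exp (-(H t - y))))
      ((c * Q1 (H t - x) - f (Q (H t - x))) / d - σ * (p t * Real.exp (-(H t - x)))) x) := by
  refine ⟨?_, ?_, ?_⟩
  · have h1 : HasDerivAt (fun s => H s - x) Hp t := hH.sub_const x
    have h2 := HasDerivAt.comp t (D.Qder (H t - x)) h1
    have h3 := (hp.mul (h1.neg.exp.const_sub 1)).const_mul σ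
    refine (h2.add h3).congr_deriv ?_
    simp only [Pi.neg_apply]
    ring
  · intro y
    have h1 : HasDerivAt (fun y => H t - y) (-1) y := by
      simpa using (hasDerivAt_id y).const_sub (H t)
    have h2 := HasDerivAt.comp y (D.Qder (H t - y)) h1
    have h3 := ((h1.neg.exp.const_sub 1).const_mul (p t)).const_mul σ
    refine (h2.add h3).congr_deriv ?_
    simp only [Pi.neg_apply]
    ring
  · intro hx
    have h1 : HasDerivAt (fun y => H t - y) (-1) x := by
      simpa using (hasDerivAt_id x).const_sub (H t)
    have h2 := (HasDerivAt.comp x (D.Q1der (H t - x) (by linarith)) h1).neg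
    have h3 := ((h1.neg.exp).const_mul (p t)).const_mul σ
    refine (h2.sub h3).congr_deriv ?_
    simp only [Pi.neg_apply]
    ring

lemma half_le_zeta {z : ℝ} (hz : 1 ≤ z) : 1 / 2 < 1 - Real.exp (-z) := by
  have h1 : Real.exp (-z) * Real.exp z = 1 := by rw [← Real.exp_add]; simp
  have h2 := Real.add_one_lt_exp (x := z) (by linarith)
  have h3 := Real.exp_pos (-z)
  nlinarith

/-- Lower perturbed semi-wave. -/
lemma SolE.lower_wave (F : FDat d δ f L β r) (D : QDat d δ c f Q Q1)
    (W : WDat d δ c f Q Q1 β K p0) (S : SolE d δ f u g h T0) {T b : ℝ} {H p : ℝ → ℝ}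
    (hT : T0 ≤ T) (hb : 0 ≤ b) (hbβ : b ≤ β)
    (hp : ∀ t, HasDerivAt p (-b * p t) t) (hH : ∀ t, HasDerivAt H (c - K * p t) t)
    (hpp : ∀ t, T ≤ t → 0 < p t ∧ p t ≤ p0) (hH1 : ∀ t, T ≤ t → 1 ≤ H t)
    (hg : g T < 0) (hu0 : ∀ t, T ≤ t → 1 - p t / 2 ≤ u t 0)
    (h0 : H T < h T)
    (hU0 : ∀ x ∈ Icc 0 (H T), Q (H T - x) - p T * (1 - Real.exp (-(H T - x))) < u T x) :
    ∀ t, T ≤ t → H t < h t ∧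
      ∀ x ∈ Icc 0 (H t), Q (H t - x) - p t * (1 - Real.exp (-(H t - x))) < u t x := by
  have hHc : Continuous H := continuous_iff_continuousAt.2 fun t => (hH t).continuousAt
  have hpc : Continuous p := continuous_iff_continuousAt.2 fun t => (hp t).continuousAt
  have hQc : Continuous Q := D.Qcont
  have hd := F.hd
  have hδ := F.hδ
  intro t' ht'
  have key := S.sol.fb_lower F.hd F.hδ (T := T) (T' := t') (L := 0) (S.T0pos.le.trans hT) (H := H)
    (U := fun t x => Q (H t - x) + (-1) * (p t * (1 - Real.exp (-(H t - x))))) hHc (by fun_prop)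
    ?_ ?_ ?_ ?_ ?_ h0 ?_ ?_ ?_ t' ⟨ht', le_rfl⟩
  · refine ⟨key.1, fun x hx => ?_⟩
    have := key.2 x hx
    linarith
  · intro t ht
    have := S.ganti F (a := T) hT (b := t) (hT.trans ht.1) ht.1
    linarith
  · intro t ht; linarith [hH1 t ht.1]
  · intro t ht; exact S.above t (hT.trans ht.1)
  · intro t ht; simp [D.Q0]
  · intro t ht
    refine ⟨_, _, hH t, (wave_derivs D (x := 0) (-1) (hH t) (hp t)).2.1 (H t), ?_⟩
    simp only [sub_self, neg_zero, Real.exp_zero, D.Q10]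
    have h1 : -(d / δ) * (-(c * δ / d) - -1 * (p t * 1)) = c - d / δ * p t := by
      field_simp; ring
    rw [h1]
    have := mul_lt_mul_of_pos_right W.Kd (hpp t ht.1.le).1
    linarith
  · intro x hx
    have := hU0 x hx
    linarith
  · intro t ht
    have h1 := half_le_zeta (hH1 t ht.1)
    have h2 := (hpp t ht.1).1
    have h3 := D.Qlt (H t)
    have h4 := hu0 t ht.1
    simp only [sub_zero]
    nlinarith
  · intro t ht x hx _
    obtain ⟨w1, w2, w3⟩ := wave_derivs D (x := x) (-1) (hH t) (hp t)
    refine ⟨_, _, _, w1, Eventually.of_forall w2, w3 hx.2, ?_⟩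
    have h1 := W.low (H t - x) (by linarith [hx.2]) (p t) (hpp t ht.1.le).1 (hpp t ht.1.le).2 b hb hbβ
    have e : d * ((c * Q1 (H t - x) - f (Q (H t - x))) / d - -1 * (p t * Real.exp (-(H t - x)))) =
      c * Q1 (H t - x) - f (Q (H t - x)) + d * (p t * Real.exp (-(H t - x))) := by
      field_simp; ring
    rw [e]
    have e2 : Q (H t - x) + -1 * (p t * (1 - Real.exp (-(H t - x)))) =
      Q (H t - x) - p t * (1 - Real.exp (-(H t - x))) := by ring
    rw [e2]
    linarith

/-- Upper perturbed semi-wave. -/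
lemma Sol.upper_wave (F : FDat d δ f L β r) (D : QDat d δ c f Q Q1)
    (W : WDat d δ c f Q Q1 β K p0) (S : Sol d δ f u g h) {T b : ℝ} {H p : ℝ → ℝ}
    (hT : 0 ≤ T) (hb : 0 ≤ b) (hbβ : b ≤ β)
    (hp : ∀ t, HasDerivAt p (-b * p t) t) (hH : ∀ t, HasDerivAt H (c + K * p t) t)
    (hpp : ∀ t, T ≤ t → 0 < p t ∧ p t ≤ p0) (h0 : h T < H T)
    (hU0 : ∀ x ∈ Icc (g T) (h T), u T x < Q (H T - x) + p T * (1 - Real.exp (-(H T - x)))) :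
    ∀ t, T ≤ t → h t < H t ∧
      ∀ x ∈ Icc (g t) (h t), u t x < Q (H t - x) + p t * (1 - Real.exp (-(H t - x))) := by
  have hHc : Continuous H := continuous_iff_continuousAt.2 fun t => (hH t).continuousAt
  have hpc : Continuous p := continuous_iff_continuousAt.2 fun t => (hp t).continuousAt
  have hQc : Continuous Q := D.Qcont
  have hd := F.hd
  have hδ := F.hδ
  intro t' ht'
  have key := S.fb_upper F.hd F.hδ (T := T) (T' := t') hT (H := H)
    (U := fun t x => Q (H t - x) + 1 * (p t * (1 - Real.exp (-(H t - x))))) hHc (by fun_prop)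
    ?_ ?_ ?_ h0 ?_ ?_ t' ⟨ht', le_rfl⟩
  · refine ⟨key.1, fun x hx => ?_⟩
    have := key.2 x hx
    linarith
  · intro t ht x hx
    have h1 : 0 < H t - x := by linarith
    have h2 := D.Qmono h1
    rw [D.Q0] at h2
    have h3 : Real.exp (-(H t - x)) < 1 := by rw [Real.exp_lt_one_iff]; linarith
    have h4 : 0 < p t * (1 - Real.exp (-(H t - x))) := mul_pos (hpp t ht.1).1 (by linarith)
    linarith
  · intro t ht; simp [D.Q0]
  · intro t ht
    refine ⟨_, _, hH t, (wave_derivs D (x := 0) 1 (hH t) (hp t)).2.1 (H t), ?_⟩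
    simp only [sub_self, neg_zero, Real.exp_zero, D.Q10]
    have h1 : -(d / δ) * (-(c * δ / d) - 1 * (p t * 1)) = c + d / δ * p t := by
      field_simp; ring
    rw [h1]
    have := mul_lt_mul_of_pos_right W.Kd (hpp t ht.1.le).1
    linarith
  · intro x hx
    have := hU0 x hx
    linarith
  · intro t ht x hx _
    obtain ⟨w1, w2, w3⟩ := wave_derivs D (x := x) 1 (hH t) (hp t)
    refine ⟨_, _, _, w1, Eventually.of_forall w2, w3 hx, ?_⟩
    have h1 := W.up (H t - x) (by linarith) (p t) (hpp t ht.1.le).1 (hpp t ht.1.le).2 b hb hbβ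
    have e : d * ((c * Q1 (H t - x) - f (Q (H t - x))) / d - 1 * (p t * Real.exp (-(H t - x)))) =
      c * Q1 (H t - x) - f (Q (H t - x)) - d * (p t * Real.exp (-(H t - x))) := by
      field_simp
    rw [e]
    rw [one_mul]
    linarith
end

end Part7

section Part8

open Set Filter
open scoped Topology

section
variable {d δ L β r T0 c K p0 : ℝ} {f Q Q1 : ℝ → ℝ} {u : ℝ → ℝ → ℝ} {g h : ℝ → ℝ}

/-- Linear spreading of a plateau close to 1. -/
lemma SolE.flat_right (F : FDat d δ f L β r) (D : QDat d δ c f Q Q1)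
    (W : WDat d δ c f Q Q1 β K p0) (S : SolE d δ f u g h T0) {p : ℝ} (hp : 0 < p) (hpp : p ≤ p0) :
    ∃ T, T0 ≤ T ∧ ∀ t, T ≤ t → c / 2 * (t - T) ≤ h t ∧
      ∀ x ∈ Icc 0 (c / 2 * (t - T)), 1 - 2 * p ≤ u t x := by
  have hc := D.hc
  have hQ1 := D.Qlt 1
  obtain ⟨T1, hT1, n1⟩ := S.near_one F (ε := min (p / 2) (1 - Q 1))
    (lt_min (by linarith) (by linarith)) 1
  obtain ⟨T2, hT2, n2⟩ := S.large F 1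
  obtain ⟨Z0, hZ0⟩ := eventually_atTop.1 (D.Qlim.eventually_const_lt
    (show 1 - p < 1 by linarith))
  obtain ⟨Z, hZ, hZp⟩ : ∃ Z, (∀ z, Z ≤ z → 1 - p < Q z) ∧ 0 ≤ Z :=
    ⟨max Z0 0, fun z hz => hZ0 z ((le_max_left _ _).trans hz), le_max_right _ _⟩
  obtain ⟨T, hTa, hTb⟩ : ∃ T, T1 ≤ T ∧ T2 ≤ T := ⟨max T1 T2, le_max_left _ _, le_max_right _ _⟩
  have hKp : K * p ≤ c / 2 := (mul_le_mul_of_nonneg_left hpp W.K0.le).trans W.Kp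
  have m1 : min (p / 2) (1 - Q 1) ≤ p / 2 := min_le_left _ _
  have m2 : min (p / 2) (1 - Q 1) ≤ 1 - Q 1 := min_le_right _ _
  have n2T := n2 T hTb
  have key := S.lower_wave F D W (T := T) (b := 0) (H := fun t => 1 + (c - K * p) * (t - T))
    (p := fun _ => p) (hT1.trans hTa) le_rfl F.β0.le
    (fun t => by simpa using hasDerivAt_const t p)
    (fun t => by
      have h0 := (((hasDerivAt_id t).sub_const T).const_mul (c - K * p)).const_add 1
      refine h0.congr_deriv ?_
      ring)
    (fun t _ => ⟨hp, hpp⟩)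
    (fun t ht => by
      have : 0 ≤ (c - K * p) * (t - T) := mul_nonneg (by linarith) (by linarith)
      linarith)
    (by linarith)
    (fun t ht => by
      have := n1 t (hTa.trans ht) 0 ⟨by linarith, by linarith⟩
      linarith)
    (by simp only [sub_self, mul_zero, add_zero]; linarith)
    (by
      intro x hx
      simp only [sub_self, mul_zero, add_zero] at hx ⊢
      have h1 := n1 T hTa x ⟨by linarith [hx.1], hx.2⟩
      have h2 : Q (1 - x) ≤ Q 1 := D.Qmono.monotone (by linarith [hx.1])
      have h3 : Real.exp (-(1 - x)) ≤ 1 := by rw [Real.exp_le_one_iff]; linarith [hx.2]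
      have h4 : 0 ≤ p * (1 - Real.exp (-(1 - x))) := mul_nonneg hp.le (by linarith)
      linarith)
  have hcz : c / 2 * (2 * Z / c) = Z := by field_simp
  have hz2 : 0 ≤ 2 * Z / c := by positivity
  refine ⟨T + 2 * Z / c, by linarith, fun t ht => ?_⟩
  obtain ⟨k1, k2⟩ := key t (by linarith)
  have e1 : c / 2 * (t - (T + 2 * Z / c)) = c / 2 * (t - T) - Z := by rw [← sub_sub, mul_sub, hcz]
  have e2 : c / 2 * (t - T) ≤ (c - K * p) * (t - T) :=
    mul_le_mul_of_nonneg_right (by linarith) (by linarith)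
  rw [e1]
  refine ⟨by linarith, fun x hx => ?_⟩
  have h1 := k2 x ⟨hx.1, by linarith [hx.2]⟩
  have h2 := hZ (1 + (c - K * p) * (t - T) - x) (by linarith [hx.2])
  have h3 := Real.exp_pos (-(1 + (c - K * p) * (t - T) - x))
  have h4 := mul_pos hp h3
  linarith

lemma SolE.flat (F : FDat d δ f L β r) (D : QDat d δ c f Q Q1)
    (W : WDat d δ c f Q Q1 β K p0) (S : SolE d δ f u g h T0) {p : ℝ} (hp : 0 < p) (hpp : p ≤ p0) :
    ∃ T, T0 ≤ T ∧ ∀ t, T ≤ t → c / 2 * (t - T) ≤ h t ∧ g t ≤ -(c / 2 * (t - T)) ∧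
      ∀ x ∈ Icc (-(c / 2 * (t - T))) (c / 2 * (t - T)), 1 - 2 * p ≤ u t x := by
  have hc := D.hc
  obtain ⟨T1, hT1, h1⟩ := S.flat_right F D W hp hpp
  obtain ⟨T2, hT2, h2⟩ := S.refl.flat_right F D W hp hpp
  obtain ⟨T, hTa, hTb⟩ : ∃ T, T1 ≤ T ∧ T2 ≤ T := ⟨max T1 T2, le_max_left _ _, le_max_right _ _⟩
  refine ⟨T, hT1.trans hTa, fun t ht => ?_⟩
  obtain ⟨a1, a2⟩ := h1 t (hTa.trans ht)
  obtain ⟨b1, b2⟩ := h2 t (hTb.trans ht)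
  have e1 : c / 2 * (t - T) ≤ c / 2 * (t - T1) := mul_le_mul_of_nonneg_left (by linarith) (by linarith)
  have e2 : c / 2 * (t - T) ≤ c / 2 * (t - T2) := mul_le_mul_of_nonneg_left (by linarith) (by linarith)
  refine ⟨by linarith, by linarith, fun x hx => ?_⟩
  rcases le_total 0 x with h0 | h0
  · exact a2 x ⟨h0, hx.2.trans e1⟩
  · have := b2 (-x) ⟨by linarith, by linarith [hx.1]⟩
    simpa using this

lemma SolE.decay0 (F : FDat d δ f L β r) (D : QDat d δ c f Q Q1)
    (W : WDat d δ c f Q Q1 β K p0) (S : SolE d δ f u g h T0) :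
    ∃ b A T, 0 < b ∧ b ≤ β ∧ 0 < A ∧ T0 ≤ T ∧
      ∀ t, T ≤ t → 1 - A * Real.exp (-b * (t - T)) < u t 0 := by
  have hc := D.hc
  have hd := F.hd
  have hβ := F.β0
  have hr := F.r0
  obtain ⟨p, hp⟩ : ∃ p, p = min p0 (r / 6) := ⟨_, rfl⟩
  have p1 : 0 < p := by rw [hp]; exact lt_min W.p00 (by linarith)
  have p2 : p ≤ p0 := hp ▸ min_le_left _ _
  have p3 : p ≤ r / 6 := hp ▸ min_le_right _ _
  obtain ⟨T, hT, hfl⟩ := S.flat F D W p1 p2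
  obtain ⟨k, hk⟩ : ∃ k, k = c / 2 := ⟨_, rfl⟩
  have hkp : 0 < k := by linarith
  rw [← hk] at hfl
  obtain ⟨l, hl⟩ : ∃ l, l = min (min 1 (β / (2 * k))) (β / (2 * d)) := ⟨_, rfl⟩
  have l0 : 0 < l := by rw [hl]; positivity
  have l1 : l ≤ 1 := hl ▸ (min_le_left _ _).trans (min_le_left _ _)
  have l2 : l ≤ β / (2 * k) := hl ▸ (min_le_left _ _).trans (min_le_right _ _)
  have l3 : l ≤ β / (2 * d) := hl ▸ min_le_right _ _
  have lk : l * k ≤ β / 2 := by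
    rw [le_div_iff₀ (by positivity)] at l2; linarith
  have ld : d * l ^ 2 ≤ β / 2 := by
    rw [le_div_iff₀ (by positivity)] at l3
    have : d * l * l ≤ d * l * 1 := mul_le_mul_of_nonneg_left l1 (by positivity)
    nlinarith
  have lkp : 0 < l * k := by positivity
  have key : ∀ t, T ≤ t → ∀ x ∈ Icc (-(k * (t - T))) (k * (t - T)),
      1 - 2 * p * (Real.exp (-(l * k) * (t - T)) + Real.exp (l * (x - k * (t - T)))
        + Real.exp (l * (-x - k * (t - T)))) < u t x := by
    intro t' ht'
    refine S.sol.lower hd (T := T) (T' := t') (S.T0pos.le.trans hT)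
      (l := fun t => -(k * (t - T))) (r := fun t => k * (t - T))
      (U := fun t x => 1 - 2 * p * (Real.exp (-(l * k) * (t - T)) + Real.exp (l * (x - k * (t - T)))
        + Real.exp (l * (-x - k * (t - T))))) (by fun_prop) (by fun_prop) ?_ ?_ (by fun_prop)
      ?_ ?_ ?_ ?_ t' ⟨ht', le_rfl⟩
    · intro t ht; exact (hfl t ht.1).2.1
    · intro t ht; exact (hfl t ht.1).1
    · intro x hx
      have h1 := (hfl T le_rfl).2.2 x hx
      simp only [sub_self, mul_zero, neg_zero] at hx
      have hx0 : x = 0 := le_antisymm hx.2 hx.1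
      subst hx0
      simp only [sub_self, mul_zero, neg_zero, Real.exp_zero]
      linarith
    · intro t ht hlr
      have h1 := (hfl t ht.1.le).2.2 _ ⟨le_rfl, hlr⟩
      have h2 := Real.exp_pos (-(l * k) * (t - T))
      have h3 := Real.exp_pos (l * (-(k * (t - T)) - k * (t - T)))
      have h4 : Real.exp (l * (-(-(k * (t - T))) - k * (t - T))) = 1 := by
        rw [show l * (-(-(k * (t - T))) - k * (t - T)) = 0 by ring, Real.exp_zero]
      rw [h4]
      have := mul_pos p1 (add_pos h2 h3)
      linarith
    · intro t ht hlr
      have h1 := (hfl t ht.1.le).2.2 _ ⟨hlr, le_rfl⟩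
      have h2 := Real.exp_pos (-(l * k) * (t - T))
      have h3 := Real.exp_pos (l * (-(k * (t - T)) - k * (t - T)))
      have h4 : Real.exp (l * (k * (t - T) - k * (t - T))) = 1 := by
        rw [show l * (k * (t - T) - k * (t - T)) = 0 by ring, Real.exp_zero]
      rw [h4]
      have := mul_pos p1 (add_pos h2 h3)
      linarith
    · intro t ht x hx _
      have d1 : ∀ s, HasDerivAt (fun s => Real.exp (-(l * k) * (s - T)))
          (-(l * k) * Real.exp (-(l * k) * (s - T))) s := fun s => by
        have h0 := ((((hasDerivAt_id s).sub_const T).const_mul (-(l * k)))).exp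
        refine h0.congr_deriv ?_
        simp; ring
      have d2 : ∀ s, HasDerivAt (fun s => Real.exp (l * (x - k * (s - T))))
          (-(l * k) * Real.exp (l * (x - k * (s - T)))) s := fun s => by
        have h0 := (((((hasDerivAt_id s).sub_const T).const_mul k).const_sub x).const_mul l).exp
        refine h0.congr_deriv ?_
        simp; ring
      have d3 : ∀ s, HasDerivAt (fun s => Real.exp (l * (-x - k * (s - T))))
          (-(l * k) * Real.exp (l * (-x - k * (s - T)))) s := fun s => by
        have h0 := (((((hasDerivAt_id s).sub_const T).const_mul k).const_sub (-x)).const_mul l).exp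
        refine h0.congr_deriv ?_
        simp; ring
      have x2 : ∀ y, HasDerivAt (fun y => Real.exp (l * (y - k * (t - T))))
          (l * Real.exp (l * (y - k * (t - T)))) y := fun y => by
        have h0 := (((hasDerivAt_id y).sub_const (k * (t - T))).const_mul l).exp
        refine h0.congr_deriv ?_
        simp; ring
      have x3 : ∀ y, HasDerivAt (fun y => Real.exp (l * (-y - k * (t - T))))
          (-l * Real.exp (l * (-y - k * (t - T)))) y := fun y => by
        have h0 := (((hasDerivAt_neg y).sub_const (k * (t - T))).const_mul l).exp
        refine h0.congr_deriv ?_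
        simp; ring
      refine ⟨_, _, fun y => -(2 * p * (l * Real.exp (l * (y - k * (t - T)))
          + -l * Real.exp (l * (-y - k * (t - T))))),
        ((((d1 t).add (d2 t)).add (d3 t)).const_mul (2 * p)).const_sub 1, ?_,
        ((((x2 x).const_mul l).add ((x3 x).const_mul (-l))).const_mul (2 * p)).neg, ?_⟩
      · refine Eventually.of_forall fun y => ?_
        have h0 := ((((hasDerivAt_const y (Real.exp (-(l * k) * (t - T)))).add (x2 y)).add
          (x3 y)).const_mul (2 * p)).const_sub 1
        refine h0.congr_deriv ?_
        ring
      · have q1 := Real.exp_pos (-(l * k) * (t - T))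
        have q2 := Real.exp_pos (l * (x - k * (t - T)))
        have q3 := Real.exp_pos (l * (-x - k * (t - T)))
        have r1 : Real.exp (-(l * k) * (t - T)) ≤ 1 := by
          rw [Real.exp_le_one_iff]; nlinarith [ht.1]
        have r2 : Real.exp (l * (x - k * (t - T))) ≤ 1 := by
          rw [Real.exp_le_one_iff]; nlinarith [hx.2]
        have r3 : Real.exp (l * (-x - k * (t - T))) ≤ 1 := by
          rw [Real.exp_le_one_iff]; nlinarith [hx.1]
        generalize Real.exp (-(l * k) * (t - T)) = E1 at *
        generalize Real.exp (l * (x - k * (t - T))) = E2 at *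
        generalize Real.exp (l * (-x - k * (t - T))) = E3 at *
        have v1 : 0 < 2 * p * (E1 + E2 + E3) := by positivity
        have v2 : 2 * p * (E1 + E2 + E3) ≤ r := by
          have : 2 * p * (E1 + E2 + E3) ≤ 2 * p * 3 := mul_le_mul_of_nonneg_left (by linarith) (by positivity)
          linarith
        have hm := F.mono (1 - 2 * p * (E1 + E2 + E3)) 1 (by linarith) (by linarith) (by linarith)
        rw [F.f1] at hm
        have w1 : l * k * (2 * p * (E1 + E2 + E3)) ≤ β / 2 * (2 * p * (E1 + E2 + E3)) :=
          mul_le_mul_of_nonneg_right lk v1.le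
        have w2 : d * l ^ 2 * (2 * p * (E2 + E3)) ≤ β / 2 * (2 * p * (E2 + E3)) :=
          mul_le_mul_of_nonneg_right ld (by positivity)
        have w3 : β / 2 * (2 * p * (E2 + E3)) ≤ β / 2 * (2 * p * (E1 + E2 + E3)) := by
          refine mul_le_mul_of_nonneg_left ?_ (by positivity)
          have := mul_pos p1 q1
          linarith
        have w4 := mul_pos hβ v1
        linarith
  refine ⟨l * k, 6 * p, T, lkp, by linarith, by linarith, hT, fun t ht => ?_⟩
  have h0 : 0 ≤ k * (t - T) := mul_nonneg hkp.le (by linarith)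
  have h1 := key t ht 0 ⟨by linarith, h0⟩
  have e1 : l * (0 - k * (t - T)) = -(l * k) * (t - T) := by ring
  have e2 : l * (-0 - k * (t - T)) = -(l * k) * (t - T) := by ring
  rw [e1, e2] at h1
  linarith

/-- Exponential decay at the origin. -/
lemma SolE.decay (F : FDat d δ f L β r) (D : QDat d δ c f Q Q1)
    (W : WDat d δ c f Q Q1 β K p0) (S : SolE d δ f u g h T0) :
    ∃ b, 0 < b ∧ b ≤ β ∧ ∀ A, 0 < A → ∃ T2, T0 ≤ T2 ∧ ∀ T, T2 ≤ T → ∀ t, T ≤ t →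
      1 - A * Real.exp (-b * (t - T)) / 2 ≤ u t 0 := by
  obtain ⟨b, A0, T1, hb, hbβ, hA0, hT1, key⟩ := S.decay0 F D W
  refine ⟨b, hb, hbβ, fun A hA => ?_⟩
  have hlim : Tendsto (fun t : ℝ => A0 * Real.exp (-b * (t - T1))) atTop (𝓝 (A0 * 0)) := by
    refine Tendsto.const_mul A0 (Real.tendsto_exp_atBot.comp ?_)
    exact Tendsto.const_mul_atTop_of_neg (by linarith) (tendsto_atTop_add_const_right _ (-T1) tendsto_id)
  rw [mul_zero] at hlim
  obtain ⟨T2, hT2⟩ := eventually_atTop.1 (hlim.eventually_lt_const (show 0 < A / 2 by linarith))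
  refine ⟨max T2 T1, hT1.trans (le_max_right _ _), fun T hT t ht => ?_⟩
  have h1 := hT2 T ((le_max_left _ _).trans hT)
  have h2 := key t (((le_max_right _ _).trans hT).trans ht)
  have e : A0 * Real.exp (-b * (t - T1)) =
      A0 * Real.exp (-b * (T - T1)) * Real.exp (-b * (t - T)) := by
    rw [mul_assoc, ← Real.exp_add]; congr 2; ring
  have h3 := mul_lt_mul_of_pos_right h1 (Real.exp_pos (-b * (t - T)))
  linarith
end

end Part8

section Part9

open Set Filter
open scoped Topology

/-- Asymptotic lower bound by the semi-wave with shift `a`. -/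
def LowA (c : ℝ) (Q : ℝ → ℝ) (u : ℝ → ℝ → ℝ) (h : ℝ → ℝ) (a : ℝ) : Prop :=
  ∀ ε, 0 < ε → ∃ T, ∀ t, T ≤ t → c * t + a - ε ≤ h t ∧
    ∀ x ∈ Icc 0 (h t), Q (c * t + a - x) - ε ≤ u t x

/-- Asymptotic upper bound by the semi-wave with shift `a`. -/
def UppA (c : ℝ) (Q : ℝ → ℝ) (u : ℝ → ℝ → ℝ) (g h : ℝ → ℝ) (a : ℝ) : Prop :=
  ∀ ε, 0 < ε → ∃ T, ∀ t, T ≤ t → h t ≤ c * t + a + ε ∧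
    ∀ x ∈ Icc (g t) (h t), u t x ≤ Q (c * t + a - x) + ε

section
variable {d δ L β r T0 c K p0 : ℝ} {f Q Q1 : ℝ → ℝ} {u : ℝ → ℝ → ℝ} {g h : ℝ → ℝ}

lemma exp_decay_small {b : ℝ} (hb : 0 < b) (A T : ℝ) {ε : ℝ} (hε : 0 < ε) :
    ∃ T2, ∀ t, T2 ≤ t → A * Real.exp (-b * (t - T)) < ε := by
  have hlim : Tendsto (fun t : ℝ => A * Real.exp (-b * (t - T))) atTop (𝓝 (A * 0)) := by
    refine Tendsto.const_mul A (Real.tendsto_exp_atBot.comp ?_)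
    exact Tendsto.const_mul_atTop_of_neg (by linarith) (tendsto_atTop_add_const_right _ (-T) tendsto_id)
  rw [mul_zero] at hlim
  exact eventually_atTop.1 (hlim.eventually_lt_const hε)

/-- Restart of the lower wave. -/
lemma SolE.lowA_of (F : FDat d δ f L β r) (D : QDat d δ c f Q Q1)
    (W : WDat d δ c f Q Q1 β K p0) (S : SolE d δ f u g h T0) {T b A H0 : ℝ}
    (hT : T0 ≤ T) (hb : 0 < b) (hbβ : b ≤ β) (hA : 0 < A) (hAp : A ≤ p0) (hH0 : 1 ≤ H0)
    (hg : g T < 0) (hdec : ∀ t, T ≤ t → 1 - A * Real.exp (-b * (t - T)) / 2 ≤ u t 0)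
    (h0 : H0 < h T)
    (hU0 : ∀ x ∈ Icc 0 H0, Q (H0 - x) - A * (1 - Real.exp (-(H0 - x))) < u T x) :
    LowA c Q u h (H0 - c * T - K * A / b) := by
  have hK := W.K0
  have hexp : ∀ t, T ≤ t → 0 < Real.exp (-b * (t - T)) ∧ Real.exp (-b * (t - T)) ≤ 1 := fun t ht =>
    ⟨Real.exp_pos _, by rw [Real.exp_le_one_iff]; nlinarith⟩
  have hq : 0 < K * A / b := by positivity
  have key := S.lower_wave F D W (T := T) (b := b)
    (H := fun t => H0 + c * (t - T) - K * A / b * (1 - Real.exp (-b * (t - T))))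
    (p := fun t => A * Real.exp (-b * (t - T))) hT hb.le hbβ
    (fun t => hasDerivAt_expdecay A b T t)
    (fun t => by
      have h1 := (((hasDerivAt_id t).sub_const T).const_mul c).const_add H0
      have h2 := ((hasDerivAt_expdecay 1 b T t).const_sub 1).const_mul (K * A / b)
      have h3 := h1.sub h2
      simp only [one_mul] at h3
      refine h3.congr_deriv ?_
      field_simp)
    (fun t ht => by
      obtain ⟨e1, e2⟩ := hexp t ht
      exact ⟨by positivity, by nlinarith⟩)
    (fun t ht => by
      have h1 := Real.add_one_le_exp (-b * (t - T))
      have h2 : K * A / b * (1 - Real.exp (-b * (t - T))) ≤ K * A / b * (b * (t - T)) :=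
        mul_le_mul_of_nonneg_left (by linarith) hq.le
      have h3 : K * A / b * (b * (t - T)) = K * A * (t - T) := by field_simp
      have h4 : K * A * (t - T) ≤ c * (t - T) := by
        refine mul_le_mul_of_nonneg_right ?_ (by linarith)
        have := mul_le_mul_of_nonneg_left hAp hK.le
        linarith [W.Kp, D.hc]
      linarith)
    hg hdec
    (by simpa using h0)
    (by simpa using hU0)
  intro ε hε
  obtain ⟨T2, hT2⟩ := exp_decay_small hb A T hε
  refine ⟨max T T2, fun t ht => ?_⟩
  have htT : T ≤ t := (le_max_left _ _).trans ht
  obtain ⟨k1, k2⟩ := key t htT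
  obtain ⟨e1, e2⟩ := hexp t htT
  have e3 : 0 < K * A / b * Real.exp (-b * (t - T)) := by positivity
  have hle : c * t + (H0 - c * T - K * A / b) ≤
      H0 + c * (t - T) - K * A / b * (1 - Real.exp (-b * (t - T))) := by linarith
  refine ⟨by linarith, fun x hx => ?_⟩
  rcases le_total x (H0 + c * (t - T) - K * A / b * (1 - Real.exp (-b * (t - T)))) with h1 | h1
  · have h2 := k2 x ⟨hx.1, h1⟩
    have h3 : Q (c * t + (H0 - c * T - K * A / b) - x) ≤
      Q (H0 + c * (t - T) - K * A / b * (1 - Real.exp (-b * (t - T))) - x) :=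
      D.Qmono.monotone (by linarith)
    have h4 := hT2 t ((le_max_right _ _).trans ht)
    have h5 : 0 < A * Real.exp (-b * (t - T)) *
      Real.exp (-(H0 + c * (t - T) - K * A / b * (1 - Real.exp (-b * (t - T))) - x)) := by positivity
    linarith
  · have h3 : Q (c * t + (H0 - c * T - K * A / b) - x) ≤ Q 0 := D.Qmono.monotone (by linarith)
    rw [D.Q0] at h3
    have hg' := S.ganti F (a := T) hT (b := t) (hT.trans htT) htT
    have h4 := S.ge (hT.trans htT) x ⟨by linarith [hx.1], hx.2⟩
    linarith

/-- Restart of the upper wave. -/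
lemma Sol.uppA_of (F : FDat d δ f L β r) (D : QDat d δ c f Q Q1)
    (W : WDat d δ c f Q Q1 β K p0) (S : Sol d δ f u g h) {T b A H0 : ℝ}
    (hT : 0 ≤ T) (hb : 0 < b) (hbβ : b ≤ β) (hA : 0 < A) (hAp : A ≤ p0)
    (h0 : h T < H0)
    (hU0 : ∀ x ∈ Icc (g T) (h T), u T x < Q (H0 - x) + A * (1 - Real.exp (-(H0 - x)))) :
    UppA c Q u g h (H0 - c * T + K * A / b) := by
  have hK := W.K0
  have hexp : ∀ t, T ≤ t → 0 < Real.exp (-b * (t - T)) ∧ Real.exp (-b * (t - T)) ≤ 1 := fun t ht =>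
    ⟨Real.exp_pos _, by rw [Real.exp_le_one_iff]; nlinarith⟩
  have hq : 0 < K * A / b := by positivity
  have key := S.upper_wave F D W (T := T) (b := b)
    (H := fun t => H0 + c * (t - T) + K * A / b * (1 - Real.exp (-b * (t - T))))
    (p := fun t => A * Real.exp (-b * (t - T))) hT hb.le hbβ
    (fun t => hasDerivAt_expdecay A b T t)
    (fun t => by
      have h1 := (((hasDerivAt_id t).sub_const T).const_mul c).const_add H0
      have h2 := ((hasDerivAt_expdecay 1 b T t).const_sub 1).const_mul (K * A / b)
      have h3 := h1.add h2
      simp only [one_mul] at h3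
      refine h3.congr_deriv ?_
      field_simp)
    (fun t ht => by
      obtain ⟨e1, e2⟩ := hexp t ht
      exact ⟨by positivity, by nlinarith⟩)
    (by simpa using h0)
    (by simpa using hU0)
  intro ε hε
  obtain ⟨T2, hT2⟩ := exp_decay_small hb A T hε
  refine ⟨max T T2, fun t ht => ?_⟩
  have htT : T ≤ t := (le_max_left _ _).trans ht
  obtain ⟨k1, k2⟩ := key t htT
  obtain ⟨e1, e2⟩ := hexp t htT
  have e3 : 0 < K * A / b * Real.exp (-b * (t - T)) := by positivity
  have hle : H0 + c * (t - T) + K * A / b * (1 - Real.exp (-b * (t - T))) ≤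
    c * t + (H0 - c * T + K * A / b) := by linarith
  refine ⟨by linarith, fun x hx => ?_⟩
  have h2 := k2 x hx
  have h3 : Q (H0 + c * (t - T) + K * A / b * (1 - Real.exp (-b * (t - T))) - x) ≤
    Q (c * t + (H0 - c * T + K * A / b) - x) := D.Qmono.monotone (by linarith)
  have h4 := hT2 t ((le_max_right _ _).trans ht)
  have h5 : 0 < A * Real.exp (-b * (t - T)) *
    Real.exp (-(H0 + c * (t - T) + K * A / b * (1 - Real.exp (-b * (t - T))) - x)) := by positivity
  linarith

lemma SolE.lowA_exists (F : FDat d δ f L β r) (D : QDat d δ c f Q Q1)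
    (W : WDat d δ c f Q Q1 β K p0) (S : SolE d δ f u g h T0) : ∃ a, LowA c Q u h a := by
  obtain ⟨b, hb, hbβ, hdec⟩ := S.decay F D W
  obtain ⟨T2, hT2, h2⟩ := hdec p0 W.p00
  have hQ1 := D.Qlt 1
  obtain ⟨T1, hT1, n1⟩ := S.near_one F (ε := 1 - Q 1) (by linarith) 1
  obtain ⟨T3, hT3, n3⟩ := S.large F 1
  obtain ⟨T, ha, hb', hc'⟩ : ∃ T, T1 ≤ T ∧ T2 ≤ T ∧ T3 ≤ T :=
    ⟨max T1 (max T2 T3), le_max_left _ _, (le_max_left _ _).trans (le_max_right _ _),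
      (le_max_right _ _).trans (le_max_right _ _)⟩
  have n3T := n3 T hc'
  refine ⟨_, S.lowA_of F D W (T := T) (b := b) (A := p0) (H0 := 1) (hT1.trans ha) hb hbβ W.p00 le_rfl
    le_rfl (by linarith) (h2 T hb') n3T.1 ?_⟩
  intro x hx
  have h1 := n1 T ha x ⟨by linarith [hx.1], hx.2⟩
  have h2 : Q (1 - x) ≤ Q 1 := D.Qmono.monotone (by linarith [hx.1])
  have h3 : Real.exp (-(1 - x)) ≤ 1 := by rw [Real.exp_le_one_iff]; linarith [hx.2]
  have h4 : 0 ≤ p0 * (1 - Real.exp (-(1 - x))) := mul_nonneg W.p00.le (by linarith)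
  linarith

lemma Sol.uppA_exists (F : FDat d δ f L β r) (D : QDat d δ c f Q Q1)
    (W : WDat d δ c f Q Q1 β K p0) (S : Sol d δ f u g h) : ∃ a, UppA c Q u g h a := by
  have hp0 := W.p00
  obtain ⟨T, hT, h1⟩ := S.upper_one F (ε := p0 / 4) (by linarith)
  obtain ⟨Z0, hZ0⟩ := eventually_atTop.1 (D.Qlim.eventually_const_lt
    (show 1 - p0 / 4 < 1 by linarith))
  obtain ⟨Z, hZ, hZp⟩ : ∃ Z, (∀ z, Z ≤ z → 1 - p0 / 4 < Q z) ∧ 1 ≤ Z :=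
    ⟨max Z0 1, fun z hz => hZ0 z ((le_max_left _ _).trans hz), le_max_right _ _⟩
  refine ⟨_, S.uppA_of F D W (T := T) (b := β) (A := p0) (H0 := h T + Z) hT F.β0 le_rfl hp0 le_rfl
    (by linarith) ?_⟩
  intro x hx
  have a1 := h1 T le_rfl x hx
  have a2 := hZ (h T + Z - x) (by linarith [hx.2])
  have a3 := half_le_zeta (z := h T + Z - x) (by linarith [hx.2])
  nlinarith

lemma SolE.lowA_closed (F : FDat d δ f L β r) (D : QDat d δ c f Q Q1)
    (S : SolE d δ f u g h T0) {a : ℝ}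
    (ha : ∀ e, 0 < e → ∃ a', a - e < a' ∧ LowA c Q u h a') : LowA c Q u h a := by
  obtain ⟨M, hM, lip⟩ := D.lip
  intro ε hε
  obtain ⟨e, he⟩ : ∃ e, e = min 1 (min (ε / 2) (ε / (2 * M))) := ⟨_, rfl⟩
  have e0 : 0 < e := by rw [he]; positivity
  have e1 : e ≤ 1 := he ▸ min_le_left _ _
  have e2 : e ≤ ε / 2 := he ▸ (min_le_right _ _).trans (min_le_left _ _)
  have e3 : e ≤ ε / (2 * M) := he ▸ (min_le_right _ _).trans (min_le_right _ _)
  have e4 : M * e ≤ ε / 2 := by rw [le_div_iff₀ (by positivity)] at e3; linarith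
  obtain ⟨a', ha', hl⟩ := ha e e0
  obtain ⟨T1, h1⟩ := hl (ε / 2) (by linarith)
  obtain ⟨T2, hT2, h2⟩ := S.large F 0
  refine ⟨max T1 T2, fun t ht => ?_⟩
  obtain ⟨k1, k2⟩ := h1 t ((le_max_left _ _).trans ht)
  have k3 := h2 t ((le_max_right _ _).trans ht)
  refine ⟨by linarith, fun x hx => ?_⟩
  rcases le_total (c * t + a - x) 0 with hz | hz
  · have h3 : Q (c * t + a - x) ≤ Q 0 := D.Qmono.monotone hz
    rw [D.Q0] at h3
    have h4 := S.ge (hT2.trans ((le_max_right _ _).trans ht)) x ⟨by linarith [hx.1], hx.2⟩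
    linarith
  · have h3 := k2 x hx
    have h5 : Q (c * t + a - x) - Q (c * t + a - e - x) ≤ M * e := by
      have := lip (c * t + a - e - x) (c * t + a - x) (by linarith) (by linarith)
      rwa [show c * t + a - x - (c * t + a - e - x) = e by ring] at this
    have h6 : Q (c * t + a - e - x) ≤ Q (c * t + a' - x) := D.Qmono.monotone (by linarith)
    linarith

lemma UppA.closed (D : QDat d δ c f Q Q1) {a : ℝ}
    (ha : ∀ e, 0 < e → ∃ a', a' < a + e ∧ UppA c Q u g h a') : UppA c Q u g h a := by
  obtain ⟨M, hM, lip⟩ := D.lip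
  intro ε hε
  obtain ⟨e, he⟩ : ∃ e, e = min (1 / 2) (min (ε / 2) (ε / (2 * M))) := ⟨_, rfl⟩
  have e0 : 0 < e := by rw [he]; positivity
  have e1 : e ≤ 1 / 2 := he ▸ min_le_left _ _
  have e2 : e ≤ ε / 2 := he ▸ (min_le_right _ _).trans (min_le_left _ _)
  have e3 : e ≤ ε / (2 * M) := he ▸ (min_le_right _ _).trans (min_le_right _ _)
  have e4 : M * e ≤ ε / 2 := by rw [le_div_iff₀ (by positivity)] at e3; linarith
  obtain ⟨a', ha', hl⟩ := ha e e0
  obtain ⟨T1, h1⟩ := hl e e0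
  refine ⟨T1, fun t ht => ?_⟩
  obtain ⟨k1, k2⟩ := h1 t ht
  refine ⟨by linarith, fun x hx => ?_⟩
  have h3 := k2 x hx
  have h5 : Q (c * t + a + e - x) - Q (c * t + a - x) ≤ M * e := by
    have := lip (c * t + a - x) (c * t + a + e - x) (by linarith [hx.2]) (by linarith)
    rwa [show c * t + a + e - x - (c * t + a - x) = e by ring] at this
  have h6 : Q (c * t + a' - x) ≤ Q (c * t + a + e - x) := D.Qmono.monotone (by linarith)
  linarith

lemma LowA.le_uppA {a a' : ℝ} (hl : LowA c Q u h a) (hu : UppA c Q u g h a') : a ≤ a' := by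
  by_contra hcon
  push Not at hcon
  obtain ⟨T1, h1⟩ := hl ((a - a') / 3) (by linarith)
  obtain ⟨T2, h2⟩ := hu ((a - a') / 3) (by linarith)
  have k1 := (h1 (max T1 T2) (le_max_left _ _)).1
  have k2 := (h2 (max T1 T2) (le_max_right _ _)).1
  linarith

/-- Derivatives of the exponential perturbation. -/
lemma sq_derivs (D : QDat d δ c f Q Q1) (σ η l μ T a e t x : ℝ) :
    HasDerivAt (fun s => Q (c * s + a - x) +
        σ * (η * (Real.exp (l * (μ * (s - T) - (c * s + a - x))) - 1) - e))
      (c * Q1 (c * t + a - x) +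
        σ * (η * (l * (μ - c) * Real.exp (l * (μ * (t - T) - (c * t + a - x)))))) t ∧
    (∀ y, HasDerivAt (fun y => Q (c * t + a - y) +
        σ * (η * (Real.exp (l * (μ * (t - T) - (c * t + a - y))) - 1) - e))
      (-Q1 (c * t + a - y) + σ * (η * (l * Real.exp (l * (μ * (t - T) - (c * t + a - y)))))) y) ∧
    (x < c * t + a → HasDerivAt (fun y => -Q1 (c * t + a - y) +
        σ * (η * (l * Real.exp (l * (μ * (t - T) - (c * t + a - y))))))
      ((c * Q1 (c * t + a - x) - f (Q (c * t + a - x))) / d +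
        σ * (η * (l ^ 2 * Real.exp (l * (μ * (t - T) - (c * t + a - x)))))) x) := by
  have hx1 : ∀ y, HasDerivAt (fun y => c * t + a - y) (-1) y := fun y => by
    simpa using (hasDerivAt_id y).const_sub (c * t + a)
  have hE : ∀ y, HasDerivAt (fun y => Real.exp (l * (μ * (t - T) - (c * t + a - y))))
      (l * Real.exp (l * (μ * (t - T) - (c * t + a - y)))) y := fun y => by
    have := (((hx1 y).const_sub (μ * (t - T))).const_mul l).exp
    refine this.congr_deriv ?_
    ring
  refine ⟨?_, ?_, ?_⟩
  · have h1 : HasDerivAt (fun s => c * s + a - x) c t := by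
      have := (((hasDerivAt_id t).const_mul c).add_const a).sub_const x
      refine this.congr_deriv ?_
      ring
    have h2 := HasDerivAt.comp t (D.Qder (c * t + a - x)) h1
    have h3 : HasDerivAt (fun s => μ * (s - T)) μ t := by
      have := ((hasDerivAt_id t).sub_const T).const_mul μ
      refine this.congr_deriv ?_
      ring
    have h4 := ((((((h3.sub h1).const_mul l).exp).sub_const 1).const_mul η).sub_const e).const_mul σ
    refine (h2.add h4).congr_deriv ?_
    simp only [Pi.sub_apply]
    ring
  · intro y
    have h2 := HasDerivAt.comp y (D.Qder (c * t + a - y)) (hx1 y)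
    have h4 := ((((hE y).sub_const 1).const_mul η).sub_const e).const_mul σ
    refine (h2.add h4).congr_deriv ?_
    ring
  · intro hx
    have h2 := (HasDerivAt.comp x (D.Q1der (c * t + a - x) (by linarith)) (hx1 x)).neg
    have h4 := (((hE x).const_mul l).const_mul η).const_mul σ
    refine (h2.add h4).congr_deriv ?_
    ring

/-- Choice of parameters of the exponential perturbation. -/
lemma FDat.params (F : FDat d δ f L β r) {R τ Y : ℝ} (hR : 0 < R) (hτ : 0 < τ) (hY : 0 < Y) :
    ∃ l η, 0 < l ∧ 0 < η ∧ L + l * ((R + 1) / τ) < d * l ^ 2 ∧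
      η * Real.exp (l * (R + 1)) = Y := by
  have hd := F.hd
  have hL := F.L0
  have hμ : 0 < (R + 1) / τ := by positivity
  generalize (R + 1) / τ = μ at *
  refine ⟨(μ + L) / d + 1, Y / Real.exp (((μ + L) / d + 1) * (R + 1)), by positivity, by positivity,
    ?_, ?_⟩
  · have h1 : 0 < (μ + L) / d := by positivity
    have h2 : d * ((μ + L) / d + 1) = μ + L + d := by field_simp
    generalize (μ + L) / d + 1 = l at *
    have h3 : d * l ^ 2 = l * (μ + L + d) := by rw [← h2]; ring
    rw [h3]
    have h4 : 1 ≤ l := by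
      by_contra hcon
      push Not at hcon
      nlinarith
    nlinarith
  · have := Real.exp_pos (((μ + L) / d + 1) * (R + 1))
    field_simp
end

end Part9

section Part10

open Set Filter
open scoped Topology

section
variable {d δ L β r T0 c K p0 : ℝ} {f Q Q1 : ℝ → ℝ} {u : ℝ → ℝ → ℝ} {g h : ℝ → ℝ}

/-- Key inequality at touching points. -/
lemma push_ineq (F : FDat d δ f L β r) {μ l η P e q y : ℝ} (hc : 0 < c)
    (hl0 : 0 < l) (hη : 0 < η) (hP : 0 < P)
    (hl : L + l * μ < d * l ^ 2) (he : 0 < e) (h1 : e / 2 ≤ η * (P - 1))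
    (hq : q ∈ Icc (0:ℝ) 2) (hy : y ∈ Icc (0:ℝ) 2) (hyq : |y - q| = |η * (P - 1) - e|) :
    |f y - f q| < η * (d * l ^ 2 * P) - η * (l * (μ - c) * P) := by
  have hL := F.L0
  have h2 := F.lip y hy q hq
  rw [hyq] at h2
  have h3 : |η * (P - 1) - e| ≤ η * P := by
    rw [abs_le]; constructor <;> nlinarith
  have h4 : L * |η * (P - 1) - e| ≤ L * (η * P) := mul_le_mul_of_nonneg_left h3 hL.le
  have h5 : 0 < η * P := by positivity
  have h6 := mul_lt_mul_of_pos_right hl h5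
  have h7 : 0 < l * c * (η * P) := by positivity
  nlinarith

lemma exp_convex {Λ w : ℝ} (h0 : 0 ≤ w) (h1 : w ≤ 1) :
    Real.exp (w * Λ) - 1 ≤ w * Real.exp Λ := by
  have := convexOn_exp.2 (mem_univ Λ) (mem_univ 0) h0 (by linarith : 0 ≤ 1 - w) (by ring)
  simp only [smul_eq_mul, mul_zero, add_zero, Real.exp_zero, mul_one] at this
  linarith

lemma SolE.lower_push (F : FDat d δ f L β r) (D : QDat d δ c f Q Q1)
    (S : SolE d δ f u g h T0) {T τ R η l e a : ℝ} (hT : T0 ≤ T) (hτ : 0 < τ) (hR : 0 < R)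
    (hl0 : 0 < l) (hη : 0 < η) (hl : L + l * ((R + 1) / τ) < d * l ^ 2)
    (hY : η * Real.exp (l * (R + 1)) ≤ 1 / 2) (he : 0 < e) (heδ : e ≤ δ)
    (hg : ∀ t ∈ Icc T (T + τ), g t ≤ c * t + a - R - 1)
    (h0 : ∀ t ∈ Icc T (T + τ), 0 ≤ c * t + a - R - 1)
    (hh : ∀ t ∈ Icc T (T + τ), c * t + a ≤ h t)
    (hu : ∀ t ∈ Icc T (T + τ), ∀ x ∈ Icc 0 (h t), Q (c * t + a - x) - e / 2 ≤ u t x)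
    (hz : ∀ t ∈ Icc T (T + τ), δ + (t - T) / τ * (η * Real.exp (l * (R + 1))) ≤ u t (c * t + a)) :
    ∀ x ∈ Icc (c * (T + τ) + a - R - 1) (c * (T + τ) + a),
      Q (c * (T + τ) + a - x) + (η * (Real.exp (l * (R + 1 - (c * (T + τ) + a - x))) - 1) - e)
        < u (T + τ) x := by
  have hd := F.hd
  have hδ1 := F.hδ1
  have hc := D.hc
  have hQc : Continuous Q := D.Qcont
  obtain ⟨μ, hμ⟩ : ∃ μ, μ = (R + 1) / τ := ⟨_, rfl⟩
  have hμτ : μ * τ = R + 1 := by rw [hμ]; field_simp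
  have hμ0 : 0 < μ := by rw [hμ]; positivity
  rw [← hμ] at hl
  have hs : ∀ t ∈ Icc T (T + τ), 0 ≤ μ * (t - T) ∧ μ * (t - T) ≤ R + 1 := by
    intro t ht
    refine ⟨mul_nonneg hμ0.le (by linarith [ht.1]), ?_⟩
    rw [← hμτ]
    exact mul_le_mul_of_nonneg_left (by linarith [ht.2]) hμ0.le
  have hmem : T + τ ∈ Icc T (T + τ) := ⟨by linarith, le_rfl⟩
  have hmem0 : T ∈ Icc T (T + τ) := ⟨le_rfl, by linarith⟩
  have key := S.sol.lower hd (T := T) (T' := T + τ) (S.T0pos.le.trans hT)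
    (l := fun t => c * t + a - R - 1) (r := fun t => c * t + a)
    (U := fun t x => Q (c * t + a - x) +
        1 * (η * (Real.exp (l * (μ * (t - T) - (c * t + a - x))) - 1) - e))
    (by fun_prop) (by fun_prop) hg hh (by fun_prop) ?_ ?_ ?_ ?_ (T + τ) hmem
  · intro x hx
    have := key x hx
    rw [show μ * (T + τ - T) = R + 1 by rw [← hμτ]; ring, one_mul] at this
    exact this
  · intro x hx
    have h1 := hu T hmem0 x ⟨(h0 T hmem0).trans hx.1, hx.2.trans (hh T hmem0)⟩
    have h2 : Real.exp (l * (μ * (T - T) - (c * T + a - x))) ≤ 1 := by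
      rw [Real.exp_le_one_iff, sub_self, mul_zero]
      nlinarith [hx.2]
    nlinarith
  · intro t ht _
    have ht' : t ∈ Icc T (T + τ) := ⟨ht.1.le, ht.2⟩
    have h1 := hu t ht' _ ⟨h0 t ht', by linarith [hh t ht']⟩
    have h2 : Real.exp (l * (μ * (t - T) - (c * t + a - (c * t + a - R - 1)))) ≤ 1 := by
      rw [Real.exp_le_one_iff]
      nlinarith [(hs t ht').2]
    nlinarith
  · intro t ht _
    have ht' : t ∈ Icc T (T + τ) := ⟨ht.1.le, ht.2⟩
    have h1 := hz t ht'
    have h2 := exp_convex (Λ := l * (R + 1)) (w := (t - T) / τ) (div_nonneg (by linarith [ht.1]) hτ.le)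
      (by rw [div_le_one hτ]; linarith [ht.2])
    have e1 : (t - T) / τ * (l * (R + 1)) = l * (μ * (t - T) - (c * t + a - (c * t + a))) := by
      rw [hμ]; field_simp; ring
    rw [e1] at h2
    simp only [sub_self, D.Q0] at h2 ⊢
    have h3 := mul_le_mul_of_nonneg_left h2 hη.le
    linarith
  · intro t ht x hx eq
    have ht' : t ∈ Icc T (T + τ) := ⟨ht.1.le, ht.2⟩
    obtain ⟨w1, w2, w3⟩ := sq_derivs D 1 η l μ T a e t x
    refine ⟨_, _, _, w1, Eventually.of_forall w2, w3 hx.2, ?_⟩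
    have h1 := hu t ht' x ⟨(h0 t ht').trans hx.1.le, hx.2.le.trans (hh t ht')⟩
    have hP : Real.exp (l * (μ * (t - T) - (c * t + a - x))) ≤ Real.exp (l * (R + 1)) := by
      rw [Real.exp_le_exp]
      refine mul_le_mul_of_nonneg_left ?_ hl0.le
      linarith [(hs t ht').2, hx.2]
    have hP0 := Real.exp_pos (l * (μ * (t - T) - (c * t + a - x)))
    have q1 := D.Qge (z := c * t + a - x) (by linarith [hx.2])
    have q2 := D.Qlt (c * t + a - x)
    generalize Real.exp (l * (μ * (t - T) - (c * t + a - x))) = P at *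
    have hP1 := mul_le_mul_of_nonneg_left hP hη.le
    have h2 : e / 2 ≤ η * (P - 1) := by linarith
    have hi := push_ineq F (q := Q (c * t + a - x)) (y := Q (c * t + a - x) + 1 * (η * (P - 1) - e))
      hc hl0 hη hP0 hl he h2 ⟨by linarith [F.hδ], by linarith⟩ ⟨by linarith, by linarith⟩ (by congr 1; ring)
    have hi2 := (abs_lt.1 hi).1
    have e2 : d * ((c * Q1 (c * t + a - x) - f (Q (c * t + a - x))) / d + 1 * (η * (l ^ 2 * P))) =
      c * Q1 (c * t + a - x) - f (Q (c * t + a - x)) + η * (d * l ^ 2 * P) := by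
      field_simp
    rw [e2]
    linarith

lemma Sol.upper_push (F : FDat d δ f L β r) (D : QDat d δ c f Q Q1)
    (S : Sol d δ f u g h) {T τ R η l e a l0 : ℝ} (hT : 0 ≤ T) (hτ : 0 < τ) (hR : 0 < R)
    (hl00 : 0 < l0)
    (hl0 : 0 < l) (hη : 0 < η) (hl : L + l * ((R + 1) / τ) < d * l ^ 2)
    (hY : η * Real.exp (l * (R + 1)) ≤ Q l0 - δ) (he : 0 < e) (heδ : e ≤ 1)
    (hg : ∀ t ∈ Icc T (T + τ), g t ≤ c * t + a - R - 1)
    (hh : ∀ t ∈ Icc T (T + τ), h t ≤ c * t + a - l0)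
    (hu : ∀ t ∈ Icc T (T + τ), ∀ x ∈ Icc (g t) (h t), u t x ≤ Q (c * t + a - x) + e / 2) :
    ∀ x ∈ Icc (c * (T + τ) + a - R - 1) (h (T + τ)),
      u (T + τ) x < Q (c * (T + τ) + a - x) -
        (η * (Real.exp (l * (R + 1 - (c * (T + τ) + a - x))) - 1) - e) := by
  have hd := F.hd
  have hδ := F.hδ
  have hδ1 := F.hδ1
  have hc := D.hc
  have hQc : Continuous Q := D.Qcont
  obtain ⟨μ, hμ⟩ : ∃ μ, μ = (R + 1) / τ := ⟨_, rfl⟩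
  have hμτ : μ * τ = R + 1 := by rw [hμ]; field_simp
  have hμ0 : 0 < μ := by rw [hμ]; positivity
  rw [← hμ] at hl
  have hs : ∀ t ∈ Icc T (T + τ), 0 ≤ μ * (t - T) ∧ μ * (t - T) ≤ R + 1 := by
    intro t ht
    refine ⟨mul_nonneg hμ0.le (by linarith [ht.1]), ?_⟩
    rw [← hμτ]
    exact mul_le_mul_of_nonneg_left (by linarith [ht.2]) hμ0.le
  have hmem : T + τ ∈ Icc T (T + τ) := ⟨by linarith, le_rfl⟩
  have hmem0 : T ∈ Icc T (T + τ) := ⟨le_rfl, by linarith⟩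
  have hPle : ∀ t ∈ Icc T (T + τ), ∀ x, x ≤ h t →
      Real.exp (l * (μ * (t - T) - (c * t + a - x))) ≤ Real.exp (l * (R + 1)) := by
    intro t ht x hx
    rw [Real.exp_le_exp]
    refine mul_le_mul_of_nonneg_left ?_ hl0.le
    linarith [(hs t ht).2, hh t ht]
  have key := S.upper hd (T := T) (T' := T + τ) hT
    (l := fun t => c * t + a - R - 1) (r := h)
    (U := fun t x => Q (c * t + a - x) +
        (-1) * (η * (Real.exp (l * (μ * (t - T) - (c * t + a - x))) - 1) - e))
    (by fun_prop) (S.hcont.mono fun t ht => hT.trans ht.1) hg (fun _ _ => le_rfl) (by fun_prop)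
    ?_ ?_ ?_ ?_ (T + τ) hmem
  · intro x hx
    have := key x hx
    rw [show μ * (T + τ - T) = R + 1 by rw [← hμτ]; ring] at this
    linarith
  · intro x hx
    have h1 := hu T hmem0 x ⟨(hg T hmem0).trans hx.1, hx.2⟩
    have h2 : Real.exp (l * (μ * (T - T) - (c * T + a - x))) ≤ 1 := by
      rw [Real.exp_le_one_iff, sub_self, mul_zero]
      nlinarith [hx.2, hh T hmem0]
    nlinarith
  · intro t ht hlr
    have ht' : t ∈ Icc T (T + τ) := ⟨ht.1.le, ht.2⟩
    have h1 := hu t ht' _ ⟨hg t ht', hlr⟩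
    have h2 : Real.exp (l * (μ * (t - T) - (c * t + a - (c * t + a - R - 1)))) ≤ 1 := by
      rw [Real.exp_le_one_iff]
      nlinarith [(hs t ht').2]
    nlinarith
  · intro t ht _
    have ht' : t ∈ Icc T (T + τ) := ⟨ht.1.le, ht.2⟩
    rw [S.bh t (hT.trans ht.1.le)]
    have h1 := hPle t ht' (h t) le_rfl
    have h2 : Q l0 ≤ Q (c * t + a - h t) := D.Qmono.monotone (by linarith [hh t ht'])
    have h3 := mul_le_mul_of_nonneg_left h1 hη.le
    linarith
  · intro t ht x hx eq
    have ht' : t ∈ Icc T (T + τ) := ⟨ht.1.le, ht.2⟩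
    have hht := hh t ht'
    obtain ⟨w1, w2, w3⟩ := sq_derivs D (-1) η l μ T a e t x
    refine ⟨_, _, _, w1, Eventually.of_forall w2, w3 (by linarith [hx.2]), ?_⟩
    have h1 := hu t ht' x ⟨(hg t ht').trans hx.1.le, hx.2.le⟩
    have hP := hPle t ht' x hx.2.le
    have hP0 := Real.exp_pos (l * (μ * (t - T) - (c * t + a - x)))
    have q1 : Q l0 ≤ Q (c * t + a - x) := D.Qmono.monotone (by linarith [hx.2])
    have q2 := D.Qlt (c * t + a - x)
    generalize Real.exp (l * (μ * (t - T) - (c * t + a - x))) = P at *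
    have hP1 := mul_le_mul_of_nonneg_left hP hη.le
    have h2 : e / 2 ≤ η * (P - 1) := by linarith
    have hi := push_ineq F (q := Q (c * t + a - x)) (y := Q (c * t + a - x) + (-1) * (η * (P - 1) - e))
      hc hl0 hη hP0 hl he h2 ⟨by linarith [D.Qge hl00.le], by linarith⟩ ⟨by linarith, by linarith⟩
      (by rw [← abs_neg]; congr 1; ring)
    have hi2 := (abs_lt.1 hi).2
    have e2 : d * ((c * Q1 (c * t + a - x) - f (Q (c * t + a - x))) / d + (-1) * (η * (l ^ 2 * P))) =
      c * Q1 (c * t + a - x) - f (Q (c * t + a - x)) - η * (d * l ^ 2 * P) := by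
      field_simp
      ring
    rw [e2]
    linarith
end

end Part10

section Part11

open Set Filter
open scoped Topology

section
variable {d δ L β r T0 c K p0 : ℝ} {f Q Q1 : ℝ → ℝ} {u : ℝ → ℝ → ℝ} {g h : ℝ → ℝ}

lemma QDat.tail (D : QDat d δ c f Q Q1) {η : ℝ} (hη : 0 < η) :
    ∃ Z, 1 ≤ Z ∧ ∀ x y, Z ≤ x → x ≤ y → Q y - Q x ≤ η * (y - x) := by
  obtain ⟨z1, hz1⟩ := eventually_atTop.1 (D.Q1lim.eventually_lt_const hη)
  refine ⟨max z1 1, le_max_right _ _, fun x y hx hxy => ?_⟩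
  refine (convex_Ici (max z1 1)).image_sub_le_mul_sub_of_deriv_le D.Qcont.continuousOn
    (fun z _ => (D.Qder z).differentiableAt.differentiableWithinAt) (fun z hz => ?_) x hx y
    (hx.trans hxy) hxy
  rw [(D.Qder z).deriv]
  exact (hz1 z ((le_max_left _ _).trans (interior_subset hz))).le

lemma linear_large (hc : 0 < c) (a X : ℝ) : ∃ T, ∀ t, T ≤ t → X ≤ c * t + a := by
  refine ⟨(X - a) / c, fun t ht => ?_⟩
  rw [div_le_iff₀ hc] at ht
  linarith

lemma SolE.uppA_squeeze (F : FDat d δ f L β r) (D : QDat d δ c f Q Q1)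
    (W : WDat d δ c f Q Q1 β K p0) (S : SolE d δ f u g h T0) {a l0 : ℝ}
    (hU : UppA c Q u g h a) (hl0 : 0 < l0) (hev : ∃ T, ∀ t, T ≤ t → h t ≤ c * t + a - l0) :
    ∃ a', a' < a ∧ UppA c Q u g h a' := by
  have hβ := F.β0
  have hK := W.K0
  have hp0 := W.p00
  obtain ⟨M, hM, lip⟩ := D.lip
  obtain ⟨η1, hη1⟩ : ∃ η1, η1 = β / (8 * K) := ⟨_, rfl⟩
  have η1p : 0 < η1 := by rw [hη1]; positivity
  obtain ⟨Z, hZ1, hZ⟩ := D.tail η1p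
  obtain ⟨R, hR⟩ : ∃ R, R = Z + 1 := ⟨_, rfl⟩
  have hRp : 0 < R := by linarith
  have hQl : δ < Q l0 := by have := D.Qmono hl0; rwa [D.Q0] at this
  obtain ⟨l, η, hl, hη, hcond, hYe⟩ := F.params (R := R) (τ := 1) (Y := Q l0 - δ) hRp one_pos
    (by linarith)
  have hel : 1 < Real.exp l := by rw [Real.one_lt_exp_iff]; exact hl
  obtain ⟨κ, hκ⟩ : ∃ κ, κ = η * (Real.exp l - 1) / 2 := ⟨_, rfl⟩
  have hκp : 0 < κ := by rw [hκ]; exact div_pos (mul_pos hη (by linarith)) two_pos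
  obtain ⟨e, he⟩ : ∃ e, e = min κ 1 := ⟨_, rfl⟩
  have e0 : 0 < e := by rw [he]; positivity
  have e1 : e ≤ κ := he ▸ min_le_left _ _
  have e2 : e ≤ 1 := he ▸ min_le_right _ _
  obtain ⟨σ, hσ⟩ : ∃ σ, σ = min (min (l0 / 2) 1) (min (κ / (2 * M)) (p0 / (4 * η1))) := ⟨_, rfl⟩
  have s0 : 0 < σ := by rw [hσ]; positivity
  have s1 : σ ≤ l0 / 2 := hσ ▸ (min_le_left _ _).trans (min_le_left _ _)
  have s2 : σ ≤ 1 := hσ ▸ (min_le_left _ _).trans (min_le_right _ _)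
  have s3 : M * σ ≤ κ / 2 := by
    have : σ ≤ κ / (2 * M) := hσ ▸ (min_le_right _ _).trans (min_le_left _ _)
    rw [le_div_iff₀ (by positivity)] at this; linarith
  have s4 : 4 * η1 * σ ≤ p0 := by
    have : σ ≤ p0 / (4 * η1) := hσ ▸ (min_le_right _ _).trans (min_le_right _ _)
    rw [le_div_iff₀ (by positivity)] at this; linarith
  have hησ : 0 < η1 * σ := by positivity
  obtain ⟨T1, h1⟩ := hU (min (e / 2) (η1 * σ / 2)) (by positivity)
  have m1 : min (e / 2) (η1 * σ / 2) ≤ e / 2 := min_le_left _ _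
  have m2 : min (e / 2) (η1 * σ / 2) ≤ η1 * σ / 2 := min_le_right _ _
  obtain ⟨T2, h2⟩ := hev
  obtain ⟨T3, hT3, h3⟩ := S.large F 0
  obtain ⟨T4, h4⟩ := linear_large D.hc a (R + 1)
  obtain ⟨T, t1, t2, t3, t4⟩ : ∃ T, T1 ≤ T ∧ T2 ≤ T ∧ T3 ≤ T ∧ T4 ≤ T :=
    ⟨max (max T1 T2) (max T3 T4), (le_max_left _ _).trans (le_max_left _ _),
      (le_max_right _ _).trans (le_max_left _ _), (le_max_left _ _).trans (le_max_right _ _),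
      (le_max_right _ _).trans (le_max_right _ _)⟩
  have hTp : 0 ≤ T := S.T0pos.le.trans (hT3.trans t3)
  have push := S.sol.upper_push F D (T := T) (τ := 1) (R := R) (η := η) (l := l) (e := e) (a := a)
    (l0 := l0) hTp one_pos hRp hl0 hl hη hcond hYe.le e0 e2
    (fun t ht => by
      have a1 := (h3 t (t3.trans ht.1)).2
      have a2 := h4 t (t4.trans ht.1)
      linarith)
    (fun t ht => h2 t (t2.trans ht.1))
    (fun t ht x hx => by
      have := (h1 t (t1.trans ht.1)).2 x hx
      linarith)
  obtain ⟨T', hT'⟩ : ∃ T', T' = T + 1 := ⟨_, rfl⟩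
  rw [← hT'] at push
  have hTT : T ≤ T' := by linarith
  have b1 := h1 T' (t1.trans hTT)
  have b2 := h2 T' (t2.trans hTT)
  have res := S.sol.uppA_of F D W (T := T') (b := β) (A := 4 * η1 * σ) (H0 := c * T' + a - σ)
    (hTp.trans hTT) hβ le_rfl (by positivity) s4 (by linarith) (by
      intro x hx
      have hz : l0 ≤ c * T' + a - x := by linarith [hx.2]
      obtain ⟨z, hzd⟩ : ∃ z, z = c * T' + a - x := ⟨_, rfl⟩
      rw [show c * T' + a - σ - x = z - σ by rw [hzd]; ring]
      rw [← hzd] at hz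
      rcases le_total z R with hzR | hzR
      · have k1 := push x ⟨by linarith, hx.2⟩
        rw [← hzd] at k1
        have k2 : Real.exp l ≤ Real.exp (l * (R + 1 - z)) := by
          rw [Real.exp_le_exp]; nlinarith
        have k3 : η * (Real.exp l - 1) ≤ η * (Real.exp (l * (R + 1 - z)) - 1) :=
          mul_le_mul_of_nonneg_left (by linarith) hη.le
        have k4 := lip (z - σ) z (by linarith) (by linarith)
        rw [show z - (z - σ) = σ by ring] at k4
        have k5 : Real.exp (-(z - σ)) ≤ 1 := by rw [Real.exp_le_one_iff]; linarith
        have k6 : 0 ≤ 4 * η1 * σ * (1 - Real.exp (-(z - σ))) := mul_nonneg (by positivity) (by linarith)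
        linarith
      · have k1 := b1.2 x hx
        rw [← hzd] at k1
        have k4 := hZ (z - σ) z (by linarith) (by linarith)
        rw [show z - (z - σ) = σ by ring] at k4
        have k5 := half_le_zeta (z := z - σ) (by linarith)
        have k6 : 4 * η1 * σ * (1 / 2) ≤ 4 * η1 * σ * (1 - Real.exp (-(z - σ))) :=
          mul_le_mul_of_nonneg_left k5.le (by positivity)
        linarith)
  refine ⟨_, ?_, res⟩
  have e3 : K * (4 * η1 * σ) / β = σ / 2 := by rw [hη1]; field_simp; ring
  rw [e3]
  linarith

set_option maxHeartbeats 1000000 in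
lemma SolE.lowA_squeeze (F : FDat d δ f L β r) (D : QDat d δ c f Q Q1)
    (W : WDat d δ c f Q Q1 β K p0) (S : SolE d δ f u g h T0) {a l0 : ℝ}
    (hU : LowA c Q u h a) (hl0 : 0 < l0) (hfr : ∀ T, ∃ t, T ≤ t ∧ c * t + a + l0 ≤ h t) :
    ∃ a', a < a' ∧ LowA c Q u h a' := by
  have hβ := F.β0
  have hK := W.K0
  have hp0 := W.p00
  have hδ := F.hδ
  have hδ1 := F.hδ1
  have hd := F.hd
  have hc := D.hc
  obtain ⟨M, hM, lip⟩ := D.lip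
  obtain ⟨b, hb, hbβ, hdec⟩ := S.decay F D W
  obtain ⟨η1, hη1⟩ : ∃ η1, η1 = b / (8 * K) := ⟨_, rfl⟩
  have η1p : 0 < η1 := by rw [hη1]; positivity
  obtain ⟨R, hR1, hZ⟩ := D.tail η1p
  have hRp : 0 < R := by linarith
  -- the parabola
  obtain ⟨m, hm, hmf⟩ := F.fmin (y := (1 + δ) / 2) (by linarith) (by linarith)
  obtain ⟨τ, hτ⟩ : ∃ τ, τ = l0 / (8 * c) := ⟨_, rfl⟩
  have τp : 0 < τ := by rw [hτ]; positivity
  have hcτ : c * τ = l0 / 8 := by rw [hτ]; field_simp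
  obtain ⟨ρ, hρ⟩ : ∃ ρ, ρ = 1 + 2 * d * τ / (l0 / 2) ^ 2 := ⟨_, rfl⟩
  have ρp : 0 < ρ := by rw [hρ]; positivity
  obtain ⟨κ, hκ⟩ : ∃ κ, κ = min ((1 - δ) / (2 * τ)) (m / (2 * ρ)) := ⟨_, rfl⟩
  have hδ1' : 0 < 1 - δ := by linarith
  have κp : 0 < κ := by rw [hκ]; positivity
  have κ1 : κ * τ ≤ (1 - δ) / 2 := by
    have : κ ≤ (1 - δ) / (2 * τ) := hκ ▸ min_le_left _ _
    rw [le_div_iff₀ (by positivity)] at this; linarith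
  have κ2 : κ * ρ ≤ m / 2 := by
    have : κ ≤ m / (2 * ρ) := hκ ▸ min_le_right _ _
    rw [le_div_iff₀ (by positivity)] at this; linarith
  have κτ : 0 < κ * τ := by positivity
  obtain ⟨Y, hY⟩ : ∃ Y, Y = min (1 / 2) (3 / 4 * (κ * τ)) := ⟨_, rfl⟩
  have Yp : 0 < Y := by rw [hY]; positivity
  have Y1 : Y ≤ 1 / 2 := hY ▸ min_le_left _ _
  have Y2 : Y ≤ 3 / 4 * (κ * τ) := hY ▸ min_le_right _ _
  obtain ⟨l, η, hl, hη, hcond, hYe⟩ := F.params (R := R) (τ := τ) (Y := Y) hRp τp Yp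
  have hel : 1 < Real.exp l := by rw [Real.one_lt_exp_iff]; exact hl
  obtain ⟨k, hk⟩ : ∃ k, k = η * (Real.exp l - 1) / 2 := ⟨_, rfl⟩
  have hkp : 0 < k := by rw [hk]; exact div_pos (mul_pos hη (by linarith)) two_pos
  obtain ⟨e, he⟩ : ∃ e, e = min (min k δ) (l0 / 8) := ⟨_, rfl⟩
  have e0 : 0 < e := by rw [he]; positivity
  have e1 : e ≤ k := he ▸ (min_le_left _ _).trans (min_le_left _ _)
  have e2 : e ≤ δ := he ▸ (min_le_left _ _).trans (min_le_right _ _)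
  obtain ⟨σ, hσ⟩ : ∃ σ, σ = min (min (l0 / 8) (κ * τ / (2 * M))) (min (k / (2 * M)) (p0 / (4 * η1))) :=
    ⟨_, rfl⟩
  have s0 : 0 < σ := by rw [hσ]; positivity
  have s1 : σ ≤ l0 / 8 := hσ ▸ (min_le_left _ _).trans (min_le_left _ _)
  have s2 : M * σ ≤ κ * τ / 2 := by
    have : σ ≤ κ * τ / (2 * M) := hσ ▸ (min_le_left _ _).trans (min_le_right _ _)
    rw [le_div_iff₀ (by positivity)] at this; linarith
  have s3 : M * σ ≤ k / 2 := by
    have : σ ≤ k / (2 * M) := hσ ▸ (min_le_right _ _).trans (min_le_left _ _)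
    rw [le_div_iff₀ (by positivity)] at this; linarith
  have s4 : 4 * η1 * σ ≤ p0 := by
    have : σ ≤ p0 / (4 * η1) := hσ ▸ (min_le_right _ _).trans (min_le_right _ _)
    rw [le_div_iff₀ (by positivity)] at this; linarith
  have hησ : 0 < η1 * σ := by positivity
  obtain ⟨T1, h1⟩ := hU (min (e / 2) (η1 * σ / 2)) (by positivity)
  have m1 : min (e / 2) (η1 * σ / 2) ≤ e / 2 := min_le_left _ _
  have m2 : min (e / 2) (η1 * σ / 2) ≤ η1 * σ / 2 := min_le_right _ _
  obtain ⟨T2, hT2, h2⟩ := hdec (4 * η1 * σ) (by positivity)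
  obtain ⟨T3, hT3, h3⟩ := S.large F 0
  obtain ⟨T4, h4⟩ := linear_large hc a (R + 1 + l0)
  obtain ⟨T, hTm, hhT⟩ := hfr (max (max T1 T2) (max T3 T4))
  obtain ⟨t1, t2, t3, t4⟩ : T1 ≤ T ∧ T2 ≤ T ∧ T3 ≤ T ∧ T4 ≤ T :=
    ⟨((le_max_left _ _).trans (le_max_left _ _)).trans hTm,
      ((le_max_right _ _).trans (le_max_left _ _)).trans hTm,
      ((le_max_left _ _).trans (le_max_right _ _)).trans hTm,
      ((le_max_right _ _).trans (le_max_right _ _)).trans hTm⟩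
  have hT0T : T0 ≤ T := hT3.trans t3
  have gneg := fun t (ht : T ≤ t) => (h3 t (t3.trans ht)).2
  have hmon : ∀ t, T ≤ t → c * T + a + l0 ≤ h t := fun t ht =>
    hhT.trans (S.hmono F (a := T) hT0T (b := t) (hT0T.trans ht) ht)
  have lin : ∀ t ∈ Icc T (T + τ), c * T ≤ c * t ∧ c * t ≤ c * T + l0 / 8 := fun t ht => by
    refine ⟨mul_le_mul_of_nonneg_left ht.1 hc.le, ?_⟩
    have := mul_le_mul_of_nonneg_left ht.2 hc.le
    linarith
  have par := S.parabola F (T := T) (τ := τ) (κ := κ) (b := l0 / 2) (x0 := c * T + a) hT0T κp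
    (by linarith) (by
      have := gneg T le_rfl
      have := h4 T t4
      linarith) (by linarith) (by
      intro y hy
      have a1 := hmf y ⟨hy.1, by linarith [hy.2]⟩
      have a2 : κ + 2 * d * (κ * τ) / (l0 / 2) ^ 2 = κ * ρ := by rw [hρ]; ring
      rw [a2]
      linarith)
  have par2 : ∀ t ∈ Icc T (T + τ), ∀ x ∈ Icc (c * T + a) (c * T + a + l0 / 4),
      δ + κ * (t - T) * (3 / 4) < u t x := by
    intro t ht x hx
    have a1 := par t ht x ⟨by linarith [hx.1], by linarith [hx.2]⟩
    have a2 : (x - (c * T + a)) ^ 2 / (l0 / 2) ^ 2 ≤ 1 / 4 := by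
      rw [div_le_iff₀ (by positivity)]
      have b1 : 0 ≤ x - (c * T + a) := by linarith [hx.1]
      have b2 : x - (c * T + a) ≤ l0 / 4 := by linarith [hx.2]
      have b3 := pow_le_pow_left₀ b1 b2 2
      linarith
    have a3 : κ * (t - T) * (3 / 4) ≤ κ * (t - T) * (1 - (x - (c * T + a)) ^ 2 / (l0 / 2) ^ 2) :=
      mul_le_mul_of_nonneg_left (by linarith) (mul_nonneg κp.le (by linarith [ht.1]))
    linarith
  have push := S.lower_push F D (T := T) (τ := τ) (R := R) (η := η) (l := l) (e := e) (a := a)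
    hT0T τp hRp hl hη hcond (by rw [hYe]; exact Y1) e0 e2
    (fun t ht => by
      have a1 := gneg t ht.1
      have a2 := h4 t (t4.trans ht.1)
      linarith)
    (fun t ht => by
      have a2 := h4 t (t4.trans ht.1)
      linarith)
    (fun t ht => by
      have a1 := hmon t ht.1
      have a2 := lin t ht
      linarith)
    (fun t ht x hx => by
      have := (h1 t (t1.trans ht.1)).2 x hx
      linarith)
    (fun t ht => by
      rw [hYe]
      have a2 := lin t ht
      have a1 := par2 t ht (c * t + a) ⟨by linarith, by linarith⟩
      have a3 : (t - T) / τ * Y ≤ (t - T) / τ * (3 / 4 * (κ * τ)) :=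
        mul_le_mul_of_nonneg_left Y2 (div_nonneg (by linarith [ht.1]) τp.le)
      have a4 : (t - T) / τ * (3 / 4 * (κ * τ)) = κ * (t - T) * (3 / 4) := by field_simp
      linarith)
  have par3 := par2 (T + τ) ⟨by linarith, le_rfl⟩
  rw [show κ * (T + τ - T) = κ * τ by ring] at par3
  have lin3 := lin (T + τ) ⟨by linarith, le_rfl⟩
  obtain ⟨T', hT'⟩ : ∃ T', T' = T + τ := ⟨_, rfl⟩
  rw [← hT'] at push par3 lin3
  have hTT : T ≤ T' := by linarith
  have b1 := h1 T' (t1.trans hTT)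
  have b2 := hmon T' hTT
  have b4 := h4 T' (t4.trans hTT)
  have res := S.lowA_of F D W (T := T') (b := b) (A := 4 * η1 * σ) (H0 := c * T' + a + σ)
    (hT0T.trans hTT) hb hbβ (by positivity) s4 (by linarith) (by linarith [gneg T' hTT])
    (h2 T' (t2.trans hTT)) (by linarith) (by
      intro x hx
      obtain ⟨z, hzd⟩ : ∃ z, z = c * T' + a - x := ⟨_, rfl⟩
      have hzs : 0 ≤ z + σ := by rw [hzd]; linarith [hx.2]
      have hxh : x ≤ h T' := by linarith [hx.2]
      rw [show c * T' + a + σ - x = z + σ by rw [hzd]; ring]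
      have k5 : Real.exp (-(z + σ)) ≤ 1 := by rw [Real.exp_le_one_iff]; linarith
      have k6 : 0 ≤ 4 * η1 * σ * (1 - Real.exp (-(z + σ))) := mul_nonneg (by positivity) (by linarith)
      rcases le_total z 0 with hz0 | hz0
      · have k1 := par3 x ⟨by linarith, by linarith [hx.2]⟩
        have k2 : Q (z + σ) ≤ Q σ := D.Qmono.monotone (by linarith)
        have k4 := lip 0 σ (by linarith) s0.le
        rw [D.Q0, sub_zero] at k4
        linarith
      rcases le_total z R with hzR | hzR
      · have k1 := push x ⟨by linarith, by linarith⟩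
        rw [← hzd] at k1
        have k2 : Real.exp l ≤ Real.exp (l * (R + 1 - z)) := by
          rw [Real.exp_le_exp]; nlinarith
        have k3 : η * (Real.exp l - 1) ≤ η * (Real.exp (l * (R + 1 - z)) - 1) :=
          mul_le_mul_of_nonneg_left (by linarith) hη.le
        have k4 := lip z (z + σ) (by linarith) (by linarith)
        rw [show z + σ - z = σ by ring] at k4
        linarith
      · have k1 := b1.2 x ⟨hx.1, hxh⟩
        rw [← hzd] at k1
        have k4 := hZ z (z + σ) (by linarith) (by linarith)
        rw [show z + σ - z = σ by ring] at k4
        have k5 := half_le_zeta (z := z + σ) (by linarith)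
        have k6 : 4 * η1 * σ * (1 / 2) ≤ 4 * η1 * σ * (1 - Real.exp (-(z + σ))) :=
          mul_le_mul_of_nonneg_left k5.le (by positivity)
        linarith)
  refine ⟨_, ?_, res⟩
  have e3 : K * (4 * η1 * σ) / b = σ / 2 := by rw [hη1]; field_simp; ring
  rw [e3]
  linarith

/-- Convergence at the right front. -/
lemma SolE.conv (F : FDat d δ f L β r) (D : QDat d δ c f Q Q1)
    (W : WDat d δ c f Q Q1 β K p0) (S : SolE d δ f u g h T0) :
    ∀ ε, 0 < ε → ∃ T, ∀ t, T ≤ t → ∀ x ∈ Icc 0 (h t), |u t x - Q (h t - x)| < ε := by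
  obtain ⟨al, hal⟩ := S.lowA_exists F D W
  obtain ⟨au, hau⟩ := S.sol.uppA_exists F D W
  obtain ⟨a, hLub⟩ := (⟨_, isLUB_csSup (s := {a | LowA c Q u h a}) ⟨al, hal⟩
    ⟨au, fun y hy => LowA.le_uppA hy hau⟩⟩ : ∃ a, IsLUB {a | LowA c Q u h a} a)
  obtain ⟨a2, hGlb⟩ := (⟨_, isGLB_csInf (s := {a | UppA c Q u g h a}) ⟨au, hau⟩
    ⟨al, fun y hy => LowA.le_uppA hal hy⟩⟩ : ∃ a, IsGLB {a | UppA c Q u g h a} a)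
  have hLa : LowA c Q u h a := by
    refine S.lowA_closed F D fun e he => ?_
    obtain ⟨a', h1, h2⟩ := (lt_isLUB_iff hLub).1 (show a - e < a by linarith)
    exact ⟨a', h2, h1⟩
  have hUa : UppA c Q u g h a2 := by
    refine UppA.closed D fun e he => ?_
    obtain ⟨a', h1, h2⟩ := (isGLB_lt_iff hGlb).1 (show a2 < a2 + e by linarith)
    exact ⟨a', h2, h1⟩
  have hle := hLa.le_uppA hUa
  have hev : ∀ l, 0 < l → ∃ T, ∀ t, T ≤ t → h t ≤ c * t + a + l := by
    intro l hl
    by_contra hcon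
    push Not at hcon
    obtain ⟨a', h1, h2⟩ := S.lowA_squeeze F D W hLa hl (fun T => by
      obtain ⟨t, h1, h2⟩ := hcon T
      exact ⟨t, h1, h2.le⟩)
    have := hLub.1 h2
    linarith
  have heq : a2 = a := by
    by_contra hne
    have hlt : a < a2 := lt_of_le_of_ne hle (Ne.symm hne)
    obtain ⟨T, hT⟩ := hev ((a2 - a) / 2) (by linarith)
    obtain ⟨a', h1, h2⟩ := S.uppA_squeeze F D W hUa (l0 := (a2 - a) / 2) (by linarith)
      ⟨T, fun t ht => by have := hT t ht; linarith⟩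
    have := hGlb.1 h2
    linarith
  rw [heq] at hUa
  obtain ⟨M, hM, lip⟩ := D.lip
  intro ε hε
  obtain ⟨e, he⟩ : ∃ e, e = min 1 (min (ε / 3) (ε / (3 * M))) := ⟨_, rfl⟩
  have e0 : 0 < e := by rw [he]; positivity
  have e1 : e ≤ 1 := he ▸ min_le_left _ _
  have e2 : e ≤ ε / 3 := he ▸ (min_le_right _ _).trans (min_le_left _ _)
  have e3 : M * e ≤ ε / 3 := by
    have : e ≤ ε / (3 * M) := he ▸ (min_le_right _ _).trans (min_le_right _ _)
    rw [le_div_iff₀ (by positivity)] at this; linarith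
  obtain ⟨T1, h1⟩ := hLa e e0
  obtain ⟨T2, h2⟩ := hUa e e0
  obtain ⟨T3, hT3, h3⟩ := S.large F 0
  refine ⟨max T1 (max T2 T3), fun t ht x hx => ?_⟩
  obtain ⟨k1, k2⟩ := h1 t ((le_max_left _ _).trans ht)
  obtain ⟨k3, k4⟩ := h2 t (((le_max_left _ _).trans (le_max_right _ _)).trans ht)
  have k5 := h3 t (((le_max_right _ _).trans (le_max_right _ _)).trans ht)
  have a1 := k2 x hx
  have a2 := k4 x ⟨by linarith [hx.1], hx.2⟩
  rcases le_total (h t) (c * t + a) with hh | hh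
  · have b1 := lip (h t - x) (c * t + a - x) (by linarith [hx.2]) (by linarith)
    have b2 : M * (c * t + a - x - (h t - x)) ≤ M * e := mul_le_mul_of_nonneg_left (by linarith) hM.le
    have b3 : Q (h t - x) ≤ Q (c * t + a - x) := D.Qmono.monotone (by linarith)
    rw [abs_lt]; constructor <;> linarith
  · have b1 := lip (c * t + a - x) (h t - x) (by linarith [hx.2]) (by linarith)
    have b2 : M * (h t - x - (c * t + a - x)) ≤ M * e := mul_le_mul_of_nonneg_left (by linarith) hM.le
    have b3 : Q (c * t + a - x) ≤ Q (h t - x) := D.Qmono.monotone (by linarith)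
    rw [abs_lt]; constructor <;> linarith
end

end Part11

/-- convergence of the solution to the semi-wave profile at each front. -/
theorem profile_convergence (d δ h₀ θ θs c : ℝ) (f u₀ q : ℝ → ℝ)
    (u : ℝ → ℝ → ℝ) (g h : ℝ → ℝ)
    (hd : 0 < d) (hh₀ : 0 < h₀)
    (hf : AlleeType f θ) (hθs : IsThetaStar f θ θs) (hδ : δ ∈ Ioo θs 1)
    (hsw : SemiWavePair d δ f c q)
    (hu₀ : InX δ h₀ u₀)
    (hsol : ClassicalSolution d δ h₀ (fun _ _ v => f v) u₀ (Ici (0:ℝ)) u g h) :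
    ∀ ε > 0, ∃ T > 0, ∀ t ≥ T,
      (∀ x ∈ Icc 0 (h t), |u t x - q (h t - x)| < ε) ∧
      (∀ x ∈ Icc (g t) 0, |u t x - q (x - g t)| < ε) := by
  obtain ⟨L, β, r, F⟩ := FDat.exists_of hd hf hθs hδ
  obtain ⟨Q, Q1, D, hQ⟩ := QDat.exists_of F hsw
  obtain ⟨K, p0, W⟩ := WDat.exists_of F D
  have S := ClassicalSolution.toSol hh₀ hu₀ hsol
  obtain ⟨T0, hT0, hab⟩ := S.above F hf hθs hδ
  have SE : SolE d δ f u g h T0 := ⟨S, hT0, hab⟩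
  intro ε hε
  obtain ⟨T1, h1⟩ := SE.conv F D W ε hε
  obtain ⟨T2, h2⟩ := SE.refl.conv F D W ε hε
  refine ⟨max (max T1 T2) 1, lt_of_lt_of_le one_pos (le_max_right _ _), fun t ht => ⟨?_, ?_⟩⟩
  · intro x hx
    have h3 := h1 t (le_trans (le_trans (le_max_left _ _) (le_max_left _ _)) ht) x hx
    rwa [hQ _ (by linarith [hx.2])] at h3
  · intro x hx
    have h3 := h2 t (le_trans (le_trans (le_max_right _ _) (le_max_left _ _)) ht) (-x)
      ⟨by linarith [hx.2], by linarith [hx.1]⟩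
    have e : -g t - -x = x - g t := by ring
    simp only [neg_neg] at h3
    rw [e, hQ _ (by linarith [hx.1])] at h3
    exact h3
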